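/- Let q ≥ 2 be an integer, f_1, …, f_r be M_q-functions, and R a real number with 0 < R < 1. There exists a finite set S_R ⊂ ℚ̄ such that for every algebraic number α with 0 < |α| < R that is not a pole of any f_i, if there exists a non-banal homogeneous algebraic relation over ℚ̄ among f_1(α), …, f_r(α) (i.e., a homogeneous P ∈ ℚ̄[X_1,…,X_r] with P(f_1(α),…,f_r(α)) = 0 which is not banal), then α ∈ S_R. -/

import Mathlib

noncomputable section

/-- The derivative `d/dz` of a formal power series over `ℂ`. -/
def psD (f : PowerSeries ℂ) : PowerSeries ℂ :=
  PowerSeries.mk fun n => ((n : ℂ) + 1) * PowerSeries.coeff (n + 1) f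

/-- The Mahler operator `σ_q : f(z) ↦ f(z^q)` on formal power series over `ℂ`. -/
def psSigma (q : ℕ) (f : PowerSeries ℂ) : PowerSeries ℂ :=
  PowerSeries.mk fun n => if q ∣ n then PowerSeries.coeff (n / q) f else 0

/-- The canonical embedding of polynomials into power series. -/
def polyPS : Polynomial ℂ →+* PowerSeries ℂ := Polynomial.coeToPowerSeries.ringHom

/-- The power series `∑ (a n / n!) zⁿ` attached to a sequence `a` of coefficients. -/
def ePS (a : ℕ → ℂ) : PowerSeries ℂ := PowerSeries.mk fun n => a n / (n.factorial : ℂ)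

/-- `IsE a` : the power series `∑ (a n / n!) zⁿ` is an E-function: its coefficients are
algebraic, it satisfies a nonzero linear differential equation over `ℚ̄[z]`, and the size of
the conjugates of the `a n` as well as their common denominators grow at most geometrically. -/
def IsE (a : ℕ → ℂ) : Prop :=
  (∀ n, IsAlgebraic ℚ (a n)) ∧
  (∃ (m : ℕ) (p : ℕ → Polynomial ℂ),
      (∀ i k, IsAlgebraic ℚ ((p i).coeff k)) ∧ (∃ i, i ≤ m ∧ p i ≠ 0) ∧
      ∑ i ∈ Finset.range (m + 1), polyPS (p i) * psD^[i] (ePS a) = 0) ∧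
  (∃ C : ℝ, 0 < C ∧ ∃ d : ℕ → ℕ, ∀ n : ℕ, 1 ≤ n →
      1 ≤ d n ∧ (d n : ℝ) ≤ C ^ n ∧
      (∀ σ : (integralClosure ℚ ℂ) →+* ℂ, ∀ h : a n ∈ integralClosure ℚ ℂ,
        ‖σ ⟨a n, h⟩‖ ≤ C ^ n) ∧
      (∀ i, 1 ≤ i → i ≤ n → IsIntegral ℤ ((d n : ℂ) * a i)))

/-- The value at `α` of the E-function with coefficient sequence `a`
(E-functions are entire, so this series converges for all `α`). -/
def evalE (a : ℕ → ℂ) (α : ℂ) : ℂ := ∑' n : ℕ, a n / (n.factorial : ℂ) * α ^ n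

/-- `IsM q f` : the formal power series `f` is an M_q-function, i.e. it has algebraic
coefficients and satisfies a linear `σ_q`-difference equation over `ℚ̄[z]` with
not-all-zero polynomial coefficients. -/
def IsM (q : ℕ) (f : PowerSeries ℂ) : Prop :=
  (∀ n, IsAlgebraic ℚ (PowerSeries.coeff n f)) ∧
  ∃ (m : ℕ) (p : ℕ → Polynomial ℂ),
    (∀ i k, IsAlgebraic ℚ ((p i).coeff k)) ∧ (∃ i, i ≤ m ∧ p i ≠ 0) ∧
    ∑ i ∈ Finset.range (m + 1), polyPS (p i) * (psSigma q)^[i] f = 0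

/-- `MahlerValue f α v` : the meromorphic extension of (the sum of) the power series `f`
to the open unit disk has no pole at `α` and takes the value `v` there. -/
def MahlerValue (f : PowerSeries ℂ) (α v : ℂ) : Prop :=
  ∃ F : ℂ → ℂ, MeromorphicOn F (Metric.ball (0 : ℂ) 1) ∧
    (∀ᶠ z in nhds (0 : ℂ), HasSum (fun n => PowerSeries.coeff n f * z ^ n) (F z)) ∧
    AnalyticAt ℂ F α ∧ F α = v

/-- The power series `f` converges (hence defines an analytic function) on the open
disk `D(0,R)`. -/
def AnOnBall (f : PowerSeries ℂ) (R : ℝ) : Prop :=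
  ∀ z : ℂ, ‖z‖ < R → Summable fun n => PowerSeries.coeff n f * z ^ n

/-- The value at `z` of (the sum of) the power series `f`. -/
def psEval (f : PowerSeries ℂ) (z : ℂ) : ℂ := ∑' n : ℕ, PowerSeries.coeff n f * z ^ n

/-- `Banal fv α P` : the homogeneous algebraic relation `P` among the values at `α` of the
power series `fv 1, …, fv r` is banal: it is the specialization at `z = α` of some
`Q ∈ ℚ̄[z, X₁, …, X_r]`, homogeneous in `X₁, …, X_r`, with `Q(z, fv 1, …, fv r) = 0`. -/
def Banal {r : ℕ} (fv : Fin r → PowerSeries ℂ) (α : ℂ) (P : MvPolynomial (Fin r) ℂ) : Prop :=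
  ∃ Q : MvPolynomial (Fin r) (Polynomial ℂ),
    (∀ v k, IsAlgebraic ℚ ((MvPolynomial.coeff v Q).coeff k)) ∧
    (∃ e, Q.IsHomogeneous e) ∧
    MvPolynomial.eval₂ polyPS fv Q = 0 ∧
    MvPolynomial.map (Polynomial.evalRingHom α) Q = P

/-- `Eset S` : the set of values at `z = 1` of all E-functions with coefficients in `S`. -/
def Eset (S : Set ℂ) : Set ℂ :=
  {x | ∃ a : ℕ → ℂ, IsE a ∧ (∀ n, a n ∈ S) ∧ x = evalE a 1}

/-- `Mset q α S` : the set of values at `α` of all M_q-functions with coefficients in `S`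
having no pole at `α`. -/
def Mset (q : ℕ) (α : ℂ) (S : Set ℂ) : Set ℂ :=
  {x | ∃ f : PowerSeries ℂ, IsM q f ∧ (∀ n, PowerSeries.coeff n f ∈ S) ∧ MahlerValue f α x}

namespace Mahler
open IntermediateField IntermediateField.algebraAdjoinAdjoin

section FieldTheory

variable {F E Γ : Type*} [Field F] [Field E] [Field Γ] [Algebra F E] [Algebra F Γ] [Algebra E Γ]
  [IsScalarTower F E Γ]

theorem linearIndependent_adjoin_of_algebraicIndependent {ι κ : Type*} {x : ι → Γ} {y : κ → E}
    (hx : AlgebraicIndependent E x) (hy : LinearIndependent F y) :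
    LinearIndependent (adjoin F (Set.range x)) (fun i => algebraMap E Γ (y i)) := by
  rw [← LinearIndependent.iff_fractionRing (Algebra.adjoin F (Set.range x))]
  rw [linearIndependent_iff']
  intro s c hc i hi
  have hp : ∀ i, ∃ p : MvPolynomial ι F, MvPolynomial.aeval x p = (c i : Γ) := by
    intro i
    exact (Algebra.adjoin_range_eq_range_aeval F x).le (c i).2
  choose p hp using hp
  have h0 : MvPolynomial.aeval x
      (∑ i ∈ s, MvPolynomial.map (algebraMap F E) (p i) * MvPolynomial.C (y i)) = 0 := by
    rw [map_sum, ← hc]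
    refine Finset.sum_congr rfl fun i _ => ?_
    rw [map_mul, MvPolynomial.aeval_map_algebraMap, hp, MvPolynomial.aeval_C]
    rfl
  have h1 := hx.eq_zero_of_aeval_eq_zero _ h0
  have : p i = 0 := by
    ext m
    have h2 := congrArg (MvPolynomial.coeff m) h1
    rw [MvPolynomial.coeff_sum] at h2
    simp only [mul_comm _ (MvPolynomial.C _), MvPolynomial.coeff_C_mul, MvPolynomial.coeff_map,
      MvPolynomial.coeff_zero, mul_comm (y _), ← Algebra.smul_def] at h2
    exact linearIndependent_iff'.1 hy s _ h2 i hi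
  apply Subtype.ext
  rw [← hp, this, map_zero]
  rfl

attribute [local instance] MvPolynomial.algebraMvPolynomial in
theorem mem_adjoin_of_isAlgebraic {ι : Type*} {x : ι → Γ}
    (hcl : ∀ e : E, IsAlgebraic F e → e ∈ Set.range (algebraMap F E))
    (hx : AlgebraicIndependent E x) {e : Γ} (he : e ∈ adjoin E (Set.range x))
    (halg : IsAlgebraic (adjoin F (Set.range x)) e) : e ∈ adjoin F (Set.range x) := by
  have halg' : IsAlgebraic (Algebra.adjoin F (Set.range x)) e :=
    (IsFractionRing.isAlgebraic_iff (Algebra.adjoin F (Set.range x))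
      (adjoin F (Set.range x)) Γ).2 halg
  obtain ⟨d, hd, hde⟩ := halg'.exists_integral_multiple
  -- the inclusion of polynomial rings
  have key : ∀ z : Γ, z ∈ adjoin E (Set.range x) →
      IsIntegral (Algebra.adjoin F (Set.range x)) z → z ∈ Algebra.adjoin F (Set.range x) := by
    intro z hz hintg
    let _ : Algebra (MvPolynomial ι E) Γ := (MvPolynomial.aeval x).toRingHom.toAlgebra
    let _ : Algebra (MvPolynomial ι F) Γ := (MvPolynomial.aeval x).toRingHom.toAlgebra
    have hFE : ∀ p : MvPolynomial ι F, algebraMap (MvPolynomial ι E) Γ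
        (MvPolynomial.map (algebraMap F E) p) = algebraMap (MvPolynomial ι F) Γ p := fun p =>
      MvPolynomial.aeval_map_algebraMap ..
    have : IsScalarTower (MvPolynomial ι F) (MvPolynomial ι E) Γ :=
      IsScalarTower.of_algebraMap_eq fun p => (hFE p).symm
    have hintF : IsIntegral (MvPolynomial ι F) z := by
      obtain ⟨P, hP, hPz⟩ := hintg
      have hs : Function.Surjective ((MvPolynomial.aeval x : MvPolynomial ι F →ₐ[F] Γ).codRestrict
          (Algebra.adjoin F (Set.range x)) (fun p => by
            rw [Algebra.adjoin_range_eq_range_aeval]; exact ⟨p, rfl⟩)) := by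
        intro c
        obtain ⟨p, hp⟩ := (Algebra.adjoin_range_eq_range_aeval F x).le c.2
        exact ⟨p, Subtype.ext hp⟩
      obtain ⟨P', hP', -, hmon⟩ := Polynomial.lifts_and_degree_eq_and_monic
        (f := ((MvPolynomial.aeval x : MvPolynomial ι F →ₐ[F] Γ).codRestrict
          (Algebra.adjoin F (Set.range x)) (fun p => by
            rw [Algebra.adjoin_range_eq_range_aeval]; exact ⟨p, rfl⟩)).toRingHom)
        ((Polynomial.lifts_iff_coeff_lifts _).2 fun n => hs _) hP
      refine ⟨P', hmon, ?_⟩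
      rw [← hPz, ← hP', Polynomial.eval₂_map]
      rfl
    have hintE : IsIntegral (MvPolynomial ι E) z := hintF.tower_top
    obtain ⟨u, hu, w, hw, rfl⟩ := mem_adjoin_iff_div.mp hz
    rw [Algebra.adjoin_range_eq_range_aeval] at hu hw
    obtain ⟨u, rfl⟩ := hu
    obtain ⟨w, rfl⟩ := hw
    have hinj : Function.Injective (algebraMap (MvPolynomial ι E) Γ) := hx
    have : FaithfulSMul (MvPolynomial ι E) Γ := (faithfulSMul_iff_algebraMap_injective _ _).2 hinj
    have hlift : ∃ z' : MvPolynomial ι E, algebraMap (MvPolynomial ι E) Γ z' =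
        MvPolynomial.aeval x u / MvPolynomial.aeval x w := by
      let φ : FractionRing (MvPolynomial ι E) →ₐ[MvPolynomial ι E] Γ :=
        IsFractionRing.liftAlgHom (g := Algebra.ofId _ Γ) hinj
      have hφ : φ (algebraMap _ _ u / algebraMap _ _ w) =
          MvPolynomial.aeval x u / MvPolynomial.aeval x w := by
        rw [map_div₀, AlgHom.commutes, AlgHom.commutes]; rfl
      have := (isIntegral_algHom_iff φ φ.toRingHom.injective).1 (hφ ▸ hintE)
      obtain ⟨z', hz'⟩ := IsIntegrallyClosed.isIntegral_iff.1 this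
      exact ⟨z', by rw [← hφ, ← hz', AlgHom.commutes]⟩
    obtain ⟨z', hz'⟩ := hlift
    change IsIntegral _ (MvPolynomial.aeval x u / MvPolynomial.aeval x w) at hintF
    change MvPolynomial.aeval x u / MvPolynomial.aeval x w ∈ _
    rw [← hz'] at hintF ⊢
    have h3 : IsIntegral (MvPolynomial ι F) z' := (isIntegral_algebraMap_iff hinj).1 hintF
    have h4 := MvPolynomial.isIntegral_iff_isIntegral_coeff.1 h3
    have h5 : ∀ m, z'.coeff m ∈ Set.range (algebraMap F E) := fun m => hcl _ (h4 m).isAlgebraic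
    have h6 : z' ∈ Set.range (MvPolynomial.map (algebraMap F E)) := by
      rw [MvPolynomial.mem_range_map_iff_coeffs_subset]
      rintro _ hc
      obtain ⟨m, -, rfl⟩ := MvPolynomial.mem_coeffs_iff.1 hc
      exact h5 m
    obtain ⟨p, rfl⟩ := h6
    rw [hFE, Algebra.adjoin_range_eq_range_aeval]
    exact ⟨p, rfl⟩
  have hdE : (d : Γ) ∈ adjoin E (Set.range x) := by
    have : (d : Γ) ∈ adjoin F (Set.range x) := algebra_adjoin_le_adjoin F _ d.2
    have hle : Algebra.adjoin F (Set.range x) ≤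
        ((adjoin E (Set.range x)).restrictScalars F).toSubalgebra :=
      Algebra.adjoin_le (subset_adjoin E _)
    exact hle d.2
  have h2 := key _ (mul_mem hdE he) hde
  have hd0 : (d : Γ) ≠ 0 := fun h => hd (Subtype.ext h)
  have h7 : e = (d : Γ)⁻¹ * (d * e) := by field_simp
  rw [h7]
  exact mul_mem (inv_mem (algebra_adjoin_le_adjoin F _ d.2)) (algebra_adjoin_le_adjoin F _ h2)

/-- If `F` is algebraically closed in `E`, then `E` is linearly disjoint over `F` from every
finite extension of `F`. -/
theorem eq_zero_of_sum_eq_zero_of_finiteDimensional [CharZero F]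
    (hcl : ∀ e : E, IsAlgebraic F e → e ∈ Set.range (algebraMap F E))
    (L : IntermediateField F Γ) [FiniteDimensional F L] {κ : Type*} {y : κ → E}
    (hy : LinearIndependent F y) (s : Finset κ) (c : κ → Γ) (hc : ∀ i, c i ∈ L)
    (h0 : ∑ i ∈ s, c i * algebraMap E Γ (y i) = 0) : ∀ i ∈ s, c i = 0 := by
  obtain ⟨θ, hθ⟩ := Field.exists_primitive_element F L
  have hintg : IsIntegral F (θ : Γ) := (Algebra.IsIntegral.isIntegral (R := F) θ).map L.val
  have hintE : IsIntegral E (θ : Γ) := hintg.tower_top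
  have hmem : ∀ z ∈ L, ∃ p : Polynomial F, p.degree < (minpoly F (θ : Γ)).degree ∧
      Polynomial.aeval (θ : Γ) p = z := by
    intro z hz
    have h1 : (⟨z, hz⟩ : L) ∈ F⟮θ⟯ := hθ ▸ mem_top
    rw [← mem_toSubalgebra, adjoin_simple_toSubalgebra_of_isAlgebraic
      (Algebra.IsIntegral.isIntegral (R := F) θ).isAlgebraic,
      Algebra.adjoin_singleton_eq_range_aeval] at h1
    obtain ⟨p, hp⟩ := h1
    refine ⟨p %ₘ minpoly F (θ : Γ), Polynomial.degree_modByMonic_lt _ (minpoly.monic hintg), ?_⟩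
    have h2 := congrArg (Polynomial.aeval (θ : Γ))
      (Polynomial.modByMonic_add_div p (minpoly F (θ : Γ)))
    rw [map_add, map_mul, minpoly.aeval, zero_mul, add_zero] at h2
    rw [h2]
    have h3 := congrArg (fun w : L => (w : Γ)) hp
    simpa [Polynomial.aeval_subalgebra_coe] using h3
  have hmin : (minpoly E (θ : Γ)) = (minpoly F (θ : Γ)).map (algebraMap F E) := by
    have hdvd : minpoly E (θ : Γ) ∣ (minpoly F (θ : Γ)).map (algebraMap F E) :=
      minpoly.dvd_map_of_isScalarTower F E (θ : Γ)
    have hl : minpoly E (θ : Γ) ∈ Polynomial.lifts (algebraMap F E) :=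
      (Polynomial.lifts_iff_coeff_lifts _).2 fun n => hcl _
        (Polynomial.isIntegral_coeff_of_dvd _ _ (minpoly.monic hintg) (minpoly.monic hintE)
          hdvd n).isAlgebraic
    obtain ⟨p, hp, hdeg, hmon⟩ := Polynomial.lifts_and_degree_eq_and_monic hl
      (minpoly.monic hintE)
    have hp0 : Polynomial.aeval (θ : Γ) p = 0 := by
      rw [← Polynomial.aeval_map_algebraMap E, hp, minpoly.aeval]
    refine (Polynomial.eq_of_monic_of_dvd_of_natDegree_le (minpoly.monic hintE)
      ((minpoly.monic hintg).map _) hdvd ?_).symm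
    rw [(minpoly.monic hintg).natDegree_map]
    refine (Polynomial.natDegree_le_of_dvd (minpoly.dvd F _ hp0) hmon.ne_zero).trans ?_
    exact (Polynomial.natDegree_eq_of_degree_eq hdeg).le
  choose p hpdeg hp using fun i => hmem (c i) (hc i)
  have h1 : ∑ i ∈ s, (p i).map (algebraMap F E) * Polynomial.C (y i) = 0 := by
    by_contra hne
    refine hne (Polynomial.eq_zero_of_dvd_of_degree_lt (minpoly.dvd E (θ : Γ) ?_) ?_)
    · rw [map_sum, ← h0]
      refine Finset.sum_congr rfl fun i _ => ?_
      rw [map_mul, Polynomial.aeval_map_algebraMap, hp, Polynomial.aeval_C]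
    · rw [hmin, Polynomial.degree_map]
      refine (Polynomial.degree_sum_le _ _).trans_lt ?_
      rw [Finset.sup_lt_iff]
      · intro i _
        refine (Polynomial.degree_mul_le _ _).trans_lt ?_
        rw [Polynomial.degree_map]
        refine lt_of_le_of_lt ?_ (hpdeg i)
        calc (p i).degree + (Polynomial.C (y i)).degree ≤ (p i).degree + 0 := by
              gcongr; exact Polynomial.degree_C_le
          _ = _ := add_zero _
      · exact bot_lt_iff_ne_bot.2 (Polynomial.degree_ne_bot.2 (minpoly.ne_zero hintg))
  intro i hi
  have : p i = 0 := by
    ext m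
    have h2 := congrArg (fun P => Polynomial.coeff P m) h1
    simp only [Polynomial.finsetSum_coeff, Polynomial.coeff_mul_C, Polynomial.coeff_map,
      Polynomial.coeff_zero, ← Algebra.smul_def] at h2
    exact linearIndependent_iff'.1 hy s _ h2 i hi
  rw [← hp, this, map_zero]

/-- If `F` is algebraically closed in `E` and algebraic independence over `F` of subfamilies of
`x` implies algebraic independence over `E`, then `E` and `F(x)` are linearly disjoint over `F`. -/
theorem eq_zero_of_sum_eq_zero_of_mem_adjoin [CharZero F] {ι : Type*} [Finite ι] (x : ι → Γ)
    (hcl : ∀ e : E, IsAlgebraic F e → e ∈ Set.range (algebraMap F E))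
    (hind : ∀ s : Set ι, AlgebraicIndependent F (fun i : s => x i) →
      AlgebraicIndependent E (fun i : s => x i))
    {κ : Type*} {y : κ → E} (hy : LinearIndependent F y) (s : Finset κ) (c : κ → Γ)
    (hc : ∀ i, c i ∈ adjoin F (Set.range x))
    (h0 : ∑ i ∈ s, c i * algebraMap E Γ (y i) = 0) : ∀ i ∈ s, c i = 0 := by
  obtain ⟨b, hb⟩ := Set.Finite.exists_maximal
    (Set.toFinite {s : Set ι | AlgebraicIndependent F (fun i : s => x i)})
    ⟨∅, (algebraicIndependent_empty_type_iff ..).2 (algebraMap F Γ).injective⟩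
  have hbF : AlgebraicIndependent F (fun i : b => x i) := hb.1
  have hbE := hind b hbF
  have halg : ∀ i, IsAlgebraic (Algebra.adjoin F (Set.range fun i : b => x i)) (x i) := by
    intro i
    by_contra hi
    have hib : i ∉ b := fun h => hi (isAlgebraic_algebraMap
      (⟨x i, Algebra.subset_adjoin ⟨⟨i, h⟩, rfl⟩⟩ :
        Algebra.adjoin F (Set.range fun i : b => x i)))
    have h1 : AlgebraicIndepOn F x (insert i b) := by
      rw [AlgebraicIndepOn.insert_iff hib]
      refine ⟨hbF, ?_⟩
      rw [Set.image_eq_range]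
      exact hi
    exact hib (hb.2 h1 (Set.subset_insert _ _) (Set.mem_insert _ _))
  set xb : b → Γ := fun i => x i with hxb
  have hle : adjoin F (Set.range xb) ≤ (adjoin E (Set.range xb)).restrictScalars F :=
    adjoin_le_iff.2 (subset_adjoin E _)
  let _ : Algebra (adjoin F (Set.range xb)) (adjoin E (Set.range xb)) :=
    (IntermediateField.inclusion hle).toRingHom.toAlgebra
  have : IsScalarTower (adjoin F (Set.range xb)) (adjoin E (Set.range xb)) Γ :=
    IsScalarTower.of_algebraMap_eq fun _ => rfl
  have halg' : ∀ i, IsIntegral (adjoin F (Set.range xb)) (x i) := fun i =>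
    ((IsFractionRing.isAlgebraic_iff (Algebra.adjoin F (Set.range xb))
      (adjoin F (Set.range xb)) Γ).1 (halg i)).isIntegral
  have : FiniteDimensional (adjoin F (Set.range xb))
      (adjoin (adjoin F (Set.range xb)) (Set.range x)) := by
    refine finiteDimensional_adjoin ?_
    rintro _ ⟨i, rfl⟩
    exact halg' i
  have hLI := linearIndependent_adjoin_of_algebraicIndependent hbE hy
  have hLI' : LinearIndependent (adjoin F (Set.range xb))
      (fun i => algebraMap E (adjoin E (Set.range xb)) (y i)) :=
    LinearIndependent.of_comp (IsScalarTower.toAlgHom (adjoin F (Set.range xb))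
      (adjoin E (Set.range xb)) Γ).toLinearMap hLI
  refine eq_zero_of_sum_eq_zero_of_finiteDimensional ?_
    (adjoin (adjoin F (Set.range xb)) (Set.range x)) hLI' s c ?_ h0
  · intro e he
    have he' : IsAlgebraic (adjoin F (Set.range xb)) (e : Γ) := he.algebraMap
    exact ⟨⟨e, mem_adjoin_of_isAlgebraic hcl hbE e.2 he'⟩, rfl⟩
  · intro i
    have : adjoin F (Set.range x) ≤
        (adjoin (adjoin F (Set.range xb)) (Set.range x)).restrictScalars F :=
      adjoin_le_iff.2 (subset_adjoin _ _)
    exact this (hc i)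

end FieldTheory
end Mahler

namespace Mahler

section Torsion

variable {D Ω : Type*} [CommRing D] [IsDomain D] [CommRing Ω] [Algebra D Ω]

theorem exists_ne_zero_smul_mem_ideal (B : Subalgebra D Ω) [IsNoetherianRing B] (J : Ideal B) :
    ∃ h : D, h ≠ 0 ∧ ∀ (b : B) (d : D), d ≠ 0 → d • b ∈ J → h • b ∈ J := by
  classical
  let T : Ideal B :=
    { carrier := {b | ∃ d : D, d ≠ 0 ∧ d • b ∈ J}
      zero_mem' := ⟨1, one_ne_zero, by simp⟩
      add_mem' := by
        rintro b c ⟨d, hd, hb⟩ ⟨e, he, hc⟩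
        refine ⟨d * e, mul_ne_zero hd he, ?_⟩
        rw [smul_add]
        refine add_mem ?_ ?_
        · rw [mul_comm, mul_smul, Algebra.smul_def]; exact J.mul_mem_left _ hb
        · rw [mul_smul, Algebra.smul_def]; exact J.mul_mem_left _ hc
      smul_mem' := by
        rintro c b ⟨d, hd, hb⟩
        refine ⟨d, hd, ?_⟩
        rw [smul_comm]; exact J.mul_mem_left _ hb }
  obtain ⟨s, hs⟩ := (isNoetherianRing_iff_ideal_fg B).1 inferInstance T
  have hsT : ∀ b : s, ∃ d : D, d ≠ 0 ∧ d • (b : B) ∈ J := fun b => by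
    have : (b : B) ∈ T := hs ▸ Submodule.subset_span b.2
    exact this
  choose d hd hdJ using hsT
  refine ⟨∏ b, d b, Finset.prod_ne_zero_iff.2 fun b _ => hd b, fun b e he hbe => ?_⟩
  have hbT : b ∈ Ideal.span (s : Set B) := hs ▸ (⟨e, he, hbe⟩ : b ∈ T)
  clear hbe
  induction hbT using Submodule.span_induction with
  | mem x hx =>
    rw [← Finset.prod_erase_mul _ _ (Finset.mem_univ (⟨x, hx⟩ : s)), mul_smul, Algebra.smul_def]
    exact J.mul_mem_left _ (hdJ ⟨x, hx⟩)
  | zero => simp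
  | add x y _ _ hx hy => rw [smul_add]; exact add_mem hx hy
  | smul a x _ hx => rw [smul_comm]; exact J.mul_mem_left _ hx

theorem exists_pow_smul_mem_of_mem_aeval (B : Subalgebra D Ω) [IsNoetherianRing B] (a : Ω) :
    ∃ h : D, h ≠ 0 ∧ ∀ (p : Polynomial B) (d : D), d ≠ 0 → d • Polynomial.aeval a p ∈ B →
      ∃ n : ℕ, h ^ n • Polynomial.aeval a p ∈ B := by
  let J : ℕ →o Ideal B :=
    { toFun := fun n =>
        { carrier := {b | ∃ p : Polynomial B, p.natDegree ≤ n ∧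
            (b : Ω) * a ^ (n + 1) = Polynomial.aeval a p}
          zero_mem' := ⟨0, by simp, by simp⟩
          add_mem' := by
            rintro b c ⟨p, hp, hb⟩ ⟨r, hr, hc⟩
            refine ⟨p + r, Polynomial.natDegree_add_le_of_degree_le hp hr, ?_⟩
            rw [map_add, ← hb, ← hc, Subalgebra.coe_add, add_mul]
          smul_mem' := by
            rintro c b ⟨p, hp, hb⟩
            refine ⟨Polynomial.C c * p, (Polynomial.natDegree_C_mul_le _ _).trans hp, ?_⟩
            rw [map_mul, ← hb, Polynomial.aeval_C, smul_eq_mul, Subalgebra.coe_mul, mul_assoc]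
            rfl }
      monotone' := by
        refine monotone_nat_of_le_succ fun n => ?_
        rintro b ⟨p, hp, hb⟩
        refine ⟨p * Polynomial.X, ?_, ?_⟩
        · exact (Polynomial.natDegree_mul_le).trans
            (add_le_add hp Polynomial.natDegree_X_le)
        · rw [map_mul, ← hb, Polynomial.aeval_X]; ring }
  obtain ⟨N, hN⟩ := monotone_stabilizes_iff_noetherian.2 (inferInstance : IsNoetherian B B) J
  choose h hh0 hh using fun n => exists_ne_zero_smul_mem_ideal B (J n)
  refine ⟨∏ i ∈ Finset.range (N + 1), h i, Finset.prod_ne_zero_iff.2 fun i _ => hh0 i, ?_⟩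
  set H := ∏ i ∈ Finset.range (N + 1), h i with hH
  have hHJ : ∀ (n : ℕ) (b : B) (d : D), d ≠ 0 → d • b ∈ J n → H • b ∈ J n := by
    intro n b d hd hdb
    obtain ⟨m, hm, hJ⟩ : ∃ m ∈ Finset.range (N + 1), J n = J m := by
      rcases le_total n N with h | h
      · exact ⟨n, Finset.mem_range.2 (by lia), rfl⟩
      · exact ⟨N, Finset.mem_range.2 (by lia), (hN n h).symm⟩
    rw [hJ] at hdb ⊢
    rw [hH, ← Finset.prod_erase_mul _ _ hm, mul_smul, Algebra.smul_def]
    exact (J m).mul_mem_left _ (hh m b d hd hdb)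
  suffices h : ∀ (n : ℕ) (p : Polynomial B), p.natDegree ≤ n → ∀ d : D, d ≠ 0 →
      d • Polynomial.aeval a p ∈ B → ∃ n : ℕ, H ^ n • Polynomial.aeval a p ∈ B from
    fun p => h _ p le_rfl
  intro n
  induction n with
  | zero =>
    intro p hp d _ _
    refine ⟨0, ?_⟩
    rw [Polynomial.eq_C_of_natDegree_le_zero hp, Polynomial.aeval_C, pow_zero, one_smul]
    exact (p.coeff 0).2
  | succ n ih =>
    intro p hp d hd hdp
    have hsplit : ∃ p₁ : Polynomial B, p₁.natDegree ≤ n ∧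
        p = p₁ + Polynomial.C (p.coeff (n + 1)) * Polynomial.X ^ (n + 1) := by
      refine ⟨p - Polynomial.C (p.coeff (n + 1)) * Polynomial.X ^ (n + 1), ?_, by ring⟩
      rw [Polynomial.natDegree_le_iff_coeff_eq_zero]
      intro m hm
      rcases (Nat.succ_le_iff.2 hm).eq_or_lt with h | h
      · simp [← h]
      · rw [Polynomial.coeff_sub, Polynomial.coeff_eq_zero_of_natDegree_lt (lt_of_le_of_lt hp h),
          Polynomial.coeff_C_mul, Polynomial.coeff_X_pow, if_neg (by lia)]
        simp
    obtain ⟨p₁, hp₁, hpe⟩ := hsplit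
    set b := p.coeff (n + 1) with hb
    have hval : Polynomial.aeval a p = Polynomial.aeval a p₁ + (b : Ω) * a ^ (n + 1) := by
      rw [hpe]; simp
    have h1 : d • b ∈ J n := by
      refine ⟨Polynomial.C ⟨_, hdp⟩ - Polynomial.C (algebraMap D B d) * p₁, ?_, ?_⟩
      · refine (Polynomial.natDegree_sub_le _ _).trans (max_le ?_ ?_)
        · simp
        · exact (Polynomial.natDegree_C_mul_le _ _).trans hp₁
      · rw [map_sub, map_mul, Polynomial.aeval_C, Polynomial.aeval_C, Subalgebra.coe_smul,
          Algebra.smul_def]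
        change _ = d • Polynomial.aeval a p - algebraMap D Ω d * _
        rw [hval, Algebra.smul_def]; ring
    obtain ⟨p₂, hp₂, h2⟩ := hHJ n b d hd h1
    have hval2 : H • Polynomial.aeval a p =
        Polynomial.aeval a (p₂ + Polynomial.C (algebraMap D B H) * p₁) := by
      rw [map_add, ← h2, hval, map_mul, Polynomial.aeval_C, Subalgebra.coe_smul,
        Algebra.smul_def, Algebra.smul_def]
      change _ = _ + algebraMap D Ω H * _
      ring
    obtain ⟨m, hm⟩ := ih (p₂ + Polynomial.C (algebraMap D B H) * p₁)
      (Polynomial.natDegree_add_le_of_degree_le hp₂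
        ((Polynomial.natDegree_C_mul_le _ _).trans hp₁)) d hd (by
        rw [← hval2, smul_comm]; exact B.smul_mem hdp H)
    refine ⟨m + 1, ?_⟩
    rwa [pow_succ, mul_smul, hval2]

/-- Denominators needed to bring elements of the finitely generated algebra `D[S ∪ T]` that are
rational over `D[S]` back to `D[S]` involve the powers of a single element of `D`. -/
theorem exists_pow_smul_mem_adjoin [IsNoetherianRing D] (S T : Set Ω) (hS : S.Finite)
    (hT : T.Finite) :
    ∃ h : D, h ≠ 0 ∧ ∀ y ∈ Algebra.adjoin D (S ∪ T), ∀ d : D, d ≠ 0 →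
      d • y ∈ Algebra.adjoin D S → ∃ n : ℕ, h ^ n • y ∈ Algebra.adjoin D S := by
  induction T, hT using Set.Finite.induction_on with
  | empty => exact ⟨1, one_ne_zero, fun y hy _ _ _ => ⟨0, by simpa using hy⟩⟩
  | @insert a T _ hT ih =>
    obtain ⟨h₁, hh₁, H₁⟩ := ih
    have : IsNoetherianRing (Algebra.adjoin D (S ∪ T)) :=
      isNoetherianRing_of_fg (Subalgebra.fg_def.2 ⟨_, hS.union hT, rfl⟩)
    obtain ⟨h₂, hh₂, H₂⟩ := exists_pow_smul_mem_of_mem_aeval (Algebra.adjoin D (S ∪ T)) a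
    refine ⟨h₂ * h₁, mul_ne_zero hh₂ hh₁, fun y hy d hd hdy => ?_⟩
    have hy' : y ∈ Algebra.adjoin (Algebra.adjoin D (S ∪ T)) {a} := by
      rw [← Subalgebra.mem_restrictScalars D, ← Algebra.adjoin_union_eq_adjoin_adjoin]
      convert hy using 2
      rw [Set.union_assoc, Set.union_singleton]
    rw [Algebra.adjoin_singleton_eq_range_aeval] at hy'
    obtain ⟨p, rfl⟩ := hy'
    obtain ⟨n, hn⟩ := H₂ p d hd (Algebra.adjoin_mono Set.subset_union_left hdy)
    obtain ⟨m, hm⟩ := H₁ _ hn d hd (by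
      rw [smul_comm]; exact Subalgebra.smul_mem _ hdy _)
    refine ⟨n + m, ?_⟩
    have : (h₂ * h₁) ^ (n + m) • Polynomial.aeval a p =
        (h₂ ^ m * h₁ ^ n) • (h₁ ^ m • (h₂ ^ n • Polynomial.aeval a p)) := by
      rw [smul_smul, smul_smul]; congr 1; ring
    change (h₂ * h₁) ^ (n + m) • Polynomial.aeval a p ∈ _
    rw [this]
    exact Subalgebra.smul_mem _ hm _

end Torsion
end Mahler

namespace Mahler

open Filter Topology

section Convergent

variable {K : Type*} [Field K] (φ : K →+* ℂ)

/-- The sum at `z` of a power series with coefficients in `K`, embedded in `ℂ` by `φ`. -/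
noncomputable def psSum (f : PowerSeries K) (z : ℂ) : ℂ := ∑' n, φ (PowerSeries.coeff n f) * z ^ n

/-- Absolute convergence on the closed disc of radius `ρ`. -/
def AbsConv (f : PowerSeries K) (ρ : ℝ) : Prop :=
  Summable fun n => ‖φ (PowerSeries.coeff n f)‖ * ρ ^ n

variable {φ}

theorem AbsConv.summable_norm {f : PowerSeries K} {ρ : ℝ} (h : AbsConv φ f ρ) {z : ℂ}
    (hz : ‖z‖ ≤ ρ) : Summable fun n => ‖φ (PowerSeries.coeff n f) * z ^ n‖ := by
  refine Summable.of_nonneg_of_le (fun _ => norm_nonneg _) (fun n => ?_) h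
  rw [norm_mul, norm_pow]
  gcongr

theorem AbsConv.mono {f : PowerSeries K} {ρ ρ' : ℝ} (h : AbsConv φ f ρ) (h0 : 0 ≤ ρ')
    (hz : ρ' ≤ ρ) : AbsConv φ f ρ' := by
  refine Summable.of_nonneg_of_le (fun _ => by positivity) (fun n => ?_) h
  gcongr

theorem AbsConv.add {f g : PowerSeries K} {ρ : ℝ} (hf : AbsConv φ f ρ) (hg : AbsConv φ g ρ)
    (h0 : 0 ≤ ρ) : AbsConv φ (f + g) ρ := by
  refine Summable.of_nonneg_of_le (fun _ => by positivity) (fun n => ?_) (Summable.add hf hg)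
  rw [map_add, map_add, ← add_mul]
  gcongr
  exact norm_add_le _ _

theorem AbsConv.neg {f : PowerSeries K} {ρ : ℝ} (hf : AbsConv φ f ρ) : AbsConv φ (-f) ρ := by
  simpa [AbsConv] using hf

theorem coeff_mul_mul_pow (f g : PowerSeries K) (z : ℂ) (n : ℕ) :
    φ (PowerSeries.coeff n (f * g)) * z ^ n = ∑ kl ∈ Finset.HasAntidiagonal.antidiagonal n,
      (φ (PowerSeries.coeff kl.1 f) * z ^ kl.1) * (φ (PowerSeries.coeff kl.2 g) * z ^ kl.2) := by
  rw [PowerSeries.coeff_mul, map_sum, Finset.sum_mul]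
  refine Finset.sum_congr rfl fun kl hkl => ?_
  rw [← Finset.HasAntidiagonal.mem_antidiagonal.1 hkl, map_mul, pow_add]
  ring

theorem AbsConv.mul {f g : PowerSeries K} {ρ : ℝ} (hf : AbsConv φ f ρ) (hg : AbsConv φ g ρ)
    (h0 : 0 ≤ ρ) : AbsConv φ (f * g) ρ := by
  have hρ : ‖(ρ : ℂ)‖ = ρ := by simp [abs_of_nonneg h0]
  have := summable_norm_sum_mul_antidiagonal_of_summable_norm (hf.summable_norm hρ.le)
    (hg.summable_norm hρ.le)
  refine this.congr fun n => ?_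
  rw [← coeff_mul_mul_pow, norm_mul, norm_pow, hρ]

theorem AbsConv.coe (p : Polynomial K) (ρ : ℝ) : AbsConv φ (p : PowerSeries K) ρ := by
  refine summable_of_ne_finset_zero (s := Finset.range (p.natDegree + 1)) fun n hn => ?_
  rw [Polynomial.coeff_coe, Polynomial.coeff_eq_zero_of_natDegree_lt]
  · simp
  · simp only [Finset.mem_range, not_lt] at hn; lia

theorem psSum_add {f g : PowerSeries K} {ρ : ℝ} (hf : AbsConv φ f ρ) (hg : AbsConv φ g ρ) {z : ℂ}
    (hz : ‖z‖ ≤ ρ) : psSum φ (f + g) z = psSum φ f z + psSum φ g z := by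
  rw [psSum, psSum, psSum, ← (hf.summable_norm hz).of_norm.tsum_add (hg.summable_norm hz).of_norm]
  simp [add_mul]

theorem psSum_mul {f g : PowerSeries K} {ρ : ℝ} (hf : AbsConv φ f ρ) (hg : AbsConv φ g ρ) {z : ℂ}
    (hz : ‖z‖ ≤ ρ) : psSum φ (f * g) z = psSum φ f z * psSum φ g z := by
  rw [psSum, psSum, psSum, tsum_mul_tsum_eq_tsum_sum_antidiagonal_of_summable_norm
    (hf.summable_norm hz) (hg.summable_norm hz)]
  simp_rw [coeff_mul_mul_pow]

theorem psSum_coe (p : Polynomial K) (z : ℂ) :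
    psSum φ (p : PowerSeries K) z = (p.map φ).eval z := by
  rw [psSum, tsum_eq_sum (s := Finset.range (p.natDegree + 1)), Polynomial.eval_map,
    Polynomial.eval₂_eq_sum_range]
  · simp
  · intro n hn
    rw [Polynomial.coeff_coe, Polynomial.coeff_eq_zero_of_natDegree_lt]
    · simp
    · simp only [Finset.mem_range, not_lt] at hn; lia

theorem AbsConv.continuousOn {f : PowerSeries K} {ρ : ℝ} (hf : AbsConv φ f ρ) :
    ContinuousOn (psSum φ f) (Metric.closedBall 0 ρ) := by
  refine continuousOn_tsum (fun n => by fun_prop) hf fun n z hz => ?_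
  rw [norm_mul, norm_pow]
  have : ‖z‖ ≤ ρ := by simpa using hz
  gcongr

theorem psSum_zero (f : PowerSeries K) : psSum φ f 0 = φ (PowerSeries.constantCoeff f) := by
  rw [psSum, tsum_eq_single 0]
  · simp
  · intro n hn; simp [hn]

theorem AbsConv.tendsto {f : PowerSeries K} {ρ : ℝ} (hρ : 0 < ρ) (hf : AbsConv φ f ρ) :
    Tendsto (psSum φ f) (𝓝 0) (𝓝 (φ (PowerSeries.constantCoeff f))) := by
  rw [← psSum_zero]
  exact (hf.continuousOn.continuousAt (Metric.closedBall_mem_nhds _ hρ)).tendsto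

variable (φ)

/-- The subring of convergent power series with coefficients in `K`. -/
def convSubring : Subring (PowerSeries K) where
  carrier := {f | ∃ ρ : ℝ, 0 < ρ ∧ AbsConv φ f ρ}
  zero_mem' := ⟨1, one_pos, by simpa using AbsConv.coe (φ := φ) (0 : Polynomial K) 1⟩
  one_mem' := ⟨1, one_pos, by simpa using AbsConv.coe (φ := φ) (1 : Polynomial K) 1⟩
  add_mem' := by
    rintro f g ⟨ρ, hρ, hf⟩ ⟨ρ', hρ', hg⟩
    have h0 : 0 < min ρ ρ' := lt_min hρ hρ'
    exact ⟨_, h0, (hf.mono h0.le (min_le_left _ _)).add (hg.mono h0.le (min_le_right _ _)) h0.le⟩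
  mul_mem' := by
    rintro f g ⟨ρ, hρ, hf⟩ ⟨ρ', hρ', hg⟩
    have h0 : 0 < min ρ ρ' := lt_min hρ hρ'
    exact ⟨_, h0, (hf.mono h0.le (min_le_left _ _)).mul (hg.mono h0.le (min_le_right _ _)) h0.le⟩
  neg_mem' := by
    rintro f ⟨ρ, hρ, hf⟩
    exact ⟨ρ, hρ, hf.neg⟩

theorem coe_mem_convSubring (p : Polynomial K) : (p : PowerSeries K) ∈ convSubring φ :=
  ⟨1, one_pos, AbsConv.coe p 1⟩

/-- Polynomials as convergent power series. -/
noncomputable def polyConv : Polynomial K →+* convSubring φ :=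
  (Polynomial.coeToPowerSeries.ringHom (R := K)).codRestrict (convSubring φ)
    (coe_mem_convSubring φ)

@[simp]
theorem coe_polyConv (p : Polynomial K) : (polyConv φ p : PowerSeries K) = p := rfl

theorem polyConv_injective : Function.Injective (polyConv φ) := fun _ _ h =>
  Polynomial.coe_injective K (congrArg Subtype.val h)

theorem mem_convSubring_of_X_mul_mem {f : PowerSeries K}
    (hf : PowerSeries.X * f ∈ convSubring φ) : f ∈ convSubring φ := by
  obtain ⟨ρ, hρ, h⟩ := hf
  refine ⟨ρ, hρ, ?_⟩
  have h1 := ((summable_nat_add_iff 1).2 h).mul_right ρ⁻¹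
  refine h1.congr fun n => ?_
  rw [mul_comm PowerSeries.X, PowerSeries.coeff_succ_mul_X]
  field_simp
  ring

theorem tendsto_psSum_of_mem {f : PowerSeries K} (hf : f ∈ convSubring φ) :
    Tendsto (psSum φ f) (𝓝 0) (𝓝 (φ (PowerSeries.constantCoeff f))) := by
  obtain ⟨ρ, hρ, h⟩ := hf
  exact h.tendsto hρ

theorem eventually_psSum_add {f g : PowerSeries K} (hf : f ∈ convSubring φ)
    (hg : g ∈ convSubring φ) :
    ∀ᶠ z in 𝓝 0, psSum φ (f + g) z = psSum φ f z + psSum φ g z := by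
  obtain ⟨ρ, hρ, hf⟩ := hf
  obtain ⟨ρ', hρ', hg⟩ := hg
  have h0 : 0 < min ρ ρ' := lt_min hρ hρ'
  filter_upwards [Metric.closedBall_mem_nhds (0 : ℂ) h0] with z hz
  exact psSum_add (hf.mono h0.le (min_le_left _ _)) (hg.mono h0.le (min_le_right _ _))
    (by simpa using hz)

theorem eventually_psSum_mul {f g : PowerSeries K} (hf : f ∈ convSubring φ)
    (hg : g ∈ convSubring φ) :
    ∀ᶠ z in 𝓝 0, psSum φ (f * g) z = psSum φ f z * psSum φ g z := by
  obtain ⟨ρ, hρ, hf⟩ := hf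
  obtain ⟨ρ', hρ', hg⟩ := hg
  have h0 : 0 < min ρ ρ' := lt_min hρ hρ'
  filter_upwards [Metric.closedBall_mem_nhds (0 : ℂ) h0] with z hz
  exact psSum_mul (hf.mono h0.le (min_le_left _ _)) (hg.mono h0.le (min_le_right _ _))
    (by simpa using hz)

variable {ι : Type*} {l : Filter ι} {Z : ι → ℂ} (hZ : Tendsto Z l (𝓝 0))

/-- Evaluation of convergent power series along a family of points tending to `0`. -/
noncomputable def evGerm : convSubring φ →+* l.Germ ℂ where
  toFun f := ((fun k => psSum φ (f : PowerSeries K) (Z k) : ι → ℂ) : l.Germ ℂ)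
  map_one' := by
    refine Germ.coe_eq.2 (Eventually.of_forall fun k => ?_)
    simpa using psSum_coe (φ := φ) (1 : Polynomial K) (Z k)
  map_zero' := by
    refine Germ.coe_eq.2 (Eventually.of_forall fun k => ?_)
    simpa using psSum_coe (φ := φ) (0 : Polynomial K) (Z k)
  map_add' f g := Germ.coe_eq.2 (hZ.eventually (eventually_psSum_add φ f.2 g.2))
  map_mul' f g := Germ.coe_eq.2 (hZ.eventually (eventually_psSum_mul φ f.2 g.2))

theorem evGerm_apply (f : convSubring φ) :
    evGerm φ hZ f = ((fun k => psSum φ (f : PowerSeries K) (Z k) : ι → ℂ) : l.Germ ℂ) := rfl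

theorem evGerm_polyConv (p : Polynomial K) :
    evGerm φ hZ (polyConv φ p) = ((fun k => (p.map φ).eval (Z k) : ι → ℂ) : l.Germ ℂ) := by
  rw [evGerm_apply]
  simp only [coe_polyConv, psSum_coe]

theorem eventually_psSum_ne_zero {f : PowerSeries K} (hf : f ∈ convSubring φ) (h0 : f ≠ 0) :
    ∀ᶠ z in 𝓝[≠] 0, psSum φ f z ≠ 0 := by
  obtain ⟨n, g, hg, rfl⟩ : ∃ (n : ℕ) (g : PowerSeries K), PowerSeries.constantCoeff g ≠ 0 ∧
      f = PowerSeries.X ^ n * g := by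
    refine ⟨f.order.toNat, PowerSeries.divXPowOrder f, ?_, ?_⟩
    · rw [PowerSeries.constantCoeff_divXPowOrder]
      exact PowerSeries.coeff_order h0
    · exact (PowerSeries.X_pow_order_mul_divXPowOrder).symm
  have hgc : g ∈ convSubring φ := by
    clear hg h0
    induction n with
    | zero => simpa using hf
    | succ n ih =>
      refine ih (mem_convSubring_of_X_mul_mem φ ?_)
      rwa [← mul_assoc, ← pow_succ']
  have hXc : (PowerSeries.X ^ n : PowerSeries K) ∈ convSubring φ := by
    have := coe_mem_convSubring φ (Polynomial.X ^ n)
    simpa using this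
  have h1 := (tendsto_psSum_of_mem φ hgc).eventually_ne ((map_ne_zero φ).2 hg)
  filter_upwards [h1.filter_mono nhdsWithin_le_nhds, (eventually_psSum_mul φ hXc hgc).filter_mono
    nhdsWithin_le_nhds, self_mem_nhdsWithin] with z h1 h2 h3
  rw [h2]
  refine mul_ne_zero ?_ h1
  have := psSum_coe (φ := φ) (Polynomial.X ^ n) z
  simp only [Polynomial.coe_pow, Polynomial.coe_X] at this
  rw [this]
  simpa using pow_ne_zero n h3

theorem evGerm_injective [l.NeBot] (hZ0 : ∀ᶠ k in l, Z k ≠ 0) :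
    Function.Injective (evGerm φ hZ) := by
  rw [injective_iff_map_eq_zero]
  intro f hf
  by_contra h0
  have h1 : ∀ᶠ k in l, psSum φ (f : PowerSeries K) (Z k) ≠ 0 :=
    (tendsto_nhdsWithin_iff.2 ⟨hZ, hZ0⟩).eventually
      (eventually_psSum_ne_zero φ f.2 fun h => h0 (Subtype.ext h))
  have h2 : ∀ᶠ k in l, psSum φ (f : PowerSeries K) (Z k) = 0 := Germ.coe_eq.1 hf
  obtain ⟨k, h3, h4⟩ := (h1.and h2).exists
  exact h3 h4

end Convergent
end Mahler

namespace Mahler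

open Filter Topology

section Size

variable {K : Type*} [Field K] [NumberField K]

/-- The sequence `β` in a number field has denominators and conjugates bounded by a constant
multiple of `c ^ (e * q ^ k)`. -/
def SizeLE (c q e : ℕ) (β : ℕ → K) : Prop :=
  ∃ C : ℕ, 0 < C ∧ ∀ k, IsIntegral ℤ ((C : K) * (c : K) ^ (e * q ^ k) * β k) ∧
    ∀ τ : K →+* ℂ, ‖τ (β k)‖ ≤ C * (c : ℝ) ^ (e * q ^ k)

variable {c q : ℕ}

theorem isIntegral_natCast_pow_mul {x : K} (a : ℕ) (h : IsIntegral ℤ x) :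
    IsIntegral ℤ ((a : K) * x) :=
  IsIntegral.mul (by exact_mod_cast (isIntegral_algebraMap (R := ℤ) (A := K) (x := (a : ℤ)))) h

theorem SizeLE.mono (hc : 1 ≤ c) {e e' : ℕ} (he : e ≤ e') {β : ℕ → K} (h : SizeLE c q e β) :
    SizeLE c q e' β := by
  obtain ⟨C, hC, h⟩ := h
  refine ⟨C, hC, fun k => ⟨?_, fun τ => ((h k).2 τ).trans ?_⟩⟩
  · have h1 := isIntegral_natCast_pow_mul (c ^ ((e' - e) * q ^ k)) (h k).1
    convert h1 using 1
    push_cast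
    rw [show e' * q ^ k = (e' - e) * q ^ k + e * q ^ k by rw [← add_mul, Nat.sub_add_cancel he],
      pow_add]
    ring
  · have : (1 : ℝ) ≤ c := by exact_mod_cast hc
    gcongr

theorem SizeLE.add {e : ℕ} {β γ : ℕ → K} (hβ : SizeLE c q e β)
    (hγ : SizeLE c q e γ) : SizeLE c q e (fun k => β k + γ k) := by
  obtain ⟨C, hC, h⟩ := hβ
  obtain ⟨D, hD, h'⟩ := hγ
  have hCD : C + D ≤ 2 * C * D := by nlinarith
  refine ⟨2 * C * D, by positivity, fun k => ⟨?_, fun τ => ?_⟩⟩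
  · have h1 := isIntegral_natCast_pow_mul (2 * D) (h k).1
    have h2 := isIntegral_natCast_pow_mul (2 * C) (h' k).1
    have h3 : IsIntegral ℤ (((2 * D : ℕ) : K) * ((C : K) * (c : K) ^ (e * q ^ k) * β k) +
        ((2 * C : ℕ) : K) * ((D : K) * (c : K) ^ (e * q ^ k) * γ k)) := h1.add h2
    have h4 : ((2 * C * D : ℕ) : K) * (c : K) ^ (e * q ^ k) * (β k + γ k) =
        ((2 * D : ℕ) : K) * ((C : K) * (c : K) ^ (e * q ^ k) * β k) +
        ((2 * C : ℕ) : K) * ((D : K) * (c : K) ^ (e * q ^ k) * γ k) := by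
      push_cast; ring
    rwa [← h4] at h3
  · rw [map_add]
    calc ‖τ (β k) + τ (γ k)‖ ≤ ‖τ (β k)‖ + ‖τ (γ k)‖ := norm_add_le _ _
      _ ≤ C * (c : ℝ) ^ (e * q ^ k) + D * (c : ℝ) ^ (e * q ^ k) := add_le_add ((h k).2 τ) ((h' k).2 τ)
      _ = ((C + D : ℕ) : ℝ) * (c : ℝ) ^ (e * q ^ k) := by push_cast; ring
      _ ≤ _ := by gcongr

theorem SizeLE.mul {e e' : ℕ} {β γ : ℕ → K} (hβ : SizeLE c q e β)
    (hγ : SizeLE c q e' γ) : SizeLE c q (e + e') (fun k => β k * γ k) := by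
  obtain ⟨C, hC, h⟩ := hβ
  obtain ⟨D, hD, h'⟩ := hγ
  refine ⟨C * D, by positivity, fun k => ⟨?_, fun τ => ?_⟩⟩
  · have h3 : IsIntegral ℤ (((C : K) * (c : K) ^ (e * q ^ k) * β k) *
        ((D : K) * (c : K) ^ (e' * q ^ k) * γ k)) := (h k).1.mul (h' k).1
    have h4 : ((C * D : ℕ) : K) * (c : K) ^ ((e + e') * q ^ k) * (β k * γ k) =
        ((C : K) * (c : K) ^ (e * q ^ k) * β k) * ((D : K) * (c : K) ^ (e' * q ^ k) * γ k) := by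
      push_cast; ring
    rwa [← h4] at h3
  · rw [map_mul, norm_mul]
    calc ‖τ (β k)‖ * ‖τ (γ k)‖ ≤ (C * (c : ℝ) ^ (e * q ^ k)) * (D * (c : ℝ) ^ (e' * q ^ k)) := by
          gcongr; exacts [(h k).2 τ, (h' k).2 τ]
      _ = _ := by push_cast; ring

theorem SizeLE.const (x : K) : SizeLE c q 0 (fun _ => x) := by
  obtain ⟨d, hd, hdx⟩ : ∃ d : ℕ, 0 < d ∧ IsIntegral ℤ ((d : K) * x) := by
    have : IsAlgebraic ℤ x := (IsFractionRing.isAlgebraic_iff ℤ ℚ K).2 (Algebra.IsAlgebraic.isAlgebraic x)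
    obtain ⟨d, hd, h⟩ := this.exists_integral_multiple
    refine ⟨d.natAbs, Int.natAbs_pos.2 hd, ?_⟩
    rw [zsmul_eq_mul] at h
    rcases Int.natAbs_eq d with h1 | h1
    · rw [h1, Int.cast_natCast] at h; exact h
    · rw [h1] at h
      rw [Int.cast_neg, Int.cast_natCast] at h
      simpa only [neg_mul, neg_neg] using h.neg
  obtain ⟨B, hB⟩ := exists_nat_ge (∑ τ : K →+* ℂ, ‖τ x‖)
  refine ⟨d * (B + 1), by positivity, fun k => ⟨?_, fun τ => ?_⟩⟩
  · convert isIntegral_natCast_pow_mul (B + 1) hdx using 1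
    push_cast; ring
  · have h1 : ‖τ x‖ ≤ ∑ τ : K →+* ℂ, ‖τ x‖ :=
      Finset.single_le_sum (f := fun τ : K →+* ℂ => ‖τ x‖) (fun _ _ => norm_nonneg _) (Finset.mem_univ τ)
    have h2 : (1 : ℝ) ≤ d := by exact_mod_cast hd
    have h3 : (0 : ℝ) ≤ B := Nat.cast_nonneg B
    push_cast
    rw [zero_mul, pow_zero, mul_one]
    nlinarith

theorem SizeLE.sum (hc : 1 ≤ c) {ι : Type*} {e : ℕ} (s : Finset ι) {β : ι → ℕ → K}
    (h : ∀ i ∈ s, SizeLE c q e (β i)) : SizeLE c q e (fun k => ∑ i ∈ s, β i k) := by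
  classical
  induction s using Finset.induction_on with
  | empty => simpa using (SizeLE.const (c := c) (q := q) (0 : K)).mono hc (Nat.zero_le e)
  | insert a s ha ih =>
    simp only [Finset.sum_insert ha]
    exact (h a (Finset.mem_insert_self _ _)).add
      (ih fun i hi => h i (Finset.mem_insert_of_mem hi))

theorem SizeLE.pow {e : ℕ} {β : ℕ → K} (h : SizeLE c q e β) (n : ℕ) :
    SizeLE c q (n * e) (fun k => β k ^ n) := by
  induction n with
  | zero => simpa using SizeLE.const (c := c) (q := q) (1 : K)
  | succ n ih =>
    simp only [pow_succ]
    rw [Nat.succ_mul]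
    exact ih.mul h

theorem SizeLE.prod {ι : Type*} {e : ι → ℕ} (s : Finset ι) {β : ι → ℕ → K}
    (h : ∀ i ∈ s, SizeLE c q (e i) (β i)) :
    SizeLE c q (∑ i ∈ s, e i) (fun k => ∏ i ∈ s, β i k) := by
  classical
  induction s using Finset.induction_on with
  | empty => simpa using SizeLE.const (c := c) (q := q) (1 : K)
  | insert a s ha ih =>
    simp only [Finset.prod_insert ha, Finset.sum_insert ha]
    exact (h a (Finset.mem_insert_self _ _)).mul
      (ih fun i hi => h i (Finset.mem_insert_of_mem hi))

/-- Liouville's inequality. -/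
theorem SizeLE.liouville (hc : 1 ≤ c) {e : ℕ} {β : ℕ → K} (h : SizeLE c q e β) (φ : K →+* ℂ) :
    ∃ C : ℝ, 0 < C ∧ ∀ k, β k ≠ 0 →
      1 ≤ C * (c : ℝ) ^ ((2 * Module.finrank ℚ K + 1) * e * q ^ k) * ‖φ (β k)‖ := by
  obtain ⟨C, hC, h⟩ := h
  have hC1 : (1 : ℝ) ≤ C := by exact_mod_cast hC
  have hc1 : (1 : ℝ) ≤ c := by exact_mod_cast hc
  refine ⟨(C * C) ^ Module.finrank ℚ K * C, by positivity, fun k hk => ?_⟩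
  obtain ⟨hintg, hconj⟩ := h k
  set γ : K := (C : K) * (c : K) ^ (e * q ^ k) * β k with hγ
  have hγ0 : γ ≠ 0 := by
    have : (c : K) ≠ 0 := by exact_mod_cast (by lia : c ≠ 0)
    have : (C : K) ≠ 0 := by exact_mod_cast (by lia : C ≠ 0)
    positivity
  have hτ : ∀ τ : K →+* ℂ, ‖τ γ‖ = C * (c : ℝ) ^ (e * q ^ k) * ‖τ (β k)‖ := by
    intro τ
    rw [hγ, map_mul, map_mul, map_pow, map_natCast, map_natCast, norm_mul, norm_mul, norm_pow,
      RCLike.norm_natCast, RCLike.norm_natCast]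
  have hprod : (1 : ℝ) ≤ ∏ τ : K →+* ℂ, ‖τ γ‖ := by
    have h1 : ((Algebra.norm ℚ γ : ℚ) : ℂ) = ∏ τ : K →ₐ[ℚ] ℂ, τ γ := by
      have := Algebra.norm_eq_prod_embeddings ℚ ℂ γ
      simpa using this
    have h2 : ∏ τ : K →+* ℂ, ‖τ γ‖ = ‖((Algebra.norm ℚ γ : ℚ) : ℂ)‖ := by
      rw [h1, norm_prod]
      exact Fintype.prod_equiv (RingHom.equivRatAlgHom K ℂ) _ _ fun τ => rfl
    obtain ⟨m, hm⟩ := IsIntegrallyClosed.isIntegral_iff.1 (Algebra.isIntegral_norm ℚ hintg)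
    have hm0 : m ≠ 0 := by
      rintro rfl
      rw [map_zero] at hm
      exact hγ0 (Algebra.norm_eq_zero_iff.1 hm.symm)
    rw [h2, ← hm]
    simp only [eq_intCast, Rat.cast_intCast, Complex.norm_intCast]
    exact_mod_cast Int.one_le_abs hm0
  classical
  rw [← Finset.mul_prod_erase _ _ (Finset.mem_univ φ)] at hprod
  set w : ℝ := (c : ℝ) ^ (e * q ^ k) with hw
  have hw1 : 1 ≤ w := one_le_pow₀ hc1
  have hbd : ∏ τ ∈ Finset.univ.erase φ, ‖τ γ‖ ≤ (C * C * w ^ 2) ^ Module.finrank ℚ K := by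
    calc ∏ τ ∈ Finset.univ.erase φ, ‖τ γ‖ ≤ ∏ τ ∈ Finset.univ.erase φ, (C * C * w ^ 2 : ℝ) := by
          refine Finset.prod_le_prod (fun _ _ => norm_nonneg _) fun τ _ => ?_
          rw [hτ]
          calc C * w * ‖τ (β k)‖ ≤ C * w * (C * w) := by gcongr; exact hconj τ
            _ = _ := by ring
      _ = (C * C * w ^ 2 : ℝ) ^ (Finset.univ.erase φ).card := by rw [Finset.prod_const]
      _ ≤ _ := by
          refine pow_le_pow_right₀ ?_ ?_
          · have : 1 ≤ (C : ℝ) * C := by nlinarith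
            have : 1 ≤ w ^ 2 := one_le_pow₀ hw1
            nlinarith
          · rw [← NumberField.Embeddings.card K ℂ]
            exact (Finset.card_le_card (Finset.erase_subset _ _)).trans_eq rfl
  have hexp : (c : ℝ) ^ ((2 * Module.finrank ℚ K + 1) * e * q ^ k) =
      (w ^ 2) ^ Module.finrank ℚ K * w := by
    rw [hw, ← pow_mul, ← pow_mul, ← pow_add]
    congr 1; ring
  rw [hexp]
  calc (1 : ℝ) ≤ ‖φ γ‖ * ∏ τ ∈ Finset.univ.erase φ, ‖τ γ‖ := hprod
    _ ≤ ‖φ γ‖ * (C * C * w ^ 2) ^ Module.finrank ℚ K := by gcongr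
    _ = _ := by rw [hτ, mul_pow]; ring

end Size
end Mahler

namespace Mahler

open Filter Topology

section Pade

variable {K : Type*} [Field K] (φ : K →+* ℂ) {σ : Type*} [Fintype σ]

/-- The exponent vector attached to a bounded family of natural numbers. -/
noncomputable def expVec {d : ℕ} (u : σ → Fin (d + 1)) : σ →₀ ℕ :=
  Finsupp.equivFunOnFinite.symm fun i => (u i : ℕ)

theorem expVec_injective {d : ℕ} :
    Function.Injective (expVec : (σ → Fin (d + 1)) → σ →₀ ℕ) := by
  intro u u' h
  funext i
  exact Fin.ext (DFunLike.congr_fun h i)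

/-- Padé-type approximants: a combination of the powers of `F` vanishing to high order at `0`. -/
theorem exists_pade (F : MvPolynomial σ (convSubring φ)) {δ : ℕ} (hδ : ∀ i, F.degreeOf i ≤ δ)
    {J : ℕ} (hJ : 0 < J) (M : ℕ) :
    ∃ P : Fin J → MvPolynomial σ (Polynomial K), (∃ j, P j ≠ 0) ∧
      (∀ j i, (P j).degreeOf i ≤ J * δ) ∧
      (∀ j m, ((P j).coeff m).natDegree ≤ 2 ^ Fintype.card σ * M) ∧
      ∀ m, ∀ n < J * M, PowerSeries.coeff n
        (((∑ j, MvPolynomial.map (polyConv φ) (P j) * F ^ (j : ℕ)).coeff m :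
          convSubring φ) : PowerSeries K) = 0 := by
  classical
  set D := J * δ with hD
  set B := 2 ^ Fintype.card σ * M with hB
  let e : Matrix (Fin (J * M) × (σ → Fin (2 * D + 1))) (Fin J × (σ → Fin (D + 1)) × Fin (B + 1)) K :=
    fun a b => PowerSeries.coeff (a.1 : ℕ) (((MvPolynomial.monomial (expVec b.2.1)
      (polyConv φ (Polynomial.X ^ (b.2.2 : ℕ))) * F ^ (b.1 : ℕ)).coeff (expVec a.2) :
        convSubring φ) : PowerSeries K)
  have hcard : Module.finrank K (Fin (J * M) × (σ → Fin (2 * D + 1)) → K) <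
      Module.finrank K (Fin J × (σ → Fin (D + 1)) × Fin (B + 1) → K) := by
    simp only [Module.finrank_fintype_fun_eq_card, Fintype.card_prod, Fintype.card_fin,
      Fintype.card_pi, Finset.prod_const, Finset.card_univ]
    have h1 : (2 * D + 1) ^ Fintype.card σ ≤ 2 ^ Fintype.card σ * (D + 1) ^ Fintype.card σ := by
      rw [← mul_pow]
      exact Nat.pow_le_pow_left (by lia) _
    have h2 : 0 < (D + 1) ^ Fintype.card σ := by positivity
    calc J * M * (2 * D + 1) ^ Fintype.card σ ≤
          J * M * (2 ^ Fintype.card σ * (D + 1) ^ Fintype.card σ) := by gcongr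
      _ = J * ((D + 1) ^ Fintype.card σ * B) := by rw [hB]; ring
      _ < _ := by gcongr; lia
  have hker := LinearMap.ker_ne_bot_of_finrank_lt (f := e.mulVecLin) hcard
  obtain ⟨v, hv, hv0⟩ := Submodule.exists_mem_ne_zero_of_ne_bot hker
  let P : Fin J → MvPolynomial σ (Polynomial K) := fun j =>
    ∑ u : σ → Fin (D + 1), ∑ l : Fin (B + 1),
      MvPolynomial.monomial (expVec u) (Polynomial.monomial (l : ℕ) (v (j, u, l)))
  have hcoeff : ∀ j m, (P j).coeff m = ∑ u : σ → Fin (D + 1), ∑ l : Fin (B + 1),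
      if expVec u = m then Polynomial.monomial (l : ℕ) (v (j, u, l)) else 0 := by
    intro j m
    simp only [P, MvPolynomial.coeff_sum, MvPolynomial.coeff_monomial]
  have hdegP : ∀ j i, (P j).degreeOf i ≤ D := by
    intro j i
    rw [MvPolynomial.degreeOf_le_iff]
    intro m hm
    rw [MvPolynomial.mem_support_iff, hcoeff] at hm
    obtain ⟨u, -, hu⟩ := Finset.exists_ne_zero_of_sum_ne_zero hm
    obtain ⟨l, -, hl⟩ := Finset.exists_ne_zero_of_sum_ne_zero hu
    have : expVec u = m := by
      by_contra h
      exact hl (if_neg h)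
    rw [← this]
    exact Nat.lt_succ_iff.1 (u i).2
  refine ⟨P, ?_, hdegP, ?_, ?_⟩
  · obtain ⟨⟨j, u, l⟩, hne⟩ := Function.ne_iff.1 hv0
    refine ⟨j, fun h0 => hne ?_⟩
    have h1 := congrArg (fun p => Polynomial.coeff (MvPolynomial.coeff (expVec u) p) l) h0
    beta_reduce at h1
    rw [hcoeff] at h1
    simp only [expVec_injective.eq_iff, Polynomial.finsetSum_coeff] at h1
    rw [Finset.sum_eq_single u, Finset.sum_eq_single l] at h1
    · simpa using h1
    · intro l' _ hl'
      rw [if_pos rfl, Polynomial.coeff_monomial, if_neg (fun h => hl' (Fin.ext h))]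
    · simp
    · intro u' _ hu'
      simp [hu']
    · simp
  · intro j m
    rw [hcoeff]
    refine Polynomial.natDegree_sum_le_of_forall_le _ _ fun u _ =>
      Polynomial.natDegree_sum_le_of_forall_le _ _ fun l _ => ?_
    split_ifs
    · exact (Polynomial.natDegree_monomial_le _).trans (Nat.lt_succ_iff.1 l.2)
    · simp
  · intro m n hn
    by_cases hm : ∀ i, m i ≤ 2 * D
    · obtain ⟨u', rfl⟩ : ∃ u' : σ → Fin (2 * D + 1), expVec u' = m :=
        ⟨fun i => ⟨m i, Nat.lt_succ_iff.2 (hm i)⟩, by ext i; rfl⟩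
      have hvk := congrFun (LinearMap.mem_ker.1 hv) (⟨n, hn⟩, u')
      rw [Matrix.mulVecLin_apply, Matrix.mulVec, dotProduct] at hvk
      simp only [Fintype.sum_prod_type, Pi.zero_apply] at hvk
      rw [← hvk]
      rw [MvPolynomial.coeff_sum, AddSubmonoidClass.coe_finsetSum, map_sum]
      refine Finset.sum_congr rfl fun j _ => ?_
      simp only [P, map_sum, Finset.sum_mul, MvPolynomial.coeff_sum,
        AddSubmonoidClass.coe_finsetSum]
      refine Finset.sum_congr rfl fun u _ => Finset.sum_congr rfl fun l _ => ?_
      have h1 : MvPolynomial.map (polyConv φ)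
          (MvPolynomial.monomial (expVec u) (Polynomial.monomial (l : ℕ) (v (j, u, l)))) =
          MvPolynomial.C (polyConv φ (Polynomial.C (v (j, u, l)))) *
          MvPolynomial.monomial (expVec u) (polyConv φ (Polynomial.X ^ (l : ℕ))) := by
        rw [MvPolynomial.map_monomial, MvPolynomial.C_mul_monomial, ← map_mul,
          Polynomial.C_mul_X_pow_eq_monomial]
      rw [h1, mul_assoc, MvPolynomial.coeff_C_mul, Subring.coe_mul, coe_polyConv,
        Polynomial.coe_C, PowerSeries.coeff_C_mul, mul_comm]
    · push Not at hm
      obtain ⟨i, hi⟩ := hm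
      have hlt : MvPolynomial.degreeOf i (∑ j, MvPolynomial.map (polyConv φ) (P j) *
          F ^ (j : ℕ)) < m i := by
        refine lt_of_le_of_lt ?_ hi
        refine (MvPolynomial.degreeOf_sum_le _ _ _).trans (Finset.sup_le fun j _ => ?_)
        refine (MvPolynomial.degreeOf_mul_le _ _ _).trans ?_
        have h1 : (MvPolynomial.map (polyConv φ) (P j)).degreeOf i ≤ D :=
          (MvPolynomial.degreeOf_le_iff.2 fun m hm => (MvPolynomial.degreeOf_le_iff.1 (hdegP j i))
            m (MvPolynomial.support_map_subset _ _ hm))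
        have h2 : (F ^ (j : ℕ)).degreeOf i ≤ D :=
          (MvPolynomial.degreeOf_pow_le _ _ _).trans (Nat.mul_le_mul j.2.le (hδ i))
        lia
      rw [MvPolynomial.notMem_support_iff.1 (MvPolynomial.notMem_support_of_degreeOf_lt i hlt)]
      simp

end Pade
end Mahler

namespace Mahler

open Filter Topology

section XDvd

variable {K : Type*} [Field K] (φ : K →+* ℂ)

theorem polyConv_X_dvd_iff (f : convSubring φ) :
    polyConv φ Polynomial.X ∣ f ↔ PowerSeries.constantCoeff (f : PowerSeries K) = 0 := by
  constructor
  · rintro ⟨g, rfl⟩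
    simp
  · intro h
    obtain ⟨g, hg⟩ := PowerSeries.X_dvd_iff.2 h
    have hg' : g ∈ convSubring φ := mem_convSubring_of_X_mul_mem φ (hg ▸ f.2)
    refine ⟨⟨g, hg'⟩, Subtype.ext ?_⟩
    simp [hg]

theorem polyConv_X_prime : Prime (polyConv φ Polynomial.X) := by
  refine ⟨?_, ?_, fun a b hab => ?_⟩
  · rw [Ne, map_eq_zero_iff _ (polyConv_injective φ)]
    exact Polynomial.X_ne_zero
  · intro h
    have := (polyConv_X_dvd_iff φ 1).1 (isUnit_iff_dvd_one.1 h)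
    simp at this
  · rw [polyConv_X_dvd_iff] at hab ⊢
    rw [polyConv_X_dvd_iff]
    simpa using hab

theorem polyConv_X_pow_dvd {f : convSubring φ} {N : ℕ}
    (h : ∀ n < N, PowerSeries.coeff n (f : PowerSeries K) = 0) :
    polyConv φ Polynomial.X ^ N ∣ f := by
  induction N generalizing f with
  | zero => simp
  | succ N ih =>
    obtain ⟨g, rfl⟩ := (polyConv_X_dvd_iff φ f).2 (by simpa using h 0 (Nat.succ_pos _))
    rw [pow_succ']
    refine mul_dvd_mul_left _ (ih fun n hn => ?_)
    have := h (n + 1) (by lia)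
    simpa [PowerSeries.coeff_succ_X_mul] using this

theorem exists_eq_C_X_pow_mul {σ : Type*} {F : MvPolynomial σ (convSubring φ)} (hF : F ≠ 0) :
    ∃ (n : ℕ) (G : MvPolynomial σ (convSubring φ)),
      F = MvPolynomial.C (polyConv φ Polynomial.X) ^ n * G ∧
      ¬ MvPolynomial.C (polyConv φ Polynomial.X) ∣ G := by
  obtain ⟨m, hm⟩ := MvPolynomial.ne_zero_iff.1 hF
  have hfin : FiniteMultiplicity (MvPolynomial.C (polyConv φ Polynomial.X)) F := by
    have h1 : ((MvPolynomial.coeff m F : convSubring φ) : PowerSeries K) ≠ 0 := fun h =>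
      hm (Subtype.ext h)
    obtain ⟨n, hn⟩ := PowerSeries.exists_coeff_ne_zero_iff_ne_zero.2 h1
    refine ⟨n, fun h => hn ?_⟩
    rw [← map_pow, MvPolynomial.C_dvd_iff_dvd_coeff] at h
    obtain ⟨g, hg⟩ := h m
    rw [hg]
    simp only [Subring.coe_mul, SubmonoidClass.coe_pow, coe_polyConv, Polynomial.coe_X]
    rw [PowerSeries.coeff_X_pow_mul', if_neg (by lia)]
  obtain ⟨G, hG, hG'⟩ := hfin.exists_eq_pow_mul_and_not_dvd
  exact ⟨_, G, hG, hG'⟩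

end XDvd

section Bound

theorem eval₂_germ {R : Type*} [CommSemiring R] {σ : Type*} [Fintype σ] {l : Filter ℕ}
    (ψ : R →+* l.Germ ℂ) (u : R → ℕ → ℂ) (hu : ∀ r, ψ r = (u r : l.Germ ℂ)) (w : σ → ℕ → ℂ)
    (P : MvPolynomial σ R) :
    MvPolynomial.eval₂ ψ (fun i => (w i : l.Germ ℂ)) P =
      ((fun k => ∑ m ∈ P.support, u (P.coeff m) k * ∏ i, w i k ^ m i : ℕ → ℂ) : l.Germ ℂ) := by
  have h1 : ((fun k => ∑ m ∈ P.support, u (P.coeff m) k * ∏ i, w i k ^ m i : ℕ → ℂ) : l.Germ ℂ) =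
      Germ.coeRingHom (R := ℂ) l (∑ m ∈ P.support, u (P.coeff m) * ∏ i, w i ^ m i) := by
    simp only [Germ.coe_coeRingHom]
    congr 1
    funext k
    simp
  rw [h1, MvPolynomial.eval₂_eq', map_sum]
  simp only [map_mul, map_prod, map_pow, Germ.coe_coeRingHom, hu]

end Bound

end Mahler

namespace Mahler

open Filter Topology

section

variable {K : Type*} [Field K] [NumberField K] (φ : K →+* ℂ) {σ : Type*} [Fintype σ]
  {c q : ℕ}

theorem SizeLE.eval_polynomial (hc : 1 ≤ c) {β : ℕ → K} (h : SizeLE c q 1 β)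
    (p : Polynomial K) {d : ℕ} (hd : p.natDegree ≤ d) :
    SizeLE c q d (fun k => p.eval (β k)) := by
  simp only [Polynomial.eval_eq_sum_range]
  refine SizeLE.sum hc _ fun i hi => ?_
  have := (SizeLE.const (c := c) (q := q) (p.coeff i)).mul (h.pow i)
  refine this.mono hc ?_
  have := Finset.mem_range.1 hi
  lia

theorem SizeLE.eval_mvPolynomial (hc : 1 ≤ c) {β : ℕ → K} (h : SizeLE c q 1 β)
    {t : ℕ → σ → K} (ht : ∀ i, SizeLE c q 1 fun k => t k i)
    (P : MvPolynomial σ (Polynomial K)) {d D : ℕ} (hd : ∀ m, (P.coeff m).natDegree ≤ d)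
    (hD : ∀ i, P.degreeOf i ≤ D) :
    SizeLE c q (d + Fintype.card σ * D)
      (fun k => ∑ m ∈ P.support, (P.coeff m).eval (β k) * ∏ i, t k i ^ m i) := by
  refine SizeLE.sum hc _ fun m hm => ?_
  have := (h.eval_polynomial hc (P.coeff m) (hd m)).mul
    (SizeLE.prod Finset.univ fun i _ => (ht i).pow (m i))
  refine this.mono hc (Nat.add_le_add_left ?_ _)
  calc ∑ i, m i * 1 ≤ ∑ _i : σ, D := Finset.sum_le_sum fun i _ => by
        rw [mul_one]; exact (MvPolynomial.le_degreeOf_of_mem_support i hm).trans (hD i)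
    _ = _ := by simp

theorem exists_bound_eval {l : Filter ℕ} {Z : ℕ → ℂ} (hZ : Tendsto Z l (𝓝 0)) (hc : 1 ≤ c)
    {t : ℕ → σ → K} (ht : ∀ i, SizeLE c q 1 fun k => t k i)
    (G : MvPolynomial σ (convSubring φ)) {D : ℕ} (hD : ∀ i, G.degreeOf i ≤ D) :
    ∃ C : ℝ, 0 < C ∧ ∀ᶠ k in l,
      ‖∑ m ∈ G.support, psSum φ ((G.coeff m : convSubring φ) : PowerSeries K) (Z k) * ∏ i, φ (t k i) ^ m i‖ ≤
        C * (c : ℝ) ^ (Fintype.card σ * D * q ^ k) := by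
  have hc1 : (1 : ℝ) ≤ c := by exact_mod_cast hc
  have hterm : ∀ m ∈ G.support, ∃ C : ℝ, 0 < C ∧ ∀ᶠ k in l,
      ‖psSum φ ((G.coeff m : convSubring φ) : PowerSeries K) (Z k) * ∏ i, φ (t k i) ^ m i‖ ≤
        C * (c : ℝ) ^ (Fintype.card σ * D * q ^ k) := by
    intro m hm
    have h1 := ((tendsto_psSum_of_mem φ (G.coeff m).2).comp hZ).norm
    have h2 := h1.eventually_lt_const (lt_add_one _)
    obtain ⟨C, hC, hC'⟩ : SizeLE c q (Fintype.card σ * D) fun k => ∏ i, t k i ^ m i := by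
      refine (SizeLE.prod Finset.univ fun i _ => (ht i).pow (m i)).mono hc ?_
      calc ∑ i, m i * 1 ≤ ∑ _i : σ, D := Finset.sum_le_sum fun i _ => by
            rw [mul_one]; exact (MvPolynomial.le_degreeOf_of_mem_support i hm).trans (hD i)
        _ = _ := by simp
    refine ⟨(‖φ (PowerSeries.constantCoeff ((G.coeff m : convSubring φ) : PowerSeries K))‖ + 1) * C, by positivity,
      h2.mono fun k hk => ?_⟩
    rw [norm_mul, mul_assoc]
    have h3 := (hC' k).2 φ
    simp only [map_prod, map_pow] at h3
    exact mul_le_mul hk.le h3 (norm_nonneg _) (by positivity)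
  choose! C hC hC' using hterm
  refine ⟨1 + ∑ m ∈ G.support, C m, by
    have := Finset.sum_nonneg fun m hm => (hC m hm).le
    positivity, ?_⟩
  filter_upwards [(Filter.eventually_all_finset G.support).2 hC'] with k hk
  refine (norm_sum_le _ _).trans ((Finset.sum_le_sum hk).trans ?_)
  rw [← Finset.sum_mul]
  gcongr
  linarith

theorem degreeOf_le_of_eq_C_mul {R : Type*} [CommRing R] [IsDomain R] {τ : Type*} {a : R} (ha : a ≠ 0)
    {E G : MvPolynomial τ R} (h : E = MvPolynomial.C a * G) (i : τ) :
    G.degreeOf i ≤ E.degreeOf i := by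
  rw [MvPolynomial.degreeOf_le_iff]
  intro m hm
  refine MvPolynomial.le_degreeOf_of_mem_support i ?_
  rw [MvPolynomial.mem_support_iff, h, MvPolynomial.coeff_C_mul]
  exact mul_ne_zero ha (MvPolynomial.mem_support_iff.1 hm)

theorem tendsto_const_mul_pow_pow {x : ℝ} (h0 : 0 ≤ x) (h1 : x < 1) (hq : 2 ≤ q) (C : ℝ) :
    Tendsto (fun k : ℕ => C * x ^ (q ^ k)) atTop (𝓝 0) := by
  have h2 : Tendsto (fun k : ℕ => q ^ k) atTop atTop :=
    tendsto_pow_atTop_atTop_of_one_lt (by lia)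
  simpa using ((tendsto_pow_atTop_nhds_zero_of_lt_one h0 h1).comp h2).const_mul C

/-- Functional transcendence is preserved when polynomial coefficients are replaced by convergent
power series, along a sequence `(α ^ q ^ k, t k)` of controlled height. -/
theorem eval₂_evGerm_ne_zero (hq : 2 ≤ q) (hc : 1 ≤ c) {α : K} (hα0 : α ≠ 0) (hα1 : ‖φ α‖ < 1)
    {l : Ultrafilter ℕ} (hl : (l : Filter ℕ) ≤ atTop)
    (hZ : Tendsto (fun k => φ α ^ q ^ k) (l : Filter ℕ) (𝓝 0))
    (hα : SizeLE c q 1 fun k => α ^ q ^ k)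
    {t : ℕ → σ → K} (ht : ∀ i, SizeLE c q 1 fun k => t k i)
    (hind : ∀ P : MvPolynomial σ (Polynomial K), P ≠ 0 →
      MvPolynomial.eval₂ ((evGerm φ hZ).comp (polyConv φ))
        (fun i => ((fun k => φ (t k i) : ℕ → ℂ) : (l : Filter ℕ).Germ ℂ)) P ≠ 0)
    {F : MvPolynomial σ (convSubring φ)} (hF : F ≠ 0) :
    MvPolynomial.eval₂ (evGerm φ hZ)
      (fun i => ((fun k => φ (t k i) : ℕ → ℂ) : (l : Filter ℕ).Germ ℂ)) F ≠ 0 := by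
  classical
  set T : σ → (l : Filter ℕ).Germ ℂ := fun i => ((fun k => φ (t k i) : ℕ → ℂ)) with hT
  intro h0
  set X := polyConv φ Polynomial.X with hX
  have hXprime : Prime (MvPolynomial.C (σ := σ) X) :=
    (MvPolynomial.prime_C_iff σ).2 (polyConv_X_prime φ)
  have hX0 : X ≠ 0 := (polyConv_X_prime φ).ne_zero
  obtain ⟨n, G, hG, hXG⟩ := exists_eq_C_X_pow_mul φ hF
  have hevX : evGerm φ hZ X ≠ 0 := by
    rw [Ne, map_eq_zero_iff _ (evGerm_injective φ hZ ?_)]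
    · exact hX0
    · exact Eventually.of_forall fun k => pow_ne_zero _ (by simpa using hα0)
  have hG0 : MvPolynomial.eval₂ (evGerm φ hZ) T G = 0 := by
    rw [hG, MvPolynomial.eval₂_mul, MvPolynomial.eval₂_pow, MvPolynomial.eval₂_C] at h0
    exact (mul_eq_zero.1 h0).resolve_left (pow_ne_zero _ hevX)
  clear h0 hG hF F
  obtain ⟨δ, hδ⟩ : ∃ δ, ∀ i, G.degreeOf i ≤ δ :=
    ⟨∑ i, G.degreeOf i, fun i => Finset.single_le_sum (f := fun i => G.degreeOf i)
      (fun _ _ => Nat.zero_le _) (Finset.mem_univ i)⟩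
  set h := Fintype.card σ with hh
  set N := 2 * Module.finrank ℚ K + 1 with hN
  have hc1 : (1 : ℝ) ≤ c := by exact_mod_cast hc
  have hφα : 0 < ‖φ α‖ := by simpa using hα0
  obtain ⟨J, hJ0, hJ⟩ : ∃ J : ℕ, 0 < J ∧ ‖φ α‖ ^ J * (c : ℝ) ^ (N * 2 ^ h) < 1 := by
    obtain ⟨J, hJ⟩ := exists_pow_lt_of_lt_one (y := ‖φ α‖)
      (show (0 : ℝ) < ((c : ℝ) ^ (N * 2 ^ h))⁻¹ by positivity) hα1
    refine ⟨J + 1, Nat.succ_pos _, ?_⟩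
    have : ‖φ α‖ ^ (J + 1) < ((c : ℝ) ^ (N * 2 ^ h))⁻¹ :=
      lt_of_le_of_lt (pow_le_pow_of_le_one hφα.le hα1.le (Nat.le_succ J)) hJ
    rwa [lt_inv_comm₀ (by positivity) (by positivity), ← one_div, lt_div_iff₀ (by positivity), mul_comm] at this
  obtain ⟨M, hM⟩ := exists_pow_lt_of_lt_one (show (0 : ℝ) <
    ((c : ℝ) ^ (N * (h * (J * δ)) + h * (2 * (J * δ))))⁻¹ by positivity) hJ
  obtain ⟨P, hP0, hPdeg, hPnat, hPvan⟩ := exists_pade φ G hδ hJ0 M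
  have hne : (Finset.univ.filter fun j => P j ≠ 0).Nonempty := by
    obtain ⟨j, hj⟩ := hP0
    exact ⟨j, by simpa using hj⟩
  set j₀ := (Finset.univ.filter fun j => P j ≠ 0).min' hne with hj₀
  have hPj₀ : P j₀ ≠ 0 := (Finset.mem_filter.1 (Finset.min'_mem _ hne)).2
  have hlt : ∀ j, j < j₀ → P j = 0 := by
    intro j hj
    by_contra hj'
    exact absurd (Finset.min'_le _ j (by simpa using hj')) (not_le.2 hj)
  set E' := ∑ j, MvPolynomial.map (polyConv φ) (P j) * G ^ ((j : ℕ) - (j₀ : ℕ)) with hE'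
  have hE : ∑ j, MvPolynomial.map (polyConv φ) (P j) * G ^ (j : ℕ) = G ^ (j₀ : ℕ) * E' := by
    rw [hE', Finset.mul_sum]
    refine Finset.sum_congr rfl fun j _ => ?_
    rcases lt_or_ge j j₀ with hj | hj
    · simp [hlt j hj]
    · rw [mul_left_comm, ← pow_add, Nat.add_sub_cancel' hj]
  have hdvd : MvPolynomial.C X ^ (J * M) ∣ E' := by
    refine hXprime.pow_dvd_of_dvd_mul_left _ (mt hXprime.dvd_of_dvd_pow hXG)
      (a := G ^ (j₀ : ℕ)) ?_
    rw [← hE, ← map_pow, MvPolynomial.C_dvd_iff_dvd_coeff]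
    exact fun m => polyConv_X_pow_dvd φ fun n hn => hPvan m n hn
  obtain ⟨E'', hE''⟩ := hdvd
  have hE'deg : ∀ i, E'.degreeOf i ≤ 2 * (J * δ) := by
    intro i
    refine (MvPolynomial.degreeOf_sum_le _ _ _).trans (Finset.sup_le fun j _ => ?_)
    refine (MvPolynomial.degreeOf_mul_le _ _ _).trans ?_
    have h1 : (MvPolynomial.map (polyConv φ) (P j)).degreeOf i ≤ J * δ :=
      (MvPolynomial.degreeOf_le_iff.2 fun m hm => (MvPolynomial.degreeOf_le_iff.1 (hPdeg j i))
        m (MvPolynomial.support_map_subset _ _ hm))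
    have h2 : (G ^ ((j : ℕ) - (j₀ : ℕ))).degreeOf i ≤ J * δ :=
      (MvPolynomial.degreeOf_pow_le _ _ _).trans
        (Nat.mul_le_mul ((Nat.sub_le _ _).trans j.2.le) (hδ i))
    lia
  have hE''deg : ∀ i, E''.degreeOf i ≤ 2 * (J * δ) := fun i =>
    (degreeOf_le_of_eq_C_mul (pow_ne_zero (J * M) hX0) (by rw [hE'', map_pow]) i).trans (hE'deg i)
  have hevE' : MvPolynomial.eval₂ (evGerm φ hZ) T E' =
      MvPolynomial.eval₂ ((evGerm φ hZ).comp (polyConv φ)) T (P j₀) := by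
    rw [hE', MvPolynomial.eval₂_sum, Finset.sum_eq_single j₀]
    · rw [MvPolynomial.eval₂_mul, MvPolynomial.eval₂_pow, MvPolynomial.eval₂_map]
      simp
    · intro j _ hj
      rw [MvPolynomial.eval₂_mul, MvPolynomial.eval₂_pow, hG0]
      rcases lt_or_gt_of_ne hj with hj | hj
      · simp [hlt j hj]
      · rw [zero_pow (Nat.sub_ne_zero_of_lt hj), mul_zero]
    · simp
  have key : MvPolynomial.eval₂ ((evGerm φ hZ).comp (polyConv φ)) T (P j₀) =
      evGerm φ hZ X ^ (J * M) * MvPolynomial.eval₂ (evGerm φ hZ) T E'' := by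
    rw [← hevE', hE'', MvPolynomial.eval₂_mul, MvPolynomial.eval₂_pow, MvPolynomial.eval₂_C]
  set β : ℕ → K := fun k => ∑ m ∈ (P j₀).support, ((P j₀).coeff m).eval (α ^ q ^ k) *
    ∏ i, t k i ^ m i with hβ
  have hβs : SizeLE c q (2 ^ h * M + h * (J * δ)) β :=
    SizeLE.eval_mvPolynomial hc hα ht (P j₀) (hPnat j₀) (hPdeg j₀)
  have hev1 : MvPolynomial.eval₂ ((evGerm φ hZ).comp (polyConv φ)) T (P j₀) =
      ((fun k => φ (β k) : ℕ → ℂ) : (l : Filter ℕ).Germ ℂ) := by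
    rw [eval₂_germ _ (fun (p : Polynomial K) k => φ (p.eval (α ^ q ^ k)))]
    · simp [hβ]
    · intro p
      rw [RingHom.comp_apply, evGerm_polyConv]
      congr 1
      funext k
      rw [← map_pow, Polynomial.eval_map_apply]
  have hev2 : MvPolynomial.eval₂ (evGerm φ hZ) T E'' = ((fun k => ∑ m ∈ E''.support,
      psSum φ ((E''.coeff m : convSubring φ) : PowerSeries K) (φ α ^ q ^ k) *
        ∏ i, φ (t k i) ^ m i : ℕ → ℂ) : (l : Filter ℕ).Germ ℂ) :=
    eval₂_germ _ (fun (f : convSubring φ) k => psSum φ (f : PowerSeries K) (φ α ^ q ^ k))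
      (fun f => evGerm_apply φ hZ f) _ _
  have hev3 : evGerm φ hZ X ^ (J * M) =
      ((fun k => (φ α ^ q ^ k) ^ (J * M) : ℕ → ℂ) : (l : Filter ℕ).Germ ℂ) := by
    rw [← map_pow, hX, ← map_pow, evGerm_polyConv]
    simp
  have hne0 : ∀ᶠ k in (l : Filter ℕ), β k ≠ 0 := by
    have h1 := hind _ hPj₀
    rw [hev1] at h1
    refine Ultrafilter.eventually_not.2 fun h2 => h1 (Germ.coe_eq.2 (h2.mono fun k hk => ?_))
    simp [hk]
  rw [hev1, hev2, hev3, ← Germ.coe_mul] at key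
  have hkey := Germ.coe_eq.1 key
  obtain ⟨C₁, hC₁, hL⟩ := hβs.liouville hc φ
  obtain ⟨C₂, hC₂, hU⟩ := exists_bound_eval φ hZ hc ht E'' hE''deg
  set x : ℝ := ‖φ α‖ ^ (J * M) * (c : ℝ) ^ (N * (2 ^ h * M + h * (J * δ)) + h * (2 * (J * δ)))
    with hx
  have hx0 : 0 ≤ x := by positivity
  have hx1 : x < 1 := by
    have : x = (‖φ α‖ ^ J * (c : ℝ) ^ (N * 2 ^ h)) ^ M *
        (c : ℝ) ^ (N * (h * (J * δ)) + h * (2 * (J * δ))) := by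
      rw [hx]; ring
    rw [this]
    rwa [lt_inv_comm₀ (by positivity) (by positivity), ← one_div, lt_div_iff₀ (by positivity),
      mul_comm] at hM
  have hlim := (tendsto_const_mul_pow_pow hx0 hx1 hq (C₁ * C₂)).mono_left hl
  obtain ⟨k, hk1, hk2, hk3, hk4⟩ := (hne0.and (hkey.and (hU.and
    (hlim.eventually_lt_const one_pos)))).exists
  have h1 := hL k hk1
  beta_reduce at hk2
  rw [hk2] at h1
  simp only [Pi.mul_apply, norm_mul] at h1
  refine absurd h1 (not_le.2 (lt_of_le_of_lt ?_ hk4))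
  calc C₁ * (c : ℝ) ^ (N * (2 ^ h * M + h * (J * δ)) * q ^ k) *
        (‖(φ α ^ q ^ k) ^ (J * M)‖ * _) ≤
      C₁ * (c : ℝ) ^ (N * (2 ^ h * M + h * (J * δ)) * q ^ k) *
        (‖(φ α ^ q ^ k) ^ (J * M)‖ * (C₂ * (c : ℝ) ^ (h * (2 * (J * δ)) * q ^ k))) := by
        gcongr
    _ = C₁ * C₂ * x ^ q ^ k := by
        generalize N * (2 ^ h * M + h * (J * δ)) = e₁ at hx
        generalize h * (2 * (J * δ)) = e₂ at hx
        rw [norm_pow, norm_pow, hx, mul_pow, ← pow_mul, ← pow_mul, ← pow_mul, add_mul, pow_add,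
          mul_comm (q ^ k)]
        ring

end
end Mahler

namespace Mahler

open Filter Topology

section Decay

variable {A : ℕ → ℝ} {q : ℕ}

/-- Polynomial growth from a bound of `A (q * n + j)` by the values up to `n + q`. -/
theorem exists_polynomial_growth (hA : ∀ n, 0 ≤ A n) (hq : 2 ≤ q) {L : ℝ}
    (h : ∀ n, ∀ j < q, ∀ b, (∀ m ≤ n + q, A m ≤ b) → A (q * n + j) ≤ L * b) :
    ∃ (C : ℝ) (τ : ℕ), 0 < C ∧ ∀ n, A n ≤ C * ((n : ℝ) + 1) ^ τ := by
  obtain ⟨τ, hτ⟩ := pow_unbounded_of_one_lt L (show (1 : ℝ) < 3 / 2 by norm_num)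
  set C : ℝ := 1 + ∑ m ∈ Finset.range (7 * q * q + q), A m with hC
  have hC0 : 0 < C := by
    have := Finset.sum_nonneg fun m (_ : m ∈ Finset.range (7 * q * q + q)) => hA m
    positivity
  refine ⟨C, τ, hC0, fun N => ?_⟩
  induction N using Nat.strong_induction_on with
  | _ N ih =>
    have h1N : (1 : ℝ) ≤ ((N : ℝ) + 1) ^ τ := one_le_pow₀ (by linarith [Nat.cast_nonneg (α := ℝ) N])
    by_cases hN : N < 7 * q * q + q
    · have : A N ≤ C := by
        have := Finset.single_le_sum (fun m (_ : m ∈ Finset.range (7 * q * q + q)) => hA m)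
          (Finset.mem_range.2 hN)
        linarith
      nlinarith
    · have hdm := Nat.div_add_mod N q
      have hj : N % q < q := Nat.mod_lt _ (by lia)
      set n := N / q
      set j := N % q
      have hn : 7 * q ≤ n := by
        by_contra hn
        have : q * n ≤ q * (7 * q) := Nat.mul_le_mul_left _ (by lia)
        nlinarith
      have hlt : n + q < N := by nlinarith
      rw [← hdm]
      have hb : ∀ m ≤ n + q, A m ≤ C * ((n : ℝ) + q + 1) ^ τ := fun m hm => by
        refine (ih m (by lia)).trans ?_
        have : (m : ℝ) ≤ n + q := by exact_mod_cast hm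
        gcongr
      refine (h n j hj _ hb).trans ?_
      have hkey : (3 / 2 : ℝ) * ((n : ℝ) + q + 1) ≤ ((q * n + j : ℕ) : ℝ) + 1 := by
        have h1 : (2 : ℝ) ≤ q := by exact_mod_cast hq
        have h2 : (7 : ℝ) * q ≤ n := by exact_mod_cast hn
        have h3 : (0 : ℝ) ≤ j := Nat.cast_nonneg j
        push_cast
        nlinarith
      calc L * (C * ((n : ℝ) + q + 1) ^ τ) ≤ (3 / 2) ^ τ * (C * ((n : ℝ) + q + 1) ^ τ) := by
            gcongr
        _ = C * ((3 / 2 : ℝ) * ((n : ℝ) + q + 1)) ^ τ := by rw [mul_pow]; ring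
        _ ≤ _ := by gcongr

/-- Exponential decay from polynomial growth and a local bound of `n * A n`. -/
theorem exists_exponential_decay {C : ℝ} {τ : ℕ} (hC : 0 < C)
    (hgrow : ∀ n, A n ≤ C * ((n : ℝ) + 1) ^ τ) {L : ℝ} {D : ℕ} (hD : 0 < D)
    (h : ∀ n b, (∀ m, n ≤ m + D → m ≤ n + D → A m ≤ b) → (n : ℝ) * A n ≤ L * b) :
    ∃ C' ρ : ℝ, 0 < C' ∧ 0 < ρ ∧ ρ < 1 ∧ ∀ n, A n ≤ C' * ρ ^ n := by
  obtain ⟨n₀, hn₀⟩ := exists_nat_gt (2 * L)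
  have hiter : ∀ k n : ℕ, n₀ + 1 + k * D ≤ n → A n ≤ (1 / 2) ^ k * (C * ((n : ℝ) + k * D + 1) ^ τ) := by
    intro k
    induction k with
    | zero => intro n _; simpa using hgrow n
    | succ k ih =>
      intro n hn
      have hn1 : n₀ + 1 + k * D + D ≤ n := by rw [add_mul] at hn; lia
      have hb : ∀ m, n ≤ m + D → m ≤ n + D →
          A m ≤ (1 / 2) ^ k * (C * ((n : ℝ) + (k + 1 : ℕ) * D + 1) ^ τ) := fun m h1 h2 => by
        refine (ih m (by lia)).trans ?_
        have : (m : ℝ) ≤ n + D := by exact_mod_cast h2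
        have h3 : (m : ℝ) + k * D + 1 ≤ (n : ℝ) + (k + 1 : ℕ) * D + 1 := by push_cast; linarith
        gcongr
      have h4 := h n _ hb
      have h5 : (n₀ : ℝ) < n := by exact_mod_cast (by lia : n₀ < n)
      set W : ℝ := (1 / 2) ^ k * (C * ((n : ℝ) + (k + 1 : ℕ) * D + 1) ^ τ) with hW
      have hW0 : 0 < W := by positivity
      have h6 : (n : ℝ) * A n ≤ n * (W / 2) := by nlinarith
      have h7 : A n ≤ W / 2 := le_of_mul_le_mul_left h6 (by linarith [Nat.cast_nonneg (α := ℝ) n₀])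
      refine h7.trans (le_of_eq ?_)
      rw [hW, pow_succ]
      ring
  set r : ℝ := (1 / 2 : ℝ) ^ (1 / (4 * D : ℝ)) with hr
  have hDr : (0 : ℝ) < D := by exact_mod_cast hD
  have hr0 : 0 < r := by positivity
  have hr1 : r < 1 := Real.rpow_lt_one (by norm_num) (by norm_num) (by positivity)
  have hrpow : r ^ (4 * D) = 1 / 2 := by
    rw [hr, ← Real.rpow_natCast, ← Real.rpow_mul (by norm_num)]
    push_cast
    rw [one_div_mul_cancel (by positivity), Real.rpow_one]
  have hlim : Tendsto (fun n : ℕ => (n : ℝ) ^ τ * r ^ n) atTop (𝓝 0) :=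
    tendsto_pow_const_mul_const_pow_of_abs_lt_one τ (by rwa [abs_of_pos hr0])
  have hev : ∀ᶠ n in atTop, A n ≤ r ^ n := by
    have h1 := (hlim.const_mul (C * 4 ^ τ * r⁻¹ ^ (4 * D))).eventually_lt_const
      (show C * 4 ^ τ * r⁻¹ ^ (4 * D) * 0 < 1 by simp)
    filter_upwards [h1, eventually_ge_atTop (2 * (n₀ + 1) + 1)] with n hn1 hn2
    set k := n / (2 * D) with hk
    have hk1 : 2 * D * k ≤ n := Nat.mul_div_le _ _
    have hk2 : n < 2 * D * k + 2 * D := by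
      have := Nat.lt_mul_div_succ n (show 0 < 2 * D by lia)
      rw [mul_add, mul_one] at this; exact this
    have hle := hiter k n (by nlinarith)
    refine hle.trans ?_
    have h3 : (n : ℝ) + k * D + 1 ≤ 4 * n := by
      have : n + k * D + 1 ≤ 4 * n := by nlinarith
      exact_mod_cast this
    have h4 : (1 / 2 : ℝ) ^ k ≤ r ^ n * r ^ n * r⁻¹ ^ (4 * D) := by
      rw [← hrpow, ← pow_mul]
      have h6 : r ^ (4 * D * k) = r ^ (2 * D * k + 2 * D) * r ^ (2 * D * k + 2 * D) *
          r⁻¹ ^ (4 * D) := by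
        rw [← pow_add, inv_pow, eq_mul_inv_iff_mul_eq₀ (by positivity), ← pow_add]
        congr 1
        ring
      have h5 : r ^ (2 * D * k + 2 * D) ≤ r ^ n := pow_le_pow_of_le_one hr0.le hr1.le hk2.le
      rw [h6]
      gcongr
    calc (1 / 2 : ℝ) ^ k * (C * ((n : ℝ) + k * D + 1) ^ τ) ≤
          (r ^ n * r ^ n * r⁻¹ ^ (4 * D)) * (C * (4 * n) ^ τ) := by gcongr
      _ = r ^ n * (C * 4 ^ τ * r⁻¹ ^ (4 * D) * ((n : ℝ) ^ τ * r ^ n)) := by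
          rw [mul_pow]; ring
      _ ≤ r ^ n * 1 := by gcongr
      _ = r ^ n := mul_one _
  obtain ⟨n₁, hn₁⟩ := eventually_atTop.1 hev
  refine ⟨1 + ∑ m ∈ Finset.range n₁, |A m| * r⁻¹ ^ m, r, by positivity, hr0, hr1, fun n => ?_⟩
  have hs : 0 ≤ ∑ m ∈ Finset.range n₁, |A m| * r⁻¹ ^ m := by positivity
  rcases lt_or_ge n n₁ with hn | hn
  · have h1 := Finset.single_le_sum (f := fun m => |A m| * r⁻¹ ^ m)
      (fun m (_ : m ∈ Finset.range n₁) => by positivity) (Finset.mem_range.2 hn)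
    have h2 : |A n| ≤ (∑ m ∈ Finset.range n₁, |A m| * r⁻¹ ^ m) * r ^ n := by
      have := mul_le_mul_of_nonneg_right h1 (pow_pos hr0 n).le
      rwa [mul_assoc, inv_pow, inv_mul_cancel₀ (by positivity), mul_one] at this
    have h3 := pow_pos hr0 n
    nlinarith [le_abs_self (A n)]
  · have h3 := pow_pos hr0 n
    nlinarith [hn₁ n hn]

/-- Superexponential decay from exponential decay and a bound of `A n` by values near `q * n`. -/
theorem exists_superexponential_decay {C ρ : ℝ} (hC : 0 < C) (hρ : 0 < ρ) (hρ1 : ρ < 1)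
    (hdec : ∀ n, A n ≤ C * ρ ^ n) (hq : 2 ≤ q) {L : ℝ} {D : ℕ}
    (h : ∀ n b, (∀ m, q * n ≤ m + D → m ≤ q * n → A m ≤ b) → A n ≤ L * b) (ε : ℝ) (hε : 0 < ε) :
    ∃ C' : ℝ, 0 < C' ∧ ∀ n, A n ≤ C' * ε ^ n := by
  have hiter : ∀ k : ℕ, ∃ C' : ℝ, 0 < C' ∧ ∀ n, A n ≤ C' * (ρ ^ q ^ k) ^ n := by
    intro k
    induction k with
    | zero => exact ⟨C, hC, by simpa using hdec⟩
    | succ k ih =>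
      obtain ⟨C', hC', ih⟩ := ih
      set r := ρ ^ q ^ k with hr
      have hr0 : 0 < r := by positivity
      have hr1 : r ≤ 1 := pow_le_one₀ hρ.le hρ1.le
      refine ⟨(1 + |L|) * (C' * r⁻¹ ^ D), by positivity, fun n => ?_⟩
      have hb : ∀ m, q * n ≤ m + D → m ≤ q * n → A m ≤ C' * r⁻¹ ^ D * r ^ (q * n) := by
        intro m h1 _
        refine (ih m).trans ?_
        rw [mul_assoc]
        refine mul_le_mul_of_nonneg_left ?_ hC'.le
        rw [inv_pow, inv_mul_eq_div, le_div_iff₀ (by positivity), ← pow_add]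
        exact pow_le_pow_of_le_one hr0.le hr1 h1
      refine (h n _ hb).trans ?_
      have h2 : (ρ ^ q ^ (k + 1)) ^ n = r ^ (q * n) := by
        rw [hr, ← pow_mul, ← pow_mul]
        congr 1
        ring
      rw [h2]
      have h3 : 0 ≤ C' * r⁻¹ ^ D * r ^ (q * n) := by positivity
      nlinarith [le_abs_self L]
  obtain ⟨k, hk⟩ := exists_pow_lt_of_lt_one hε hρ1
  obtain ⟨C', hC', h1⟩ := hiter k
  refine ⟨C', hC', fun n => (h1 n).trans ?_⟩
  have : ρ ^ q ^ k ≤ ε :=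
    (pow_le_pow_of_le_one hρ.le hρ1.le (Nat.lt_pow_self (by lia)).le).trans hk.le
  gcongr

end Decay
end Mahler

namespace Mahler

open Filter Topology

theorem algebraMap_polynomial_apply {k : Type*} [Field k] (p : Polynomial k) :
    algebraMap (Polynomial k) (PowerSeries k) p = p := by
  rw [PowerSeries.algebraMap_apply', Algebra.algebraMap_self, PowerSeries.map_id]
  rfl

section Entire

/-- The subring of everywhere convergent power series. -/
def entireSubring : Subring (PowerSeries ℂ) where
  carrier := {f | ∀ ρ : ℝ, 0 < ρ → AbsConv (RingHom.id ℂ) f ρ}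
  zero_mem' := fun ρ _ => by simpa using AbsConv.coe (φ := RingHom.id ℂ) (0 : Polynomial ℂ) ρ
  one_mem' := fun ρ _ => by simpa using AbsConv.coe (φ := RingHom.id ℂ) (1 : Polynomial ℂ) ρ
  add_mem' := fun hf hg ρ hρ => (hf ρ hρ).add (hg ρ hρ) hρ.le
  mul_mem' := fun hf hg ρ hρ => (hf ρ hρ).mul (hg ρ hρ) hρ.le
  neg_mem' := fun hf ρ hρ => (hf ρ hρ).neg

/-- Evaluation of everywhere convergent power series. -/
noncomputable def entireEval (z : ℂ) : entireSubring →+* ℂ where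
  toFun f := psSum (RingHom.id ℂ) (f : PowerSeries ℂ) z
  map_one' := by simpa using psSum_coe (φ := RingHom.id ℂ) (1 : Polynomial ℂ) z
  map_zero' := by simpa using psSum_coe (φ := RingHom.id ℂ) (0 : Polynomial ℂ) z
  map_add' := fun f g => psSum_add (f.2 (‖z‖ + 1) (by positivity)) (g.2 (‖z‖ + 1) (by positivity))
    (by linarith)
  map_mul' := fun f g => psSum_mul (f.2 (‖z‖ + 1) (by positivity)) (g.2 (‖z‖ + 1) (by positivity))
    (by linarith)

theorem entireEval_coe (z : ℂ) (p : Polynomial ℂ) (hp : (p : PowerSeries ℂ) ∈ entireSubring) :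
    entireEval z ⟨p, hp⟩ = p.eval z := by
  change psSum _ _ _ = _
  rw [psSum_coe, Polynomial.map_id]

theorem coe_mem_entireSubring (p : Polynomial ℂ) : (p : PowerSeries ℂ) ∈ entireSubring :=
  fun ρ _ => AbsConv.coe p ρ

theorem mem_entireSubring_of_decay {f : PowerSeries ℂ}
    (h : ∀ ε : ℝ, 0 < ε → ∃ C : ℝ, 0 < C ∧ ∀ n, ‖PowerSeries.coeff n f‖ ≤ C * ε ^ n) :
    f ∈ entireSubring := by
  intro ρ hρ
  obtain ⟨C, hC, h⟩ := h (2 * ρ)⁻¹ (by positivity)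
  refine Summable.of_nonneg_of_le (fun n => by positivity) (fun n => ?_)
    ((summable_geometric_of_lt_one (r := 1 / 2) (by norm_num) (by norm_num)).mul_left C)
  calc ‖RingHom.id ℂ (PowerSeries.coeff n f)‖ * ρ ^ n ≤ C * (2 * ρ)⁻¹ ^ n * ρ ^ n := by
        gcongr; exact h n
    _ = C * (1 / 2) ^ n := by
        rw [mul_assoc, ← mul_pow]; congr 2; field_simp

theorem differentiable_psSum {f : PowerSeries ℂ} (hf : f ∈ entireSubring) :
    Differentiable ℂ (psSum (RingHom.id ℂ) f) := by
  intro z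
  have h1 : DifferentiableOn ℂ (psSum (RingHom.id ℂ) f) (Metric.ball 0 (‖z‖ + 1)) := by
    refine Complex.differentiableOn_tsum_of_summable_norm (hf (‖z‖ + 1) (by positivity))
      (fun n => by fun_prop) Metric.isOpen_ball fun n w hw => ?_
    rw [norm_mul, norm_pow]
    have : ‖w‖ ≤ ‖z‖ + 1 := by simpa using (mem_ball_zero_iff.1 hw).le
    gcongr
  exact h1.differentiableAt (Metric.isOpen_ball.mem_nhds (by simp))

theorem exists_norm_eval_le (p : Polynomial ℂ) :
    ∃ C : ℝ, 0 < C ∧ ∀ z : ℂ, 1 ≤ ‖z‖ → ‖p.eval z‖ ≤ C * ‖z‖ ^ p.natDegree := by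
  refine ⟨1 + ∑ i ∈ Finset.range (p.natDegree + 1), ‖p.coeff i‖, by positivity, fun z hz => ?_⟩
  rw [Polynomial.eval_eq_sum_range]
  refine (norm_sum_le _ _).trans ?_
  rw [add_mul, Finset.sum_mul]
  refine le_add_of_nonneg_of_le (by positivity) (Finset.sum_le_sum fun i hi => ?_)
  rw [norm_mul, norm_pow]
  gcongr
  exact Nat.lt_succ_iff.1 (Finset.mem_range.1 hi)

theorem exists_growth_of_isIntegral {f : PowerSeries ℂ} (hf : f ∈ entireSubring)
    (hintg : IsIntegral (Polynomial ℂ) f) :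
    ∃ (C : ℝ) (D : ℕ), 0 < C ∧ ∀ z : ℂ, 1 ≤ ‖z‖ → ‖psSum (RingHom.id ℂ) f z‖ ≤ C * ‖z‖ ^ D := by
  obtain ⟨p, hp, hp0⟩ := hintg
  choose C hC hCb using exists_norm_eval_le
  refine ⟨∑ i ∈ Finset.range p.natDegree, C (p.coeff i) + 1,
    ∑ i ∈ Finset.range p.natDegree, (p.coeff i).natDegree, ?_, fun z hz => ?_⟩
  · have := Finset.sum_nonneg fun i (_ : i ∈ Finset.range p.natDegree) => (hC (p.coeff i)).le
    positivity
  set y := psSum (RingHom.id ℂ) f z with hy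
  let ψ : Polynomial ℂ →+* entireSubring :=
    (Polynomial.coeToPowerSeries.ringHom (R := ℂ)).codRestrict entireSubring coe_mem_entireSubring
  have h1 : Polynomial.eval₂ ψ ⟨f, hf⟩ p = 0 := by
    apply Subtype.val_injective
    rw [← entireSubring.coe_subtype, Polynomial.hom_eval₂, map_zero, ← hp0]
    have hψ : entireSubring.subtype.comp ψ = algebraMap (Polynomial ℂ) (PowerSeries ℂ) :=
      RingHom.ext fun r => (algebraMap_polynomial_apply r).symm
    rw [hψ]
    rfl
  have h2 : (p.map (Polynomial.evalRingHom z)).IsRoot y := by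
    rw [Polynomial.IsRoot, Polynomial.eval_map]
    have := congrArg (entireEval z) h1
    rw [Polynomial.hom_eval₂, map_zero] at this
    have hψ : (entireEval z).comp ψ = Polynomial.evalRingHom z :=
      RingHom.ext fun r => entireEval_coe z r (coe_mem_entireSubring r)
    rwa [hψ] at this
  have h3 := h2.norm_lt_cauchyBound (hp.map _).ne_zero
  rw [Polynomial.cauchyBound, (hp.map _).leadingCoeff, hp.natDegree_map] at h3
  set D := ∑ i ∈ Finset.range p.natDegree, (p.coeff i).natDegree with hD
  have hs : 0 ≤ ∑ i ∈ Finset.range p.natDegree, C (p.coeff i) :=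
    Finset.sum_nonneg fun i _ => (hC (p.coeff i)).le
  have h4 : (Finset.range p.natDegree).sup
      (fun i => ‖(p.map (Polynomial.evalRingHom z)).coeff i‖₊) ≤
      Real.toNNReal ((∑ i ∈ Finset.range p.natDegree, C (p.coeff i)) * ‖z‖ ^ D) := by
    refine Finset.sup_le fun i hi => NNReal.le_toNNReal_of_coe_le ?_
    rw [coe_nnnorm, Polynomial.coeff_map]
    refine (hCb _ z hz).trans (mul_le_mul ?_ ?_ (by positivity) hs)
    · exact Finset.single_le_sum (f := fun i => C (p.coeff i)) (fun i _ => (hC _).le) hi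
    · refine pow_le_pow_right₀ hz ?_
      exact Finset.single_le_sum (f := fun i => (p.coeff i).natDegree) (fun i _ => Nat.zero_le _) hi
  have h5 := NNReal.coe_lt_coe.2 h3
  have h6 := NNReal.coe_le_coe.2 h4
  rw [Real.coe_toNNReal _ (by positivity)] at h6
  simp only [nnnorm_one, div_one, NNReal.coe_add, NNReal.coe_one, coe_nnnorm] at h5
  have h7 : (1 : ℝ) ≤ ‖z‖ ^ D := one_le_pow₀ hz
  rw [add_mul, one_mul]
  linarith

theorem exists_polynomial_of_isIntegral {f : PowerSeries ℂ} (hf : f ∈ entireSubring)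
    (hintg : IsIntegral (Polynomial ℂ) f) : ∃ p : Polynomial ℂ, (p : PowerSeries ℂ) = f := by
  obtain ⟨C, D, hC, hb⟩ := exists_growth_of_isIntegral hf hintg
  set p := PowerSeries.trunc (D + 1) f with hp
  set g : PowerSeries ℂ := PowerSeries.mk fun n => PowerSeries.coeff (n + (D + 1)) f with hg
  have hfg : f = PowerSeries.X ^ (D + 1) * g + (p : PowerSeries ℂ) := PowerSeries.eq_X_pow_mul_shift_add_trunc _ f
  have hgE : g ∈ entireSubring := by
    intro ρ hρ
    have h1 := ((summable_nat_add_iff (D + 1)).2 (hf ρ hρ)).mul_right (ρ⁻¹ ^ (D + 1))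
    refine h1.congr fun n => ?_
    simp only [hg, PowerSeries.coeff_mk]
    rw [pow_add, mul_assoc, mul_assoc, ← mul_pow, mul_inv_cancel₀ hρ.ne', one_pow, mul_one]
  have hev : ∀ z, psSum (RingHom.id ℂ) f z = z ^ (D + 1) * psSum (RingHom.id ℂ) g z + p.eval z := by
    intro z
    have h1 : (⟨f, hf⟩ : entireSubring) = ⟨_, coe_mem_entireSubring (Polynomial.X ^ (D + 1))⟩ *
        ⟨g, hgE⟩ + ⟨_, coe_mem_entireSubring p⟩ := Subtype.ext (by simpa using hfg)
    have := congrArg (entireEval z) h1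
    rw [map_add, map_mul, entireEval_coe, entireEval_coe] at this
    rw [Polynomial.eval_pow, Polynomial.eval_X] at this
    exact this
  have hg0 : g = 0 := by
    by_contra hg0
    have hlim : Tendsto (psSum (RingHom.id ℂ) g) (cocompact ℂ) (𝓝 0) := by
      obtain ⟨C', hC', hb'⟩ := exists_norm_eval_le p
      have hpd : p.natDegree ≤ D := Nat.lt_succ_iff.1 (PowerSeries.natDegree_trunc_lt f D)
      have h1 : Tendsto (fun z : ℂ => (C + C') * ‖z‖⁻¹) (cocompact ℂ) (𝓝 0) := by
        simpa using (tendsto_inv_atTop_zero.comp (tendsto_norm_cocompact_atTop (E := ℂ))).const_mul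
          (C + C')
      refine squeeze_zero_norm' ?_ h1
      filter_upwards [(tendsto_norm_cocompact_atTop (E := ℂ)).eventually_ge_atTop 1] with z hz
      have h2 : ‖z‖ ^ (D + 1) * ‖psSum (RingHom.id ℂ) g z‖ ≤ (C + C') * ‖z‖ ^ D := by
        rw [← norm_pow, ← norm_mul]
        have h3 : z ^ (D + 1) * psSum (RingHom.id ℂ) g z = psSum (RingHom.id ℂ) f z - p.eval z := by
          rw [hev z]; ring
        rw [h3, add_mul]
        refine (norm_sub_le _ _).trans (add_le_add (hb z hz) ((hb' z hz).trans ?_))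
        gcongr
      have hz0 : 0 < ‖z‖ := by linarith
      rw [← div_eq_mul_inv, le_div_iff₀ hz0]
      rw [pow_succ] at h2
      have h4 : ‖z‖ ^ D * (‖psSum (RingHom.id ℂ) g z‖ * ‖z‖) ≤ ‖z‖ ^ D * (C + C') := by linarith
      exact le_of_mul_le_mul_left h4 (by positivity)
    have h0 : ∀ z, psSum (RingHom.id ℂ) g z = 0 := fun z =>
      (differentiable_psSum hgE).apply_eq_of_tendsto_cocompact z hlim
    obtain ⟨z, hz⟩ := (eventually_psSum_ne_zero (RingHom.id ℂ) ⟨1, one_pos, hgE 1 one_pos⟩ hg0).exists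
    exact hz (h0 z)
  exact ⟨p, by rw [hfg, hg0]; simp⟩

end Entire
end Mahler

namespace Mahler

open Filter Topology

section Sections

variable {k : Type*} [Field k] {q : ℕ}

/-- The `j`-th section operator of step `q`: it extracts the coefficients of index `q * n + j`. -/
noncomputable def sect (q j : ℕ) (f : PowerSeries k) : PowerSeries k :=
  PowerSeries.mk fun n => PowerSeries.coeff (q * n + j) f

@[simp]
theorem coeff_sect (j : ℕ) (f : PowerSeries k) (n : ℕ) :
    PowerSeries.coeff n (sect q j f) = PowerSeries.coeff (q * n + j) f :=
  PowerSeries.coeff_mk _ _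

theorem sect_mul_expand (hq : q ≠ 0) {j : ℕ} (hj : j < q) (f g : PowerSeries k) :
    sect q j (f * PowerSeries.expand q hq g) = sect q j f * g := by
  ext n
  rw [coeff_sect, PowerSeries.coeff_mul, PowerSeries.coeff_mul]
  have hinj : Function.Injective fun x : ℕ × ℕ => (q * x.1 + j, q * x.2) := by
    rintro ⟨a, b⟩ ⟨c, d⟩ h
    simp only [Prod.mk.injEq, add_left_inj, mul_eq_mul_left_iff, hq, or_false] at h
    exact Prod.ext h.1 h.2
  rw [← Finset.sum_subset (s₁ := (Finset.HasAntidiagonal.antidiagonal n).image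
    fun x : ℕ × ℕ => (q * x.1 + j, q * x.2))]
  · rw [Finset.sum_image (hinj.injOn)]
    refine Finset.sum_congr rfl fun x _ => ?_
    rw [coeff_sect, PowerSeries.coeff_expand_mul]
  · intro y hy
    obtain ⟨x, hx, rfl⟩ := Finset.mem_image.1 hy
    rw [Finset.HasAntidiagonal.mem_antidiagonal] at hx ⊢
    simp only [← hx]
    ring
  · rintro ⟨a, b⟩ hy hn
    rw [Finset.HasAntidiagonal.mem_antidiagonal] at hy
    by_cases hb : q ∣ b
    · obtain ⟨b, rfl⟩ := hb
      simp only at hy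
      have hbn : b ≤ n := by
        by_contra hlt
        have : q * (n + 1) ≤ q * b := Nat.mul_le_mul_left _ (by lia)
        rw [mul_add] at this
        lia
      have h1 := Nat.mul_le_mul_left q hbn
      refine absurd (Finset.mem_image.2 ⟨(n - b, b), ?_, ?_⟩) hn
      · rw [Finset.HasAntidiagonal.mem_antidiagonal]
        simp only
        lia
      · simp only [Prod.mk.injEq, and_true]
        rw [Nat.mul_sub]
        lia
    · rw [PowerSeries.coeff_expand_of_not_dvd _ _ _ hb, mul_zero]

theorem exists_polynomial_coe_eq_sect (hq : 2 ≤ q) (j : ℕ) (h : Polynomial k) :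
    ∃ p : Polynomial k, (p : PowerSeries k) = sect q j h ∧
      (0 < h.natDegree → p.natDegree < h.natDegree) := by
  have hz : ∀ n, h.natDegree < q * n + j → h.coeff (q * n + j) = 0 := fun n hn =>
    Polynomial.coeff_eq_zero_of_natDegree_lt hn
  have hc : ∀ n, (PowerSeries.trunc (h.natDegree + 1) (sect q j (h : PowerSeries k))).coeff n =
      h.coeff (q * n + j) := by
    intro n
    rw [PowerSeries.coeff_trunc]
    split_ifs with hn
    · simp
    · exact (hz n (by nlinarith)).symm
  refine ⟨PowerSeries.trunc (h.natDegree + 1) (sect q j h), PowerSeries.ext fun n => ?_,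
    fun h0 => ?_⟩
  · rw [Polynomial.coeff_coe, hc]
    simp
  · have : (PowerSeries.trunc (h.natDegree + 1) (sect q j (h : PowerSeries k))).natDegree ≤
        h.natDegree - 1 := by
      rw [Polynomial.natDegree_le_iff_coeff_eq_zero]
      intro n hn
      rw [hc]
      exact hz n (by nlinarith [show h.natDegree ≤ n by lia])
    lia

/-- The Euler derivation `z d/dz`. -/
noncomputable def euler (f : PowerSeries k) : PowerSeries k :=
  PowerSeries.mk fun n => (n : k) * PowerSeries.coeff n f

@[simp]
theorem coeff_euler (f : PowerSeries k) (n : ℕ) :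
    PowerSeries.coeff n (euler f) = (n : k) * PowerSeries.coeff n f :=
  PowerSeries.coeff_mk _ _

theorem euler_expand (hq : q ≠ 0) (f : PowerSeries k) :
    euler (PowerSeries.expand q hq f) = (q : k) • PowerSeries.expand q hq (euler f) := by
  ext n
  rw [coeff_euler, map_smul, smul_eq_mul]
  by_cases h : q ∣ n
  · obtain ⟨n, rfl⟩ := h
    rw [PowerSeries.coeff_expand_mul, PowerSeries.coeff_expand_mul, coeff_euler]
    push_cast
    ring
  · rw [PowerSeries.coeff_expand_of_not_dvd _ _ _ h, PowerSeries.coeff_expand_of_not_dvd _ _ _ h]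
    simp

theorem polynomial_smul_eq (p : Polynomial k) (f : PowerSeries k) :
    p • f = (p : PowerSeries k) * f := by
  rw [Algebra.smul_def, algebraMap_polynomial_apply]

theorem C_smul_mem {M : Submodule (Polynomial k) (PowerSeries k)} {f : PowerSeries k} (a : k)
    (h : f ∈ M) : a • f ∈ M := by
  have : a • f = Polynomial.C a • f := by
    rw [polynomial_smul_eq, Polynomial.coe_C, PowerSeries.smul_eq_C_mul]
  rw [this]
  exact M.smul_mem _ h

/-- A Mahler module stable under `Δ z d/dz` is stable under `z ^ s z d/dz`. -/
theorem exists_X_pow_smul_euler_mem [CharZero k] (hq : 2 ≤ q)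
    {M : Submodule (Polynomial k) (PowerSeries k)}
    (hσ : ∀ m ∈ M, PowerSeries.expand q (by lia) m ∈ M)
    (hΛ : ∀ j < q, ∀ m ∈ M, (Polynomial.X ^ q : Polynomial k) • sect q j m ∈ M)
    (hΔ : ∃ Δ : Polynomial k, Δ ≠ 0 ∧ ∀ m ∈ M, Δ • euler m ∈ M) :
    ∃ s : ℕ, ∀ m ∈ M, (Polynomial.X ^ s : Polynomial k) • euler m ∈ M := by
  have hq0 : q ≠ 0 := by lia
  suffices H : ∀ N : ℕ, ∀ h : Polynomial k, h.natDegree = N → h ≠ 0 →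
      (∃ s : ℕ, ∀ m ∈ M, (Polynomial.X ^ s * h) • euler m ∈ M) →
      ∃ s : ℕ, ∀ m ∈ M, (Polynomial.X ^ s : Polynomial k) • euler m ∈ M by
    obtain ⟨Δ, hΔ0, hΔ⟩ := hΔ
    exact H _ Δ rfl hΔ0 ⟨0, by simpa using hΔ⟩
  intro N
  induction N using Nat.strong_induction_on with
  | _ N ih =>
    rintro h rfl h0 ⟨s, hs⟩
    rcases Nat.eq_zero_or_pos h.natDegree with hN | hN
    · rw [Polynomial.natDegree_eq_zero] at hN
      obtain ⟨a, rfl⟩ := hN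
      have ha : a ≠ 0 := by rintro rfl; simp at h0
      refine ⟨s, fun m hm => ?_⟩
      have h1 := M.smul_mem (Polynomial.C a⁻¹) (hs m hm)
      rwa [smul_smul, mul_left_comm, ← map_mul, inv_mul_cancel₀ ha, map_one, mul_one] at h1
    · set j := h.natDegree % q with hj
      have hjq : j < q := Nat.mod_lt _ (by lia)
      obtain ⟨p, hp, hpd⟩ := exists_polynomial_coe_eq_sect hq j h
      refine ih p.natDegree (hpd hN) p rfl ?_ ⟨s + q, fun m hm => ?_⟩
      · rintro rfl
        have h2 := congrArg (PowerSeries.coeff (h.natDegree / q)) hp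
        rw [coeff_sect, Polynomial.coeff_coe, Polynomial.coeff_coe, hj, Nat.div_add_mod] at h2
        exact h0 (Polynomial.leadingCoeff_eq_zero.1 h2.symm)
      · have h1 := hs _ (hσ m hm)
        rw [euler_expand] at h1
        have h2 := M.smul_mem (Polynomial.X ^ (q * s - s)) (C_smul_mem (q : k)⁻¹ h1)
        have h3 := hΛ j hjq _ h2
        have hqk : (q : k) ≠ 0 := by exact_mod_cast hq0
        have h4 : (Polynomial.X ^ (q * s - s) : Polynomial k) • (q : k)⁻¹ •
            (Polynomial.X ^ s * h) • (q : k) • PowerSeries.expand q hq0 (euler m) =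
            (h : PowerSeries k) * PowerSeries.expand q hq0 (PowerSeries.X ^ s * euler m) := by
          simp only [polynomial_smul_eq, Algebra.mul_smul_comm,
            inv_smul_smul₀ hqk]
          have h5 : q * s - s + s = q * s := Nat.sub_add_cancel (Nat.le_mul_of_pos_left s (by lia))
          have h6 : (PowerSeries.X : PowerSeries k) ^ (q * s) =
              PowerSeries.X ^ (q * s - s) * PowerSeries.X ^ s := by rw [← pow_add, h5]
          rw [map_mul, map_pow, PowerSeries.expand_X, ← pow_mul, h6]
          push_cast
          ring
        rw [h4, sect_mul_expand hq0 hjq, ← hp] at h3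
        convert h3 using 1
        simp only [polynomial_smul_eq]
        push_cast
        ring

theorem coeff_X_pow_smul (s n : ℕ) (f : PowerSeries k) :
    PowerSeries.coeff (n + s) ((Polynomial.X ^ s : Polynomial k) • f) = PowerSeries.coeff n f := by
  rw [polynomial_smul_eq, Polynomial.coe_pow, Polynomial.coe_X, PowerSeries.coeff_X_pow_mul]

theorem norm_coeff_smul_le (φ : k →+* ℂ) (p : Polynomial k) (f : PowerSeries k) {N : ℕ} {b : ℝ}
    (hb : 0 ≤ b)
    (h : ∀ m, N ≤ m + p.natDegree → m ≤ N → ‖φ (PowerSeries.coeff m f)‖ ≤ b) :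
    ‖φ (PowerSeries.coeff N (p • f))‖ ≤
      (∑ a ∈ Finset.range (p.natDegree + 1), ‖φ (p.coeff a)‖) * b := by
  rw [polynomial_smul_eq, PowerSeries.coeff_mul, map_sum,
    Finset.Nat.sum_antidiagonal_eq_sum_range_succ
      (fun i j => φ (PowerSeries.coeff i (p : PowerSeries k) * PowerSeries.coeff j f))]
  refine (norm_sum_le _ _).trans ?_
  rw [Finset.sum_mul]
  calc _ ≤ ∑ a ∈ Finset.range (N + 1), ‖φ (p.coeff a)‖ * b := by
        refine Finset.sum_le_sum fun a ha => ?_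
        rw [map_mul, norm_mul, Polynomial.coeff_coe]
        rw [Finset.mem_range] at ha
        rcases le_or_gt a p.natDegree with hap | hap
        · gcongr
          exact h _ (by lia) (by lia)
        · simp [Polynomial.coeff_eq_zero_of_natDegree_lt hap]
    _ ≤ ∑ a ∈ Finset.range (max (N + 1) (p.natDegree + 1)), ‖φ (p.coeff a)‖ * b :=
        Finset.sum_le_sum_of_subset_of_nonneg (Finset.range_mono (le_max_left _ _))
          fun _ _ _ => by positivity
    _ = _ := by
        refine (Finset.sum_subset (Finset.range_mono (le_max_right _ _)) fun a _ ha => ?_).symm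
        rw [Finset.mem_range, not_lt] at ha
        simp [Polynomial.coeff_eq_zero_of_natDegree_lt (show p.natDegree < a by lia)]

theorem exists_bound_of_mem_span (φ : k →+* ℂ) {ι κ : Type*} [Fintype ι] [Fintype κ]
    (e : ι → PowerSeries k) {g : κ → PowerSeries k}
    (hg : ∀ j, g j ∈ Submodule.span (Polynomial k) (Set.range e)) :
    ∃ (L : ℝ) (D : ℕ), ∀ (N : ℕ) (b : ℝ),
      (∀ m, N ≤ m + D → m ≤ N → ∑ i, ‖φ (PowerSeries.coeff m (e i))‖ ≤ b) →
      ∑ j, ‖φ (PowerSeries.coeff N (g j))‖ ≤ L * b := by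
  simp only [Submodule.mem_span_range_iff_exists_fun] at hg
  choose c hc using hg
  refine ⟨∑ j, ∑ i, ∑ a ∈ Finset.range ((c j i).natDegree + 1), ‖φ ((c j i).coeff a)‖,
    ∑ j, ∑ i, (c j i).natDegree, fun N b hb => ?_⟩
  have hb0 : 0 ≤ b := le_trans (Finset.sum_nonneg fun _ _ => norm_nonneg _) (hb N (by lia) le_rfl)
  rw [Finset.sum_mul]
  refine Finset.sum_le_sum fun j _ => ?_
  rw [← hc j, map_sum, map_sum, Finset.sum_mul]
  refine (norm_sum_le _ _).trans (Finset.sum_le_sum fun i _ => ?_)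
  refine norm_coeff_smul_le φ _ _ hb0 fun m hm hmN => ?_
  have h1 : (c j i).natDegree ≤ ∑ j, ∑ i, (c j i).natDegree :=
    (Finset.single_le_sum (f := fun i => (c j i).natDegree) (fun _ _ => Nat.zero_le _)
      (Finset.mem_univ i)).trans (Finset.single_le_sum (f := fun j => ∑ i, (c j i).natDegree)
      (fun _ _ => Nat.zero_le _) (Finset.mem_univ j))
  exact (Finset.single_le_sum (f := fun i => ‖φ (PowerSeries.coeff m (e i))‖)
    (fun _ _ => norm_nonneg _) (Finset.mem_univ i)).trans (hb m (by lia) hmN)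

/-- A finitely generated module of integral power series that is stable under the Mahler operator,
its sections and a differential operator consists of polynomials. -/
theorem exists_polynomial_of_mem_stable [CharZero k] (φ : k →+* ℂ) (hq : 2 ≤ q)
    {M : Submodule (Polynomial k) (PowerSeries k)} (hfg : M.FG)
    (hintg : ∀ m ∈ M, IsIntegral (Polynomial k) m)
    (hσ : ∀ m ∈ M, PowerSeries.expand q (by lia) m ∈ M)
    (hΛ : ∀ j < q, ∀ m ∈ M, (Polynomial.X ^ q : Polynomial k) • sect q j m ∈ M)
    (hΔ : ∃ Δ : Polynomial k, Δ ≠ 0 ∧ ∀ m ∈ M, Δ • euler m ∈ M) {f : PowerSeries k}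
    (hf : f ∈ M) : ∃ p : Polynomial k, (p : PowerSeries k) = f := by
  have hq0 : q ≠ 0 := by lia
  obtain ⟨s, hs⟩ := exists_X_pow_smul_euler_mem hq hσ hΛ hΔ
  obtain ⟨N, e, rfl⟩ := Submodule.fg_iff_exists_fin_generating_family.1 hfg
  have heM : ∀ i, e i ∈ Submodule.span (Polynomial k) (Set.range e) := fun i =>
    Submodule.subset_span ⟨i, rfl⟩
  set A : ℕ → ℝ := fun n => ∑ i, ‖φ (PowerSeries.coeff n (e i))‖ with hA
  have hA0 : ∀ n, 0 ≤ A n := fun n => Finset.sum_nonneg fun _ _ => norm_nonneg _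
  obtain ⟨L₁, D₁, h₁⟩ := exists_bound_of_mem_span φ e
    (g := fun x : Fin q × Fin N => (Polynomial.X ^ q : Polynomial k) • sect q x.1 (e x.2))
    fun x => hΛ _ x.1.2 _ (heM _)
  obtain ⟨C, τ, hC, hgrow⟩ := exists_polynomial_growth (A := A) (q := q) (L := L₁) hA0 hq (by
    intro n j hj b hb
    refine le_trans ?_ (h₁ (n + q) b fun m _ hm => hb m hm)
    rw [Fintype.sum_prod_type]
    refine le_trans (le_of_eq ?_) (Finset.single_le_sum (fun _ _ => Finset.sum_nonneg
      fun _ _ => norm_nonneg _) (Finset.mem_univ (⟨j, hj⟩ : Fin q)))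
    refine Finset.sum_congr rfl fun i _ => ?_
    rw [coeff_X_pow_smul, coeff_sect])
  obtain ⟨L₂, D₂, h₂⟩ := exists_bound_of_mem_span φ e
    (g := fun i => (Polynomial.X ^ s : Polynomial k) • euler (e i)) fun i => hs _ (heM _)
  obtain ⟨C', ρ, hC', hρ, hρ1, hdec⟩ := exists_exponential_decay (A := A) hC hgrow (L := L₂)
    (D := D₂ + s + 1) (by lia) (by
      intro n b hb
      refine le_trans (le_of_eq ?_) (h₂ (n + s) b fun m hm hm' => hb m (by lia) (by lia))
      rw [hA, Finset.mul_sum]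
      refine Finset.sum_congr rfl fun i _ => ?_
      rw [coeff_X_pow_smul, coeff_euler, map_mul, norm_mul, map_natCast, Complex.norm_natCast])
  obtain ⟨L₃, D₃, h₃⟩ := exists_bound_of_mem_span φ e
    (g := fun i => PowerSeries.expand q hq0 (e i)) fun i => hσ _ (heM _)
  have hsup := exists_superexponential_decay (A := A) (L := L₃) (D := D₃) hC' hρ hρ1 hdec hq (by
      intro n b hb
      refine le_trans (le_of_eq ?_) (h₃ (q * n) b fun m hm hm' => hb m (by lia) (by lia))
      refine Finset.sum_congr rfl fun i _ => ?_
      rw [PowerSeries.coeff_expand_mul])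
  have hent : ∀ i, PowerSeries.map φ (e i) ∈ entireSubring := by
    refine fun i => mem_entireSubring_of_decay fun ε hε => ?_
    obtain ⟨C, hC, h⟩ := hsup ε hε
    refine ⟨C, hC, fun n => le_trans ?_ (h n)⟩
    rw [PowerSeries.coeff_map]
    exact Finset.single_le_sum (f := fun i => ‖φ (PowerSeries.coeff n (e i))‖)
      (fun _ _ => norm_nonneg _) (Finset.mem_univ i)
  have hf' : PowerSeries.map φ f ∈ entireSubring := by
    obtain ⟨c, rfl⟩ := Submodule.mem_span_range_iff_exists_fun _ |>.1 hf
    rw [map_sum]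
    refine sum_mem fun i _ => ?_
    rw [polynomial_smul_eq, map_mul, ← Polynomial.polynomial_map_coe]
    exact mul_mem (coe_mem_entireSubring _) (hent i)
  have hfint : IsIntegral (Polynomial ℂ) (PowerSeries.map φ f) := by
    obtain ⟨P, hP, hP0⟩ := hintg f hf
    refine ⟨P.map (Polynomial.mapRingHom φ), hP.map _, ?_⟩
    rw [Polynomial.eval₂_map, ← map_zero (PowerSeries.map φ), ← hP0, Polynomial.hom_eval₂]
    congr 1
    ext x <;> simp [algebraMap_polynomial_apply]
  obtain ⟨p, hp⟩ := exists_polynomial_of_isIntegral hf' hfint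
  refine ⟨PowerSeries.trunc (p.natDegree + 1) f, PowerSeries.ext fun n => ?_⟩
  rw [Polynomial.coeff_coe, PowerSeries.coeff_trunc]
  split_ifs with hn
  · rfl
  · apply φ.injective
    rw [map_zero, ← PowerSeries.coeff_map, ← hp, Polynomial.coeff_coe,
      Polynomial.coeff_eq_zero_of_natDegree_lt (by lia)]

end Sections
end Mahler

namespace Mahler

open IntermediateField IntermediateField.algebraAdjoinAdjoin

/-- An algebraic subextension of a finitely generated field extension is finite. -/
theorem finiteDimensional_of_le_adjoin {F Γ : Type*} [Field F] [Field Γ] [Algebra F Γ]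
    {ι : Type*} [Finite ι] (x : ι → Γ) (L : IntermediateField F Γ) [Algebra.IsAlgebraic F L]
    (hL : L ≤ adjoin F (Set.range x)) : FiniteDimensional F L := by
  obtain ⟨b, hb⟩ := Set.Finite.exists_maximal
    (Set.toFinite {s : Set ι | AlgebraicIndependent F (fun i : s => x i)})
    ⟨∅, (algebraicIndependent_empty_type_iff ..).2 (algebraMap F Γ).injective⟩
  have hbF : AlgebraicIndependent F (fun i : b => x i) := hb.1
  have halg : ∀ i, IsAlgebraic (Algebra.adjoin F (Set.range fun i : b => x i)) (x i) := by
    intro i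
    by_contra hi
    have hib : i ∉ b := fun h => hi (isAlgebraic_algebraMap
      (⟨x i, Algebra.subset_adjoin ⟨⟨i, h⟩, rfl⟩⟩ :
        Algebra.adjoin F (Set.range fun i : b => x i)))
    have h1 : AlgebraicIndepOn F x (insert i b) := by
      rw [AlgebraicIndepOn.insert_iff hib]
      refine ⟨hbF, ?_⟩
      rw [Set.image_eq_range]
      exact hi
    exact hib (hb.2 h1 (Set.subset_insert _ _) (Set.mem_insert _ _))
  have hbL : AlgebraicIndependent L (fun i : b => x i) := hbF.extendScalars L
  set xb : b → Γ := fun i => x i with hxb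
  have halg' : ∀ i, IsIntegral (adjoin F (Set.range xb)) (x i) := fun i =>
    ((IsFractionRing.isAlgebraic_iff (Algebra.adjoin F (Set.range xb))
      (adjoin F (Set.range xb)) Γ).1 (halg i)).isIntegral
  have hfin : FiniteDimensional (adjoin F (Set.range xb))
      (adjoin (adjoin F (Set.range xb)) (Set.range x)) := by
    refine finiteDimensional_adjoin ?_
    rintro _ ⟨i, rfl⟩
    exact halg' i
  have hle : adjoin F (Set.range x) ≤
      (adjoin (adjoin F (Set.range xb)) (Set.range x)).restrictScalars F :=
    adjoin_le_iff.2 (subset_adjoin _ _)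
  obtain ⟨κ, ⟨B⟩⟩ : ∃ κ : Set L, Nonempty (Module.Basis κ F L) :=
    ⟨_, ⟨Module.Basis.ofVectorSpace F L⟩⟩
  have hLI := linearIndependent_adjoin_of_algebraicIndependent hbL B.linearIndependent
  have hLI' : LinearIndependent (adjoin F (Set.range xb))
      (fun i => (⟨B i, hle (hL (B i).2)⟩ : adjoin (adjoin F (Set.range xb)) (Set.range x))) :=
    LinearIndependent.of_comp (adjoin (adjoin F (Set.range xb)) (Set.range x)).val.toLinearMap hLI
  have : Finite κ := hLI'.finite
  exact B.finiteDimensional_of_finite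

attribute [local instance] FractionRing.liftAlgebra in
theorem fg_of_isIntegral_of_mul_mem_adjoin {A B : Type*} [CommRing A] [IsDomain A] [CharZero A]
    [IsIntegrallyClosed A] [IsNoetherianRing A] [CommRing B] [IsDomain B] [Algebra A B]
    [FaithfulSMul A B] {ι : Type*} [Finite ι] (x : ι → B) (M : Submodule A B)
    (hintg : ∀ m ∈ M, IsIntegral A m)
    (hM : ∀ m ∈ M, ∃ w ∈ Algebra.adjoin A (Set.range x), w ≠ 0 ∧
      w * m ∈ Algebra.adjoin A (Set.range x)) : M.FG := by
  let K := FractionRing A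
  let Ω := FractionRing B
  let y : ι → Ω := fun i => algebraMap B Ω (x i)
  let L : IntermediateField K Ω := algebraicClosure K Ω ⊓ adjoin K (Set.range y)
  have hRy : ∀ w ∈ Algebra.adjoin A (Set.range x), algebraMap B Ω w ∈ adjoin K (Set.range y) := by
    intro w hw
    induction hw using Algebra.adjoin_induction with
    | mem w hw =>
      obtain ⟨i, rfl⟩ := hw
      exact subset_adjoin _ _ ⟨i, rfl⟩
    | algebraMap a =>
      rw [← IsScalarTower.algebraMap_apply, IsScalarTower.algebraMap_apply A K Ω]
      exact IntermediateField.algebraMap_mem _ _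
    | add u v _ _ hu hv => rw [map_add]; exact add_mem hu hv
    | mul u v _ _ hu hv => rw [map_mul]; exact mul_mem hu hv
  have hLalg : Algebra.IsAlgebraic K L := by
    refine ⟨fun z => ?_⟩
    have h1 : IsAlgebraic K (z : Ω) := mem_algebraicClosure_iff.1 z.2.1
    exact (isAlgebraic_algebraMap_iff (algebraMap L Ω).injective).1 h1
  have hfin : FiniteDimensional K L := finiteDimensional_of_le_adjoin y L inf_le_right
  have hsep : Algebra.IsSeparable K L := inferInstance
  have hnoeth := IsIntegralClosure.isNoetherian A K L (integralClosure A L)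
  have hAL : ∀ a, algebraMap A Ω a = algebraMap L Ω (algebraMap A L a) := fun a => by
    rw [IsScalarTower.algebraMap_apply A K Ω, IsScalarTower.algebraMap_apply A K L]
    rfl
  have : IsScalarTower A L Ω := IsScalarTower.of_algebraMap_eq hAL
  have hml : ∀ m ∈ M, algebraMap B Ω m ∈ L := by
    intro m hm
    refine ⟨?_, ?_⟩
    · have h1 : IsIntegral A (algebraMap B Ω m) := (hintg m hm).algebraMap
      exact mem_algebraicClosure_iff.2 (h1.tower_top (A := K)).isAlgebraic
    · obtain ⟨w, hw, hw0, hwm⟩ := hM m hm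
      have hw0' : algebraMap B Ω w ≠ 0 := by
        rwa [Ne, FaithfulSMul.algebraMap_eq_zero_iff]
      have : algebraMap B Ω m = algebraMap B Ω (w * m) / algebraMap B Ω w := by
        rw [map_mul, mul_div_cancel_left₀ _ hw0']
      rw [this]
      exact div_mem (hRy _ hwm) (hRy _ hw)
  have hmi : ∀ (m : B) (hm : m ∈ M), IsIntegral A (⟨algebraMap B Ω m, hml m hm⟩ : L) := by
    intro m hm
    have h1 : IsIntegral A (algebraMap B Ω m) := (hintg m hm).algebraMap
    exact (isIntegral_algebraMap_iff (A := L) (B := Ω) (algebraMap L Ω).injective).1 h1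
  have hsm : ∀ (a : A) (m : B), algebraMap B Ω (a • m) =
      algebraMap L Ω (algebraMap A L a) * algebraMap B Ω m := fun a m => by
    rw [← hAL, Algebra.smul_def, map_mul, ← IsScalarTower.algebraMap_apply]
  let f : M →ₗ[A] integralClosure A L :=
    { toFun := fun m => ⟨⟨algebraMap B Ω m, hml m m.2⟩, hmi m m.2⟩
      map_add' := fun m n => by
        apply Subtype.ext; apply Subtype.ext
        simp
      map_smul' := fun a m => by
        apply Subtype.ext; apply Subtype.ext
        rw [RingHom.id_apply, Algebra.smul_def (A := integralClosure A L)]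
        exact hsm a m }
  have hf : Function.Injective f := by
    intro m n h
    have h1 := congrArg (fun z : integralClosure A L => ((z : L) : Ω)) h
    exact Subtype.ext (IsFractionRing.injective B Ω h1)
  have : IsNoetherian A M := isNoetherian_of_injective f hf
  exact isNoetherian_submodule.1 this M le_rfl

end Mahler

namespace Mahler

open Polynomial

section Generalities

theorem exists_mul_eq_of_eval₂_eq_zero {A B : Type*} [CommRing A] [CommRing B] [IsDomain B]
    (f : A →+* B) (S : Subring B) (hf : ∀ a, f a ∈ S) {v : B} (hv : v ∈ S) (hv0 : v ≠ 0)
    {P : A[X]} (hP : P.map f ≠ 0) (h : P.eval₂ f v = 0) :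
    ∃ v' ∈ S, ∃ a, f a ≠ 0 ∧ v * v' = f a := by
  induction hN : P.natDegree using Nat.strong_induction_on generalizing P with
  | _ N ih =>
    have h1 : v * P.divX.eval₂ f v + f (P.coeff 0) = 0 := by
      rw [← h]
      conv_rhs => rw [← P.divX_mul_X_add]
      rw [eval₂_add, eval₂_mul_X, eval₂_C, mul_comm]
    by_cases h0 : f (P.coeff 0) = 0
    · have h2 : P.divX.eval₂ f v = 0 := by
        rw [h0, add_zero] at h1
        exact (mul_eq_zero.1 h1).resolve_left hv0
      have h3 : P.divX.map f ≠ 0 := by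
        intro h3
        apply hP
        rw [← P.divX_mul_X_add, Polynomial.map_add, Polynomial.map_mul, h3, map_C, h0]
        simp
      refine ih P.divX.natDegree ?_ h3 h2 rfl
      rw [natDegree_divX_eq_natDegree_tsub_one, ← hN]
      have : P.natDegree ≠ 0 := by
        intro hd
        rw [natDegree_eq_zero] at hd
        obtain ⟨c, rfl⟩ := hd
        simp at h3
      lia
    · refine ⟨-P.divX.eval₂ f v, neg_mem ?_, P.coeff 0, h0, ?_⟩
      · rw [eval₂_eq_sum_range]
        exact sum_mem fun i _ => mul_mem (hf _) (pow_mem hv _)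
      · linear_combination -h1

theorem exists_pow_smul_mem_adjoin_of_forall {D Ω : Type*} [CommRing D] [CommRing Ω] [Algebra D Ω]
    {a : D} {S T : Set Ω} (h : ∀ s ∈ S, a • s ∈ Algebra.adjoin D T) {w : Ω}
    (hw : w ∈ Algebra.adjoin D S) : ∃ N : ℕ, ∀ n ≥ N, a ^ n • w ∈ Algebra.adjoin D T := by
  suffices ∃ N : ℕ, a ^ N • w ∈ Algebra.adjoin D T by
    obtain ⟨N, hN⟩ := this
    refine ⟨N, fun n hn => ?_⟩
    rw [← Nat.sub_add_cancel hn, pow_add, mul_smul]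
    exact Subalgebra.smul_mem _ hN _
  induction hw using Algebra.adjoin_induction with
  | mem s hs => exact ⟨1, by simpa using h s hs⟩
  | algebraMap d => exact ⟨0, by simp⟩
  | add u v _ _ hu hv =>
    obtain ⟨m, hm⟩ := hu
    obtain ⟨n, hn⟩ := hv
    refine ⟨m + n, ?_⟩
    rw [smul_add]
    refine add_mem ?_ ?_
    · rw [add_comm, pow_add, mul_smul]
      exact Subalgebra.smul_mem _ hm _
    · rw [pow_add, mul_smul]
      exact Subalgebra.smul_mem _ hn _
  | mul u v _ _ hu hv =>
    obtain ⟨m, hm⟩ := hu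
    obtain ⟨n, hn⟩ := hv
    refine ⟨m + n, ?_⟩
    rw [pow_add, ← smul_mul_smul_comm]
    exact mul_mem hm hn

/-- The integral elements of the fraction field of `D[S]` that lie in `Ω`. -/
def integralFractions (D : Type*) {Ω : Type*} [CommRing D] [CommRing Ω] [IsDomain Ω] [Algebra D Ω]
    (S : Set Ω) : Subalgebra D Ω where
  carrier := {x | IsIntegral D x ∧
    ∃ w ∈ Algebra.adjoin D S, w ≠ 0 ∧ w * x ∈ Algebra.adjoin D S}
  mul_mem' := by
    rintro x y ⟨hx, w, hw, hw0, hwx⟩ ⟨hy, v, hv, hv0, hvy⟩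
    refine ⟨hx.mul hy, w * v, mul_mem hw hv, mul_ne_zero hw0 hv0, ?_⟩
    rw [mul_mul_mul_comm]
    exact mul_mem hwx hvy
  add_mem' := by
    rintro x y ⟨hx, w, hw, hw0, hwx⟩ ⟨hy, v, hv, hv0, hvy⟩
    refine ⟨hx.add hy, w * v, mul_mem hw hv, mul_ne_zero hw0 hv0, ?_⟩
    rw [mul_add, mul_right_comm, mul_assoc w v y]
    exact add_mem (mul_mem hwx hv) (mul_mem hw hvy)
  algebraMap_mem' := fun d => ⟨isIntegral_algebraMap, 1, one_mem _, one_ne_zero, by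
    rw [one_mul]; exact Subalgebra.algebraMap_mem _ _⟩

end Generalities

section Euler

variable {k : Type*} [Field k]

theorem euler_add (f g : PowerSeries k) : euler (f + g) = euler f + euler g := by
  ext n
  simp [mul_add]

theorem euler_mul (f g : PowerSeries k) : euler (f * g) = euler f * g + f * euler g := by
  have h : ∀ f : PowerSeries k, euler f = PowerSeries.X * PowerSeries.derivative k f := by
    intro f
    ext n
    cases n with
    | zero => simp
    | succ n =>
      rw [coeff_euler, PowerSeries.coeff_succ_X_mul, PowerSeries.coeff_derivative]
      push_cast
      ring
  rw [h, h, h, Derivation.leibniz, smul_eq_mul, smul_eq_mul]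
  ring

theorem euler_pow_succ (f : PowerSeries k) (n : ℕ) :
    euler (f ^ (n + 1)) = (n + 1 : PowerSeries k) * f ^ n * euler f := by
  induction n with
  | zero => simp
  | succ n ih =>
    rw [pow_succ, euler_mul, ih]
    push_cast
    ring

theorem exists_polynomial_euler (p : k[X]) : ∃ p' : k[X], (p' : PowerSeries k) = euler p := by
  refine ⟨X * derivative p, ?_⟩
  ext n
  cases n with
  | zero => simp
  | succ n =>
    rw [Polynomial.coeff_coe, coeff_X_mul, coeff_derivative, coeff_euler, Polynomial.coeff_coe]
    push_cast
    ring

theorem exists_euler_aeval (e : PowerSeries k) (P : k[X][X]) :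
    ∃ Q : k[X][X], euler (aeval e P) = aeval e Q + aeval e (derivative P) * euler e := by
  induction P using Polynomial.induction_on' with
  | add P Q hP hQ =>
    obtain ⟨P', hP⟩ := hP
    obtain ⟨Q', hQ⟩ := hQ
    refine ⟨P' + Q', ?_⟩
    rw [map_add, euler_add, hP, hQ, derivative_add, map_add, map_add]
    ring
  | monomial n a =>
    obtain ⟨a', ha⟩ := exists_polynomial_euler a
    refine ⟨monomial n a', ?_⟩
    rw [aeval_monomial, aeval_monomial, derivative_monomial, aeval_monomial, euler_mul,
      algebraMap_polynomial_apply, algebraMap_polynomial_apply, algebraMap_polynomial_apply, ha]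
    cases n with
    | zero =>
      have : euler (1 : PowerSeries k) = 0 := by
        ext n
        simp +contextual [PowerSeries.coeff_one]
      simp [this]
    | succ n =>
      have hn : ((n : k[X]) : PowerSeries k) = n := map_natCast coeToPowerSeries.ringHom n
      rw [euler_pow_succ]
      push_cast
      rw [hn]
      ring

theorem exists_smul_euler_mem_adjoin [CharZero k] {e : PowerSeries k}
    (he : IsAlgebraic k[X] e) :
    ∃ d : k[X], d ≠ 0 ∧ d • euler e ∈ Algebra.adjoin k[X] {e} := by
  obtain ⟨P, ⟨hP0, hPe⟩, hmin⟩ := WellFounded.has_min (measure (natDegree : k[X][X] → ℕ)).wf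
    {P : k[X][X] | P ≠ 0 ∧ aeval e P = 0} he
  have hd : P.natDegree ≠ 0 := by
    intro hd
    rw [natDegree_eq_zero] at hd
    obtain ⟨c, rfl⟩ := hd
    rw [aeval_C, algebraMap_polynomial_apply, Polynomial.coe_eq_zero_iff] at hPe
    simp [hPe] at hP0
  have hP' : aeval e (derivative P) ≠ 0 := by
    intro h
    refine hmin (derivative P) ⟨?_, h⟩ (natDegree_derivative_lt hd)
    intro h0
    exact hd (derivative_eq_zero.1 h0)
  obtain ⟨Q, hQ⟩ := exists_euler_aeval e P
  have hz : euler (0 : PowerSeries k) = 0 := by ext n; simp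
  rw [hPe, hz] at hQ
  have hmem : ∀ P : k[X][X], aeval e P ∈ Algebra.adjoin k[X] {e} := fun P =>
    aeval_mem_adjoin_singleton _ _
  obtain ⟨R, hR0, hR⟩ : IsAlgebraic k[X] (aeval e (derivative P)) :=
    Algebra.isAlgebraic_adjoin_singleton_iff.mpr he _ (hmem _)
  have hinj : Function.Injective (algebraMap k[X] (PowerSeries k)) := by
    intro p q h
    simpa [algebraMap_polynomial_apply] using h
  obtain ⟨v, hv, d, hd0, hd⟩ := exists_mul_eq_of_eval₂_eq_zero (algebraMap k[X] (PowerSeries k))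
    (Algebra.adjoin k[X] {e}).toSubring (fun a => Subalgebra.algebraMap_mem _ a) (hmem _) hP'
    ((Polynomial.map_ne_zero_iff hinj).2 hR0) hR
  refine ⟨d, fun h => hd0 (by rw [h, map_zero]), ?_⟩
  have h1 : d • euler e = -(v * aeval e Q) := by
    rw [Algebra.smul_def, ← hd]
    linear_combination -v * hQ
  rw [h1]
  exact neg_mem (mul_mem hv (hmem _))

end Euler

end Mahler

namespace Mahler

open Polynomial

variable {k : Type*} [Field k] {q : ℕ}

theorem expand_coe (hq : q ≠ 0) (p : k[X]) :
    PowerSeries.expand q hq (p : PowerSeries k) = (expand k q p : k[X]) := by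
  have h : (PowerSeries.expand q hq).toRingHom.comp (coeToPowerSeries.ringHom (R := k)) =
      (coeToPowerSeries.ringHom (R := k)).comp (expand k q).toRingHom := by
    ext <;> simp [PowerSeries.expand_C, PowerSeries.expand_X]
  exact RingHom.congr_fun h p

theorem powerSeries_expand_injective (hq : q ≠ 0) :
    Function.Injective (PowerSeries.expand (R := k) q hq) := by
  intro f g h
  ext n
  rw [← PowerSeries.coeff_expand_mul q hq f, h, PowerSeries.coeff_expand_mul]

theorem isIntegral_expand (hq : q ≠ 0) {x : PowerSeries k} (hx : IsIntegral k[X] x) :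
    IsIntegral k[X] (PowerSeries.expand q hq x) := by
  refine IsIntegral.map_of_comp_eq (expand k q).toRingHom (PowerSeries.expand q hq).toRingHom ?_ hx
  ext : 1
  · ext c : 1
    simp [algebraMap_polynomial_apply, PowerSeries.expand_C]
  · simp [algebraMap_polynomial_apply]

theorem isIntegral_rescale (ζ : k) {x : PowerSeries k} (hx : IsIntegral k[X] x) :
    IsIntegral k[X] (PowerSeries.rescale ζ x) := by
  refine IsIntegral.map_of_comp_eq (compRingHom (C ζ * X)) (PowerSeries.rescale ζ) ?_ hx
  ext : 1
  · ext c n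
    rcases eq_or_ne n 0 with rfl | hn
    · simp [algebraMap_polynomial_apply]
    · simp [algebraMap_polynomial_apply, PowerSeries.coeff_C, hn]
  · simp [algebraMap_polynomial_apply, PowerSeries.rescale_X]

theorem isIntegral_of_isIntegral_expand (hq : q ≠ 0) {x : PowerSeries k}
    (hx : IsIntegral k[X] (PowerSeries.expand q hq x)) : IsIntegral k[X] x := by
  let S : Subalgebra k k[X] := (expand k q).range
  have hX : IsIntegral S (X : k[X]) := by
    refine IsIntegral.of_pow (n := q) (Nat.pos_of_ne_zero hq) ?_
    have h1 : (X : k[X]) ^ q ∈ S := ⟨X, expand_X q⟩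
    exact isIntegral_algebraMap (x := (⟨_, h1⟩ : S))
  have hintg : Algebra.IsIntegral S k[X] := by
    refine ⟨fun p => ?_⟩
    rw [as_sum_range_C_mul_X_pow p]
    refine IsIntegral.sum _ fun i _ => IsIntegral.mul ?_ (hX.pow _)
    have h1 : C (p.coeff i) ∈ S := ⟨C (p.coeff i), expand_C q _⟩
    exact isIntegral_algebraMap (x := (⟨_, h1⟩ : S))
  obtain ⟨P, hP, hP0⟩ := isIntegral_trans (R := S) _ hx
  let e : k[X] ≃+* S := RingEquiv.ofBijective (expand k q).rangeRestrict.toRingHom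
    ⟨fun a b h => expand_injective (Nat.pos_of_ne_zero hq) (congrArg Subtype.val h),
      (expand k q).rangeRestrict_surjective⟩
  refine ⟨P.map e.symm.toRingHom, hP.map _, ?_⟩
  apply powerSeries_expand_injective hq
  have h1 := Polynomial.hom_eval₂ (P.map e.symm.toRingHom) (algebraMap k[X] (PowerSeries k))
    (PowerSeries.expand q hq).toRingHom x
  rw [map_zero]
  refine h1.trans ?_
  rw [eval₂_map, ← hP0]
  congr 1
  ext s : 1
  obtain ⟨p, rfl⟩ := e.surjective s
  simp only [RingHom.comp_apply, RingEquiv.toRingHom_eq_coe, RingEquiv.coe_toRingHom,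
    RingEquiv.symm_apply_apply, algebraMap_polynomial_apply]
  change PowerSeries.expand q hq (p : PowerSeries k) = algebraMap k[X] (PowerSeries k) (expand k q p)
  rw [expand_coe, algebraMap_polynomial_apply]

theorem smul_X_pow_mul_expand_sect (hq : q ≠ 0) {ζ : k} (hζ : IsPrimitiveRoot ζ q) {j : ℕ}
    (hj : j < q) (x : PowerSeries k) :
    (q : k) • (PowerSeries.X ^ j * PowerSeries.expand q hq (sect q j x)) =
      ∑ i ∈ Finset.range q, ζ ^ (i * (q - j)) • PowerSeries.rescale (ζ ^ i) x := by
  ext n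
  rw [map_sum, PowerSeries.coeff_smul, smul_eq_mul]
  have hsum : ∑ i ∈ Finset.range q, PowerSeries.coeff n (ζ ^ (i * (q - j)) •
      PowerSeries.rescale (ζ ^ i) x) =
      (∑ i ∈ Finset.range q, (ζ ^ (n + (q - j))) ^ i) * PowerSeries.coeff n x := by
    rw [Finset.sum_mul]
    refine Finset.sum_congr rfl fun i _ => ?_
    rw [PowerSeries.coeff_smul, PowerSeries.coeff_rescale, smul_eq_mul, ← mul_assoc]
    congr 1
    rw [← pow_mul, ← pow_mul, ← pow_add]
    congr 1
    ring
  rw [hsum, PowerSeries.coeff_X_pow_mul']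
  by_cases h : q ∣ n + (q - j)
  · rw [(hζ.pow_eq_one_iff_dvd _).2 h]
    simp only [one_pow, Finset.sum_const, Finset.card_range, nsmul_eq_mul, mul_one]
    congr 1
    obtain ⟨m, hm⟩ := h
    have hm1 : m ≠ 0 := by
      rintro rfl
      rw [mul_zero] at hm
      lia
    obtain ⟨m, rfl⟩ := Nat.exists_eq_succ_of_ne_zero hm1
    have hn : n = q * m + j := by
      rw [Nat.succ_eq_add_one, mul_add] at hm
      lia
    rw [hn, if_pos (by lia), Nat.add_sub_cancel, PowerSeries.coeff_expand_mul, coeff_sect]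
  · have h1 : ζ ^ (n + (q - j)) ≠ 1 := fun h1 => h ((hζ.pow_eq_one_iff_dvd _).1 h1)
    have h2 : ∑ i ∈ Finset.range q, (ζ ^ (n + (q - j))) ^ i = 0 := by
      have h3 := geom_sum_mul (ζ ^ (n + (q - j))) q
      rw [pow_right_comm _ _ q, hζ.pow_eq_one, one_pow, sub_self] at h3
      exact (mul_eq_zero.1 h3).resolve_right (sub_ne_zero.2 h1)
    rw [h2, zero_mul]
    split_ifs with hjn
    · rw [PowerSeries.coeff_expand_of_not_dvd, mul_zero]
      intro hd
      apply h
      have : n + (q - j) = n - j + q := by lia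
      rw [this]
      exact Dvd.dvd.add hd dvd_rfl
    · rw [mul_zero]

theorem isIntegral_X_pow_smul_sect [CharZero k] [IsAlgClosed k] (hq : q ≠ 0) {j : ℕ} (hj : j < q)
    {x : PowerSeries k} (hx : IsIntegral k[X] x) :
    IsIntegral k[X] ((X ^ q : k[X]) • sect q j x) := by
  have : NeZero (q : k) := ⟨by exact_mod_cast hq⟩
  obtain ⟨ζ, hζ⟩ := HasEnoughRootsOfUnity.exists_primitiveRoot k q
  have hC : ∀ (c : k) {y : PowerSeries k}, IsIntegral k[X] y → IsIntegral k[X] (c • y) := by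
    intro c y hy
    have : c • y = (C c : k[X]) • y := by
      rw [polynomial_smul_eq, Polynomial.coe_C, PowerSeries.smul_eq_C_mul]
    rw [this]
    exact hy.smul _
  have h1 : IsIntegral k[X] ((q : k) • (PowerSeries.X ^ j *
      PowerSeries.expand q hq (sect q j x))) := by
    rw [smul_X_pow_mul_expand_sect hq hζ hj]
    exact IsIntegral.sum _ fun i _ => hC _ (isIntegral_rescale _ hx)
  have h2 := hC (q : k)⁻¹ h1
  rw [inv_smul_smul₀ (NeZero.ne _)] at h2
  apply isIntegral_of_isIntegral_expand hq
  have h3 := h2.smul (X ^ (q * q - j) : k[X])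
  have h4 : (X ^ (q * q - j) : k[X]) • (PowerSeries.X ^ j * PowerSeries.expand q hq (sect q j x)) =
      PowerSeries.expand q hq ((X ^ q : k[X]) • sect q j x) := by
    have hjq : j ≤ q * q := hj.le.trans (Nat.le_mul_of_pos_left _ (by lia))
    rw [polynomial_smul_eq, polynomial_smul_eq, map_mul, expand_coe, ← mul_assoc, map_pow, expand_X,
      ← pow_mul]
    push_cast
    rw [← pow_add, Nat.sub_add_cancel hjq]
  rwa [h4] at h3

end Mahler

namespace Mahler

open Polynomial

variable {k : Type*} [Field k] {q : ℕ} {ι : Type*} {g : ι → PowerSeries k}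

theorem coe_injective_powerSeries : Function.Injective (algebraMap k[X] (PowerSeries k)) := by
  intro p q h
  simpa [algebraMap_polynomial_apply] using h

instance : FaithfulSMul k[X] (PowerSeries k) :=
  (faithfulSMul_iff_algebraMap_injective _ _).2 coe_injective_powerSeries

theorem expand_mem_adjoin_expand (hq : q ≠ 0) {w : PowerSeries k}
    (hw : w ∈ Algebra.adjoin k[X] (Set.range g)) : PowerSeries.expand q hq w ∈
      Algebra.adjoin k[X] (Set.range fun i => PowerSeries.expand q hq (g i)) := by
  induction hw using Algebra.adjoin_induction with
  | mem w hw =>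
    obtain ⟨i, rfl⟩ := hw
    exact Algebra.subset_adjoin ⟨i, rfl⟩
  | algebraMap p =>
    rw [algebraMap_polynomial_apply, expand_coe, ← algebraMap_polynomial_apply]
    exact Subalgebra.algebraMap_mem _ _
  | add u v _ _ hu hv => rw [map_add]; exact add_mem hu hv
  | mul u v _ _ hu hv => rw [map_mul]; exact mul_mem hu hv

theorem smul_ne_zero_powerSeries {p : k[X]} {w : PowerSeries k} (hp : p ≠ 0) (hw : w ≠ 0) :
    p • w ≠ 0 := by
  rw [polynomial_smul_eq]
  exact mul_ne_zero (by rwa [Ne, Polynomial.coe_eq_zero_iff]) hw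

theorem expand_mem_integralFractions (hq : q ≠ 0) {b : k[X]} (hb0 : b ≠ 0)
    (hb : ∀ i, b • PowerSeries.expand q hq (g i) ∈ Algebra.adjoin k[X] (Set.range g))
    {x : PowerSeries k} (hx : x ∈ integralFractions k[X] (Set.range g)) :
    PowerSeries.expand q hq x ∈ integralFractions k[X] (Set.range g) := by
  obtain ⟨hintg, w, hw, hw0, hwx⟩ := hx
  have hb' : ∀ s ∈ Set.range (fun i => PowerSeries.expand q hq (g i)),
      b • s ∈ Algebra.adjoin k[X] (Set.range g) := by
    rintro _ ⟨i, rfl⟩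
    exact hb i
  obtain ⟨N₁, h₁⟩ := exists_pow_smul_mem_adjoin_of_forall hb' (expand_mem_adjoin_expand hq hw)
  obtain ⟨N₂, h₂⟩ := exists_pow_smul_mem_adjoin_of_forall hb' (expand_mem_adjoin_expand hq hwx)
  refine ⟨isIntegral_expand hq hintg, b ^ (N₁ + N₂) • PowerSeries.expand q hq w, h₁ _ (by lia),
    smul_ne_zero_powerSeries (pow_ne_zero _ hb0) ?_, ?_⟩
  · rwa [Ne, map_eq_zero_iff _ (powerSeries_expand_injective hq)]
  · rw [smul_mul_assoc, ← map_mul]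
    exact h₂ _ (by lia)

theorem sect_add (j : ℕ) (f g : PowerSeries k) : sect q j (f + g) = sect q j f + sect q j g := by
  ext n
  simp

theorem sect_mem_adjoin (hq : 2 ≤ q) {j : ℕ} (hj : j < q) {y : PowerSeries k}
    (hy : y ∈ Algebra.adjoin k[X] (Set.range fun i => PowerSeries.expand q (by lia) (g i))) :
    sect q j y ∈ Algebra.adjoin k[X] (Set.range g) := by
  have hq0 : q ≠ 0 := by lia
  rw [← Subalgebra.mem_toSubmodule, Algebra.adjoin_eq_span] at hy
  have hzero : sect q j (0 : PowerSeries k) = 0 := by ext n; simp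
  have hcl : ∀ m ∈ Submonoid.closure (Set.range fun i => PowerSeries.expand q hq0 (g i)),
      ∃ r ∈ Algebra.adjoin k[X] (Set.range g), PowerSeries.expand q hq0 r = m := by
    intro m hm
    induction hm using Submonoid.closure_induction with
    | mem m hm =>
      obtain ⟨i, rfl⟩ := hm
      exact ⟨g i, Algebra.subset_adjoin ⟨i, rfl⟩, rfl⟩
    | one => exact ⟨1, one_mem _, map_one _⟩
    | mul m n _ _ hm hn =>
      obtain ⟨r, hr, rfl⟩ := hm
      obtain ⟨s, hs, rfl⟩ := hn
      exact ⟨r * s, mul_mem hr hs, map_mul _ _ _⟩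
  refine Submodule.closure_induction (p := fun y _ =>
    sect q j y ∈ Algebra.adjoin k[X] (Set.range g)) (by rw [hzero]; exact zero_mem _)
    (fun u v _ _ hu hv => by rw [sect_add]; exact add_mem hu hv) (fun p m hm => ?_) hy
  obtain ⟨r, hr, rfl⟩ := hcl m hm
  rw [polynomial_smul_eq, sect_mul_expand hq0 hj]
  obtain ⟨p', hp', -⟩ := exists_polynomial_coe_eq_sect hq j p
  rw [← hp', ← polynomial_smul_eq]
  exact Subalgebra.smul_mem _ hr _

theorem isIntegralElem_of_mem_adjoin_expand (hq : q ≠ 0) {y : PowerSeries k}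
    (hy : y ∈ Algebra.adjoin k[X] (Set.range fun i => PowerSeries.expand q hq (g i))) :
    ((PowerSeries.expand (R := k) q hq).toRingHom.comp
      (Algebra.adjoin k[X] (Set.range g)).val.toRingHom).IsIntegralElem y := by
  set f := (PowerSeries.expand (R := k) q hq).toRingHom.comp
      (Algebra.adjoin k[X] (Set.range g)).val.toRingHom with hf
  have hmap : ∀ r ∈ Algebra.adjoin k[X] (Set.range g),
      f.IsIntegralElem (PowerSeries.expand q hq r) := fun r hr =>
    f.isIntegralElem_map (x := ⟨r, hr⟩)
  induction hy using Algebra.adjoin_induction with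
  | mem w hw =>
    obtain ⟨i, rfl⟩ := hw
    exact hmap _ (Algebra.subset_adjoin ⟨i, rfl⟩)
  | algebraMap p =>
    have hX : f.IsIntegralElem (PowerSeries.X : PowerSeries k) := by
      have h1 := hmap (algebraMap k[X] (PowerSeries k) X) (Subalgebra.algebraMap_mem _ _)
      rw [algebraMap_polynomial_apply, Polynomial.coe_X, PowerSeries.expand_X] at h1
      obtain ⟨P, hP, hP0⟩ := h1
      exact ⟨Polynomial.expand _ q P, hP.expand (Nat.pos_of_ne_zero hq), by
        rw [Polynomial.expand_eq_comp_X_pow, Polynomial.eval₂_comp, Polynomial.eval₂_pow,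
          Polynomial.eval₂_X, hP0]⟩
    have hC : ∀ c : k, f.IsIntegralElem (PowerSeries.C c : PowerSeries k) := by
      intro c
      have h1 := hmap (algebraMap k[X] (PowerSeries k) (C c)) (Subalgebra.algebraMap_mem _ _)
      rwa [algebraMap_polynomial_apply, Polynomial.coe_C, PowerSeries.expand_C] at h1
    induction p using Polynomial.induction_on with
    | C c => rw [algebraMap_polynomial_apply, Polynomial.coe_C]; exact hC c
    | add p q hp hq => rw [map_add]; exact hp.add _ hq
    | monomial n c h =>
      rw [pow_succ, ← mul_assoc, map_mul]
      refine h.mul _ ?_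
      rw [algebraMap_polynomial_apply, Polynomial.coe_X]
      exact hX
  | add u v _ _ hu hv => exact hu.add _ hv
  | mul u v _ _ hu hv => exact hu.mul _ hv

theorem X_pow_smul_sect_mem_integralFractions [CharZero k] [IsAlgClosed k] (hq : 2 ≤ q)
    {a : k[X]} (ha0 : a ≠ 0) (ha : ∀ i, a • g i ∈
      Algebra.adjoin k[X] (Set.range fun i => PowerSeries.expand q (by lia) (g i)))
    {j : ℕ} (hj : j < q) {x : PowerSeries k} (hx : x ∈ integralFractions k[X] (Set.range g)) :
    (X ^ q : k[X]) • sect q j x ∈ integralFractions k[X] (Set.range g) := by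
  have hq0 : q ≠ 0 := by lia
  obtain ⟨hintg, w, hw, hw0, hwx⟩ := hx
  refine ⟨isIntegral_X_pow_smul_sect hq0 hj hintg, ?_⟩
  have ha' : ∀ s ∈ Set.range g, a • s ∈
      Algebra.adjoin k[X] (Set.range fun i => PowerSeries.expand q hq0 (g i)) := by
    rintro _ ⟨i, rfl⟩
    exact ha i
  obtain ⟨N₁, h₁⟩ := exists_pow_smul_mem_adjoin_of_forall ha' hw
  obtain ⟨N₂, h₂⟩ := exists_pow_smul_mem_adjoin_of_forall ha' hwx
  have hv := h₁ (N₁ + N₂) (by lia)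
  have hu := h₂ (N₁ + N₂) (by lia)
  obtain ⟨P, hP, hP0⟩ := isIntegralElem_of_mem_adjoin_expand hq0 hv
  obtain ⟨v', hv', w', hw'0, hvw⟩ := exists_mul_eq_of_eval₂_eq_zero
    ((PowerSeries.expand (R := k) q hq0).toRingHom.comp
      (Algebra.adjoin k[X] (Set.range g)).val.toRingHom)
    (Algebra.adjoin k[X] (Set.range fun i => PowerSeries.expand q hq0 (g i))).toSubring
    (fun r => expand_mem_adjoin_expand hq0 r.2) hv
    (smul_ne_zero_powerSeries (pow_ne_zero _ ha0) hw0) (hP.map _).ne_zero hP0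
  replace hvw : a ^ (N₁ + N₂) • w * v' = PowerSeries.expand q hq0 (w' : PowerSeries k) := hvw
  have h3 : x * PowerSeries.expand q hq0 (w' : PowerSeries k) ∈
      Algebra.adjoin k[X] (Set.range fun i => PowerSeries.expand q hq0 (g i)) := by
    have : x * PowerSeries.expand q hq0 (w' : PowerSeries k) =
        (a ^ (N₁ + N₂) • (w * x)) * v' := by
      rw [← hvw]
      simp only [polynomial_smul_eq]
      ring
    rw [this]
    exact mul_mem hu hv'
  refine ⟨w', w'.2, ?_, ?_⟩
  · intro h0
    apply hw'0
    change PowerSeries.expand q hq0 (w' : PowerSeries k) = 0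
    rw [h0, map_zero]
  · have h4 := sect_mem_adjoin hq hj h3
    rw [sect_mul_expand hq0 hj, mul_comm] at h4
    rw [mul_smul_comm]
    exact Subalgebra.smul_mem _ h4 _

theorem exists_smul_euler_mem_integralFractions [CharZero k] [Finite ι] :
    ∃ Δ : k[X], Δ ≠ 0 ∧ ∀ m ∈ integralFractions k[X] (Set.range g),
      Δ • euler m ∈ integralFractions k[X] (Set.range g) := by
  have hfg : (Subalgebra.toSubmodule (integralFractions k[X] (Set.range g))).FG :=
    fg_of_isIntegral_of_mul_mem_adjoin g _ (fun m hm => hm.1) fun m hm => hm.2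
  obtain ⟨N, e, he⟩ := Submodule.fg_iff_exists_fin_generating_family.1 hfg
  have heM : ∀ i, e i ∈ integralFractions k[X] (Set.range g) := fun i => by
    rw [← Subalgebra.mem_toSubmodule, ← he]
    exact Submodule.subset_span ⟨i, rfl⟩
  choose d hd0 hd using fun i => exists_smul_euler_mem_adjoin (heM i).1.isAlgebraic
  have hdm : ∀ i, d i • euler (e i) ∈ integralFractions k[X] (Set.range g) := fun i =>
    (Algebra.adjoin_le (Set.singleton_subset_iff.2 (heM i)) :
      Algebra.adjoin k[X] {e i} ≤ _) (hd i)
  refine ⟨∏ i, d i, Finset.prod_ne_zero_iff.2 fun i _ => hd0 i, fun m hm => ?_⟩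
  have hzero : euler (0 : PowerSeries k) = 0 := by ext n; simp
  rw [← Subalgebra.mem_toSubmodule, ← he] at hm
  refine Submodule.closure_induction (p := fun y _ =>
    (∏ i, d i) • euler y ∈ integralFractions k[X] (Set.range g))
    (by rw [hzero, smul_zero]; exact zero_mem _)
    (fun u v _ _ hu hv => by rw [euler_add, smul_add]; exact add_mem hu hv) ?_ hm
  rintro p _ ⟨i, rfl⟩
  obtain ⟨p', hp'⟩ := exists_polynomial_euler p
  rw [polynomial_smul_eq p, euler_mul, ← hp', smul_add, ← polynomial_smul_eq, ← polynomial_smul_eq]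
  refine add_mem (Subalgebra.smul_mem _ (Subalgebra.smul_mem _ (heM i) _) _) ?_
  rw [← Finset.mul_prod_erase _ _ (Finset.mem_univ i), smul_comm, mul_comm, mul_smul]
  exact Subalgebra.smul_mem _ (Subalgebra.smul_mem _ (hdm i) _) _

/-- Regularity: an element of the field generated by a Mahler system that is algebraic over the
rational functions is itself a rational function. -/
theorem exists_smul_eq_smul_of_isAlgebraic [CharZero k] [IsAlgClosed k] (φ : k →+* ℂ) [Finite ι]
    (hq : 2 ≤ q) {a b : k[X]} (ha0 : a ≠ 0) (ha : ∀ i, a • g i ∈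
      Algebra.adjoin k[X] (Set.range fun i => PowerSeries.expand q (by lia) (g i)))
    (hb0 : b ≠ 0)
    (hb : ∀ i, b • PowerSeries.expand q (by lia) (g i) ∈ Algebra.adjoin k[X] (Set.range g))
    {u w : PowerSeries k} (hu : u ∈ Algebra.adjoin k[X] (Set.range g))
    (hw : w ∈ Algebra.adjoin k[X] (Set.range g)) (hw0 : w ≠ 0) {P : k[X][X]} (hP : P ≠ 0)
    (h : ∑ i ∈ Finset.range (P.natDegree + 1), P.coeff i • (u ^ i * w ^ (P.natDegree - i)) = 0) :
    ∃ c d : k[X], d ≠ 0 ∧ d • u = c • w := by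
  have hfg : (Subalgebra.toSubmodule (integralFractions k[X] (Set.range g))).FG :=
    fg_of_isIntegral_of_mul_mem_adjoin g _ (fun m hm => hm.1) fun m hm => hm.2
  let Ω := FractionRing (PowerSeries k)
  have hw0' : algebraMap (PowerSeries k) Ω w ≠ 0 := by
    rwa [Ne, FaithfulSMul.algebraMap_eq_zero_iff]
  set y : Ω := algebraMap _ Ω u / algebraMap _ Ω w with hy
  have hPy : aeval y P = 0 := by
    have h1 := congrArg (algebraMap (PowerSeries k) Ω) h
    rw [map_zero, map_sum] at h1
    have h2 : algebraMap (PowerSeries k) Ω w ^ P.natDegree * aeval y P = 0 := by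
      rw [aeval_eq_sum_range, Finset.mul_sum, ← h1]
      refine Finset.sum_congr rfl fun i hi => ?_
      rw [Finset.mem_range] at hi
      have h3 : algebraMap (PowerSeries k) Ω w ^ P.natDegree =
          algebraMap (PowerSeries k) Ω w ^ (P.natDegree - i) * algebraMap (PowerSeries k) Ω w ^ i := by
        rw [← pow_add, Nat.sub_add_cancel (by lia)]
      rw [Algebra.smul_def, Algebra.smul_def, map_mul, map_mul, map_pow, map_pow,
        ← IsScalarTower.algebraMap_apply, hy, div_pow, h3]
      have h4 := div_mul_cancel₀ (algebraMap (PowerSeries k) Ω u ^ i) (pow_ne_zero i hw0')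
      linear_combination (algebraMap (PowerSeries k) Ω w ^ (P.natDegree - i) *
        algebraMap k[X] Ω (P.coeff i)) * h4
    exact (mul_eq_zero.1 h2).resolve_left (pow_ne_zero _ hw0')
  have hintg := isIntegral_leadingCoeff_smul P y hPy
  obtain ⟨x, hx⟩ := IsIntegrallyClosed.algebraMap_eq_of_integral
    (R := PowerSeries k) (hintg.tower_top (A := PowerSeries k))
  have hxint : IsIntegral k[X] x := by
    rw [← hx] at hintg
    exact (isIntegral_algebraMap_iff (IsFractionRing.injective (PowerSeries k) Ω)).1 hintg
  have hwx : P.leadingCoeff • u = w * x := by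
    apply IsFractionRing.injective (PowerSeries k) Ω
    rw [map_mul, hx, Algebra.smul_def, Algebra.smul_def, map_mul, ← IsScalarTower.algebraMap_apply,
      hy]
    have h4 := div_mul_cancel₀ (algebraMap (PowerSeries k) Ω u) hw0'
    linear_combination (- algebraMap k[X] Ω P.leadingCoeff) * h4
  have hxO : x ∈ integralFractions k[X] (Set.range g) :=
    ⟨hxint, w, hw, hw0, by rw [← hwx]; exact Subalgebra.smul_mem _ hu _⟩
  obtain ⟨p, hp⟩ := exists_polynomial_of_mem_stable φ hq hfg (fun m hm => hm.1)
    (fun m hm => expand_mem_integralFractions _ hb0 hb hm)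
    (fun j hj m hm => X_pow_smul_sect_mem_integralFractions hq ha0 ha hj hm)
    exists_smul_euler_mem_integralFractions hxO
  refine ⟨p, P.leadingCoeff, leadingCoeff_ne_zero.2 hP, ?_⟩
  rw [hwx, polynomial_smul_eq, hp, mul_comm]

end Mahler

namespace Mahler

open Polynomial

variable {k : Type*} [Field k] {q : ℕ}

theorem expand_smul (hq : q ≠ 0) (p : k[X]) (f : PowerSeries k) :
    PowerSeries.expand q hq (p • f) = Polynomial.expand k q p • PowerSeries.expand q hq f := by
  rw [polynomial_smul_eq, polynomial_smul_eq, map_mul, expand_coe]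

theorem linearIndependent_expand (hq : 2 ≤ q) {ι : Type*} {g : ι → PowerSeries k}
    (hg : LinearIndependent k[X] g) :
    LinearIndependent k[X] fun i => PowerSeries.expand q (by lia) (g i) := by
  have hq0 : q ≠ 0 := by lia
  rw [linearIndependent_iff'] at hg ⊢
  intro s c hc i hi
  have hsect : ∀ j < q, sect q j (c i : PowerSeries k) = 0 := by
    intro j hj
    choose p hp _ using fun i => exists_polynomial_coe_eq_sect hq j (c i)
    have hzero : sect q j (0 : PowerSeries k) = 0 := by ext n; simp
    have hsum : ∀ (s : Finset ι) (f : ι → PowerSeries k),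
        sect q j (∑ i ∈ s, f i) = ∑ i ∈ s, sect q j (f i) := by
      intro s f
      ext n
      simp [coeff_sect, map_sum]
    have h1 := congrArg (sect q j) hc
    rw [hsum, hzero] at h1
    have h2 : ∑ i ∈ s, p i • g i = 0 := by
      rw [← h1]
      refine Finset.sum_congr rfl fun i _ => ?_
      rw [polynomial_smul_eq, polynomial_smul_eq, sect_mul_expand hq0 hj, hp]
    rw [← hp i, hg s p h2 i hi, Polynomial.coe_zero]
  ext n
  have h1 := congrArg (PowerSeries.coeff (n / q)) (hsect (n % q) (Nat.mod_lt _ (by lia)))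
  rw [coeff_sect, Polynomial.coeff_coe] at h1
  simpa [Nat.div_add_mod, Nat.mod_add_div] using h1

theorem exists_smul_mem_span_of_sum_eq_zero {R M : Type*} [CommRing R] [AddCommGroup M]
    [Module R M] (x : ℕ → M) (p : ℕ → R) (m : ℕ) (hp : ∃ i, i ≤ m ∧ p i ≠ 0)
    (h : ∑ j ∈ Finset.range (m + 1), p j • x j = 0) :
    ∃ (n : ℕ) (c : R), c ≠ 0 ∧ c • x n ∈ Submodule.span R (Set.range fun j : Fin n => x j) := by
  induction m with
  | zero =>
    obtain ⟨i, hi, hpi⟩ := hp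
    obtain rfl : i = 0 := by lia
    refine ⟨0, p 0, hpi, ?_⟩
    rw [Finset.sum_range_one] at h
    rw [h]
    exact zero_mem _
  | succ m ih =>
    by_cases h0 : p (m + 1) = 0
    · refine ih ?_ ?_
      · obtain ⟨i, hi, hpi⟩ := hp
        refine ⟨i, ?_, hpi⟩
        by_contra! hlt
        obtain rfl : i = m + 1 := by lia
        exact hpi h0
      · rw [Finset.sum_range_succ, h0, zero_smul, add_zero] at h
        exact h
    · refine ⟨m + 1, p (m + 1), h0, ?_⟩
      rw [Finset.sum_range_succ, add_eq_zero_iff_neg_eq] at h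
      rw [← h]
      refine neg_mem (Submodule.sum_mem _ fun j hj => Submodule.smul_mem _ _ ?_)
      exact Submodule.subset_span ⟨⟨j, Finset.mem_range.1 hj⟩, rfl⟩

theorem exists_basis_of_fg (N : Submodule k[X] (PowerSeries k)) [Module.Finite k[X] N] :
    ∃ (n : ℕ) (g : Fin n → PowerSeries k), LinearIndependent k[X] g ∧ (∀ i, g i ∈ N) ∧
      ∀ y ∈ N, ∃ d : Fin n → k[X], y = ∑ j, d j • g j := by
  let β := Module.finBasis k[X] N
  refine ⟨_, fun i => β i, β.linearIndependent.map' N.subtype N.ker_subtype,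
    fun i => (β i).2, fun y hy => ⟨fun j => β.repr ⟨y, hy⟩ j, ?_⟩⟩
  have h1 := congrArg N.subtype (β.sum_repr ⟨y, hy⟩)
  rw [map_sum] at h1
  exact h1.symm

theorem exists_inverse_system {R M : Type*} [CommRing R] [IsDomain R] [AddCommGroup M] [Module R M]
    {n : ℕ} {g h : Fin n → M} (hh : LinearIndependent R h) {b : R} (hb0 : b ≠ 0)
    {B : Matrix (Fin n) (Fin n) R} (hB : ∀ i, b • h i = ∑ j, B i j • g j) :
    ∃ (a : R) (A : Matrix (Fin n) (Fin n) R), a ≠ 0 ∧ (∀ i, a • g i = ∑ j, A i j • h j) ∧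
      A * B = (a * b) • 1 := by
  have hdet : B.det ≠ 0 := by
    intro h0
    obtain ⟨v, hv0, hv⟩ := Matrix.exists_vecMul_eq_zero_iff.2 h0
    apply hv0
    have h1 := linearIndependent_iff'.1 hh Finset.univ
      (fun i => v i * b) ?_
    · funext i
      exact (mul_eq_zero.1 (h1 i (Finset.mem_univ i))).resolve_right hb0
    · have h2 : ∀ j, ∑ i, v i * B i j = 0 := fun j => congrFun hv j
      calc ∑ i, (v i * b) • h i
          = ∑ i, v i • ∑ j, B i j • g j := by
            refine Finset.sum_congr rfl fun i _ => ?_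
            rw [mul_smul, hB]
        _ = ∑ j, (∑ i, v i * B i j) • g j := by
            simp_rw [Finset.smul_sum, Finset.sum_smul, mul_smul]
            exact Finset.sum_comm
        _ = 0 := by simp [h2]
  refine ⟨B.det, b • B.adjugate, hdet, ?_, ?_⟩
  · intro i
    have h1 : ∀ l, ∑ j, B.adjugate i j * B j l = if i = l then B.det else 0 := by
      intro l
      have := congrFun (congrFun (Matrix.adjugate_mul B) i) l
      rw [Matrix.mul_apply] at this
      rw [this, Matrix.smul_apply, Matrix.one_apply]
      simp
    symm
    calc ∑ j, (b • B.adjugate) i j • h j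
        = ∑ j, B.adjugate i j • ∑ l, B j l • g l := by
          refine Finset.sum_congr rfl fun j _ => ?_
          rw [← hB, Matrix.smul_apply, smul_eq_mul, mul_comm, mul_smul]
      _ = ∑ l, (∑ j, B.adjugate i j * B j l) • g l := by
          simp_rw [Finset.smul_sum, Finset.sum_smul, mul_smul]
          exact Finset.sum_comm
      _ = B.det • g i := by
          simp_rw [h1]
          simp
  · rw [Matrix.smul_mul, Matrix.adjugate_mul, smul_smul, mul_comm]

theorem exists_stable_submodule (hq0 : q ≠ 0) {ι : Type*} [Finite ι]
    (f : ι → PowerSeries k)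
    (hf : ∀ i, ∃ (m : ℕ) (p : ℕ → k[X]), (∃ j, j ≤ m ∧ p j ≠ 0) ∧
      ∑ j ∈ Finset.range (m + 1), p j • (PowerSeries.expand q hq0)^[j] (f i) = 0) :
    ∃ (N : Submodule k[X] (PowerSeries k)) (b : k[X]), Module.Finite k[X] N ∧ b ≠ 0 ∧
      (∀ y ∈ N, b • PowerSeries.expand q hq0 y ∈ N) ∧ (∀ i, f i ∈ N) ∧
      N ≤ Submodule.span k[X]
        (Set.range fun x : ι × ℕ => (PowerSeries.expand q hq0)^[x.2] (f x.1)) := by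
  classical
  have := Fintype.ofFinite ι
  choose m c hc0 hc using fun i =>
    let ⟨m, p, hp, h⟩ := hf i
    exists_smul_mem_span_of_sum_eq_zero (fun j => (PowerSeries.expand q hq0)^[j] (f i)) p m hp h
  let x : (Σ i, Fin (m i)) → PowerSeries k := fun j => (PowerSeries.expand q hq0)^[j.2] (f j.1)
  let N := Submodule.span k[X] (Set.range x)
  have hmem : ∀ i, ∀ y ∈ Submodule.span k[X]
      (Set.range fun j : Fin (m i) => (PowerSeries.expand q hq0)^[(j : ℕ)] (f i)), y ∈ N := by
    intro i y hy
    refine Submodule.span_mono ?_ hy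
    rintro _ ⟨j, rfl⟩
    exact ⟨⟨i, j⟩, rfl⟩
  let b := ∏ i, c i
  have hb0 : b ≠ 0 := Finset.prod_ne_zero_iff.2 fun i _ => hc0 i
  have hxN : ∀ i j, j ≤ m i → b • (PowerSeries.expand q hq0)^[j] (f i) ∈ N := by
    intro i j hj
    rcases hj.lt_or_eq with hj | rfl
    · exact Submodule.smul_mem _ _ (Submodule.subset_span ⟨⟨i, ⟨j, hj⟩⟩, rfl⟩)
    · have : b = (∏ l ∈ Finset.univ.erase i, c l) * c i :=
        (Finset.prod_erase_mul _ _ (Finset.mem_univ i)).symm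
      rw [this, mul_smul]
      exact Submodule.smul_mem _ _ (hmem i _ (hc i))
  have hbN : ∀ y ∈ N, b • PowerSeries.expand q hq0 y ∈ N := by
    intro y hy
    induction hy using Submodule.span_induction with
    | mem y hy =>
      obtain ⟨⟨i, j⟩, rfl⟩ := hy
      have := hxN i (j + 1) j.2
      rwa [Function.iterate_succ_apply'] at this
    | zero => rw [map_zero, smul_zero]; exact zero_mem _
    | add y z _ _ hy hz => rw [map_add, smul_add]; exact add_mem hy hz
    | smul p y _ hy =>
      rw [expand_smul, smul_comm]
      exact Submodule.smul_mem _ _ hy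
  have hfin : Module.Finite k[X] N := Module.Finite.span_of_finite _ (Set.finite_range x)
  have hfN : ∀ i, f i ∈ N := by
    intro i
    by_cases h0 : m i = 0
    · have h1 := hc i
      have : IsEmpty (Fin (m i)) := by rw [h0]; infer_instance
      rw [Set.range_eq_empty, Submodule.span_empty, Submodule.mem_bot, h0] at h1
      have : f i = 0 := (smul_eq_zero.1 h1).resolve_left (hc0 i)
      rw [this]
      exact zero_mem _
    · exact Submodule.subset_span ⟨⟨i, ⟨0, by lia⟩⟩, rfl⟩
  refine ⟨N, b, hfin, hb0, hbN, hfN, Submodule.span_mono ?_⟩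
  rintro _ ⟨⟨i, l⟩, rfl⟩
  exact ⟨(i, l), rfl⟩

/-- A finite family of Mahler series is given by an invertible Mahler system with linearly
independent entries. -/
theorem exists_mahler_system (hq : 2 ≤ q) (hq0 : q ≠ 0) {ι : Type*} [Finite ι]
    (f : ι → PowerSeries k)
    (hf : ∀ i, ∃ (m : ℕ) (p : ℕ → k[X]), (∃ j, j ≤ m ∧ p j ≠ 0) ∧
      ∑ j ∈ Finset.range (m + 1), p j • (PowerSeries.expand q hq0)^[j] (f i) = 0) :
    ∃ (n : ℕ) (g : Fin n → PowerSeries k) (a b : k[X]) (A B : Matrix (Fin n) (Fin n) k[X])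
      (T : Matrix ι (Fin n) k[X]), LinearIndependent k[X] g ∧ a ≠ 0 ∧ b ≠ 0 ∧
      (∀ i, a • g i = ∑ j, A i j • PowerSeries.expand q hq0 (g j)) ∧
      (∀ i, b • PowerSeries.expand q hq0 (g i) = ∑ j, B i j • g j) ∧
      A * B = (a * b) • (1 : Matrix (Fin n) (Fin n) k[X]) ∧ (∀ i, f i = ∑ j, T i j • g j) ∧
      ∀ j, g j ∈ Submodule.span k[X]
        (Set.range fun x : ι × ℕ => (PowerSeries.expand q hq0)^[x.2] (f x.1)) := by
  obtain ⟨N, b, hfin, hb0, hbN, hfN, hN⟩ := exists_stable_submodule hq0 f hf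
  obtain ⟨n, g, hg, hgN, hrep⟩ := exists_basis_of_fg N
  choose B₀ hB₀ using fun i => hrep _ (hbN (g i) (hgN i))
  choose T₀ hT₀ using fun i => hrep _ (hfN i)
  obtain ⟨B, hB⟩ : ∃ B : Matrix (Fin n) (Fin n) k[X],
      ∀ i, b • PowerSeries.expand q hq0 (g i) = ∑ j, B i j • g j :=
    ⟨Matrix.of B₀, fun i => by rw [hB₀ i]; rfl⟩
  obtain ⟨T, hT⟩ : ∃ T : Matrix ι (Fin n) k[X], ∀ i, f i = ∑ j, T i j • g j :=
    ⟨Matrix.of T₀, fun i => by conv_lhs => rw [hT₀ i]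
                               rfl⟩
  obtain ⟨a, A, ha0, hA, hAB⟩ := exists_inverse_system (R := k[X]) (M := PowerSeries k)
    (g := g) (h := fun i => PowerSeries.expand q hq0 (g i)) (linearIndependent_expand hq hg) hb0 hB
  exact ⟨n, g, a, b, A, B, T, hg, ha0, hb0, hA, hB, hAB, hT, fun j => hN (hgN j)⟩

end Mahler

namespace Mahler

open Polynomial

variable {k : Type*} [Field k] {q : ℕ}

theorem coeff_mul_mem {K : Subfield k} {p : k[X]} (hp : ∀ m, p.coeff m ∈ K) {f : PowerSeries k}
    {N : ℕ} (hf : ∀ m ≤ N, PowerSeries.coeff m f ∈ K) {m : ℕ} (hm : m ≤ N) :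
    PowerSeries.coeff m (p • f) ∈ K := by
  rw [polynomial_smul_eq, PowerSeries.coeff_mul]
  refine sum_mem fun st hst => mul_mem ?_ (hf _ ?_)
  · rw [Polynomial.coeff_coe]; exact hp _
  · have := Finset.HasAntidiagonal.mem_antidiagonal.1 hst
    lia

theorem coeff_mem_of_mahler_system (hq : 2 ≤ q) (hq0 : q ≠ 0) {ι : Type*} [Fintype ι]
    {g : ι → PowerSeries k} {a : k[X]} (ha0 : a ≠ 0) {A : Matrix ι ι k[X]}
    (hA : ∀ i, a • g i = ∑ j, A i j • PowerSeries.expand q hq0 (g j)) (K : Subfield k)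
    (haK : ∀ m, a.coeff m ∈ K) (hAK : ∀ i j m, (A i j).coeff m ∈ K)
    (hgK : ∀ i, ∀ m ≤ a.natTrailingDegree, PowerSeries.coeff m (g i) ∈ K) (i : ι) (m : ℕ) :
    PowerSeries.coeff m (g i) ∈ K := by
  induction m using Nat.strong_induction_on generalizing i with
  | _ m ih =>
    set v := a.natTrailingDegree with hv
    rcases le_or_gt m v with hm | hm
    · exact hgK i m hm
    have hR : PowerSeries.coeff (m + v) (a • g i) ∈ K := by
      rw [hA, map_sum]
      refine sum_mem fun j _ => coeff_mul_mem (hAK i j) (N := m + v) (fun l hl => ?_) le_rfl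
      rw [PowerSeries.coeff_expand]
      split_ifs with hdvd
      · refine ih _ ?_ j
        exact lt_of_le_of_lt (Nat.div_le_div_left hq (by lia)) (by lia)
      · exact zero_mem _
    have hav : a.coeff v ≠ 0 := by
      rw [hv, ← Polynomial.trailingCoeff]
      exact Polynomial.trailingCoeff_nonzero_iff_nonzero.2 ha0
    have hmem : (v, m) ∈ Finset.HasAntidiagonal.antidiagonal (m + v) :=
      Finset.HasAntidiagonal.mem_antidiagonal.2 (by simp [add_comm])
    rw [polynomial_smul_eq, PowerSeries.coeff_mul, ← Finset.add_sum_erase _ _ hmem] at hR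
    have hrest : ∑ st ∈ (Finset.HasAntidiagonal.antidiagonal (m + v)).erase (v, m),
        PowerSeries.coeff st.1 (a : PowerSeries k) * PowerSeries.coeff st.2 (g i) ∈ K := by
      refine sum_mem fun st hst => ?_
      obtain ⟨hne, hst⟩ := Finset.mem_erase.1 hst
      have hst := Finset.HasAntidiagonal.mem_antidiagonal.1 hst
      rw [Polynomial.coeff_coe]
      rcases lt_or_ge st.1 v with h | h
      · rw [Polynomial.coeff_eq_zero_of_lt_natTrailingDegree h, zero_mul]
        exact zero_mem _
      · refine mul_mem (haK _) (ih _ ?_ i)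
        by_contra! hlt
        exact hne (Prod.ext (by simp; lia) (by simp; lia))
    have h1 := (add_mem_cancel_right hrest).1 hR
    rw [Polynomial.coeff_coe] at h1
    have h2 := mul_mem (inv_mem (haK v)) h1
    rwa [inv_mul_cancel_left₀ hav] at h2

theorem exists_finiteDimensional_coeff_mem [CharZero k] [Algebra.IsAlgebraic ℚ k] (hq : 2 ≤ q)
    (hq0 : q ≠ 0) {ι : Type*} [Fintype ι] {g : ι → PowerSeries k} {a : k[X]} (ha0 : a ≠ 0)
    {A : Matrix ι ι k[X]}
    (hA : ∀ i, a • g i = ∑ j, A i j • PowerSeries.expand q hq0 (g j)) (S : Set k)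
    (hS : S.Finite) :
    ∃ K : IntermediateField ℚ k, FiniteDimensional ℚ K ∧ S ⊆ K ∧
      (∀ i j m, (A i j).coeff m ∈ K) ∧ ∀ i m, PowerSeries.coeff m (g i) ∈ K := by
  let S' : Set k := S ∪ (a.coeff '' Set.Iic a.natDegree ∪
    ((⋃ i, ⋃ j, (A i j).coeff '' Set.Iic (A i j).natDegree) ∪
      ⋃ i, (fun m => PowerSeries.coeff m (g i)) '' Set.Iic a.natTrailingDegree))
  have hS' : S'.Finite := by
    refine hS.union (((Set.finite_Iic _).image _).union (Set.Finite.union ?_ ?_))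
    · exact Set.finite_iUnion fun i => Set.finite_iUnion fun j => (Set.finite_Iic _).image _
    · exact Set.finite_iUnion fun i => (Set.finite_Iic _).image _
  have hsub : S' ⊆ IntermediateField.adjoin ℚ S' := IntermediateField.subset_adjoin ℚ S'
  have hpoly : ∀ p : k[X], p.coeff '' Set.Iic p.natDegree ⊆ S' →
      ∀ m, p.coeff m ∈ IntermediateField.adjoin ℚ S' := by
    intro p hp m
    rcases le_or_gt m p.natDegree with h | h
    · exact hsub (hp ⟨m, h, rfl⟩)
    · rw [Polynomial.coeff_eq_zero_of_natDegree_lt h]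
      exact zero_mem _
  have hAK : ∀ i j m, (A i j).coeff m ∈ IntermediateField.adjoin ℚ S' := fun i j =>
    hpoly _ fun _ hx => Or.inr (Or.inr (Or.inl (Set.mem_iUnion₂.2 ⟨i, j, hx⟩)))
  refine ⟨IntermediateField.adjoin ℚ S', ?_, ?_, hAK, ?_⟩
  · have := hS'.to_subtype
    exact IntermediateField.finiteDimensional_adjoin fun x _ => Algebra.IsIntegral.isIntegral x
  · exact Set.Subset.trans Set.subset_union_left hsub
  · refine coeff_mem_of_mahler_system hq hq0 ha0 hA (IntermediateField.adjoin ℚ S').toSubfield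
      (hpoly a (Set.Subset.trans Set.subset_union_left Set.subset_union_right)) hAK ?_
    intro i m hm
    exact hsub (Or.inr (Or.inr (Or.inr (Set.mem_iUnion.2 ⟨i, m, hm, rfl⟩))))

end Mahler

namespace Mahler

open Polynomial

/-- The product `A(z) A(z ^ q) ⋯ A(z ^ q ^ (m - 1))`. -/
noncomputable def iterMat {R ι : Type*} [CommRing R] [Fintype ι] [DecidableEq ι] (q : ℕ)
    (A : Matrix ι ι R[X]) : ℕ → Matrix ι ι R[X]
  | 0 => 1
  | m + 1 => iterMat q A m * A.map (Polynomial.expand R (q ^ m))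

section Basic

variable {R S ι : Type*} [CommRing R] [CommRing S] [Fintype ι] [DecidableEq ι] {q : ℕ}

theorem iterMat_map (f : R →+* S) (A : Matrix ι ι R[X]) (m : ℕ) :
    iterMat q (A.map (Polynomial.mapRingHom f)) m =
      (iterMat q A m).map (Polynomial.mapRingHom f) := by
  induction m with
  | zero => simp [iterMat]
  | succ m ih =>
    rw [iterMat, iterMat, Matrix.map_mul, ih]
    congr 1
    ext1 i j
    simp [Polynomial.map_expand]

theorem eval_iterMat_succ (A : Matrix ι ι R[X]) (m : ℕ) (x : R) (i j : ι) :
    (iterMat q A (m + 1) i j).eval x =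
      ∑ l, (iterMat q A m i l).eval x * (A l j).eval (x ^ q ^ m) := by
  rw [iterMat, Matrix.mul_apply, Polynomial.eval_finsetSum]
  simp [Polynomial.expand_eval]

end Basic

section Size

variable {K : Type*} [Field K] [NumberField K] {q : ℕ}

theorem SizeLE.exists_base {ι : Type*} [Finite ι] (hq : 2 ≤ q) {c : ℕ} (hc : 1 ≤ c) (e : ι → ℕ)
    {β : ι → ℕ → K} (h : ∀ i, SizeLE c q (e i) (β i)) :
    ∃ d : ℕ, 1 ≤ d ∧ ∀ i k, IsIntegral ℤ ((d : K) ^ q ^ k * β i k) ∧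
      ∀ τ : K →+* ℂ, ‖τ (β i k)‖ ≤ (d : ℝ) ^ q ^ k := by
  have := Fintype.ofFinite ι
  choose C hC h using h
  have hd : ∀ i, 1 ≤ C i * c ^ e i := fun i => Nat.one_le_iff_ne_zero.2 (by
    have := hC i
    positivity)
  refine ⟨∏ i, C i * c ^ e i, Nat.one_le_iff_ne_zero.2
    (Finset.prod_ne_zero_iff.2 fun i _ => by have := hd i; lia), fun i k => ?_⟩
  have hqk : q ^ k ≠ 0 := by positivity
  have hdvd : C i * c ^ (e i * q ^ k) ∣ (∏ i, C i * c ^ e i) ^ q ^ k := by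
    refine dvd_trans ?_ (pow_dvd_pow_of_dvd (Finset.dvd_prod_of_mem _ (Finset.mem_univ i)) _)
    rw [mul_pow, ← pow_mul]
    exact mul_dvd_mul_right (dvd_pow_self _ hqk) _
  constructor
  · obtain ⟨w, hw⟩ := hdvd
    have h1 := isIntegral_natCast_pow_mul w (h i k).1
    have h2 : ((∏ i, C i * c ^ e i : ℕ) : K) ^ q ^ k * β i k =
        w * (C i * (c : K) ^ (e i * q ^ k) * β i k) := by
      rw [← Nat.cast_pow, hw]
      push_cast
      ring
    rw [h2]
    exact h1
  · intro τ
    refine ((h i k).2 τ).trans ?_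
    have h3 := Nat.le_of_dvd (Nat.pos_of_ne_zero (pow_ne_zero _
      (Finset.prod_ne_zero_iff.2 fun i _ => by have := hd i; lia))) hdvd
    exact_mod_cast h3

theorem exists_sizeLE_iterMat {ι : Type*} [Fintype ι] [DecidableEq ι] (hq : 2 ≤ q)
    (A : Matrix ι ι K[X]) (x : K) :
    ∃ c : ℕ, 1 ≤ c ∧ SizeLE c q 1 (fun k => x ^ q ^ k) ∧
      ∀ i j, SizeLE c q 1 fun k => (iterMat q A k i j).eval x := by
  obtain ⟨c₁, hc₁, hx⟩ : ∃ c : ℕ, 1 ≤ c ∧ SizeLE c q 1 (fun k => x ^ q ^ k) := by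
    obtain ⟨C, hC, h⟩ := SizeLE.const (c := 1) (q := q) x
    refine ⟨C, hC, 1, one_pos, fun k => ⟨?_, fun τ => ?_⟩⟩
    · have h1 := (h 0).1.pow (q ^ k)
      have h2 : ((1 : ℕ) : K) * (C : K) ^ (1 * q ^ k) * x ^ q ^ k =
          ((C : K) * ((1 : ℕ) : K) ^ (0 * q ^ 0) * x) ^ q ^ k := by
        simp [mul_pow]
      rw [h2]
      exact h1
    · have h1 := (h 0).2 τ
      rw [map_pow, norm_pow, Nat.cast_one, one_mul, one_mul]
      refine pow_le_pow_left₀ (norm_nonneg _) ?_ _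
      simpa using h1
  obtain ⟨d, hd, h⟩ := SizeLE.exists_base (ι := Option (ι × ι)) hq hc₁
    (fun o => o.elim 1 fun p => (A p.1 p.2).natDegree)
    (β := fun o k => o.elim (x ^ q ^ k) fun p => (A p.1 p.2).eval (x ^ q ^ k)) (by
      rintro (_ | p)
      · exact hx
      · exact hx.eval_polynomial hc₁ _ le_rfl)
  set N := Fintype.card ι with hN
  have hmain : ∀ k i j,
      IsIntegral ℤ (((d * (N + 1) : ℕ) : K) ^ (∑ l ∈ Finset.range k, q ^ l) *
        (iterMat q A k i j).eval x) ∧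
      ∀ τ : K →+* ℂ, ‖τ ((iterMat q A k i j).eval x)‖ ≤
        ((d * (N + 1) : ℕ) : ℝ) ^ (∑ l ∈ Finset.range k, q ^ l) := by
    intro k
    induction k with
    | zero =>
      intro i j
      rw [iterMat, Matrix.one_apply]
      split_ifs <;> simp [isIntegral_one, isIntegral_zero]
    | succ k ih =>
      intro i j
      rw [eval_iterMat_succ, Finset.sum_range_succ]
      constructor
      · rw [Finset.mul_sum]
        refine IsIntegral.sum _ fun l _ => ?_
        have h1 := isIntegral_natCast_pow_mul ((N + 1) ^ q ^ k)
          ((ih i l).1.mul (h (some (l, j)) k).1)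
        have h2 : ((d * (N + 1) : ℕ) : K) ^ (∑ l ∈ Finset.range k, q ^ l + q ^ k) *
            ((iterMat q A k i l).eval x * (A l j).eval (x ^ q ^ k)) =
            (((N + 1) ^ q ^ k : ℕ) : K) *
              (((d * (N + 1) : ℕ) : K) ^ (∑ l ∈ Finset.range k, q ^ l) *
                (iterMat q A k i l).eval x * ((d : K) ^ q ^ k * (A l j).eval (x ^ q ^ k))) := by
          generalize ∑ l ∈ Finset.range k, q ^ l = s
          push_cast
          rw [pow_add, mul_pow _ _ (q ^ k)]
          ring
        rw [h2]
        exact h1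
      · intro τ
        rw [map_sum]
        refine (norm_sum_le _ _).trans ((Finset.sum_le_card_nsmul _ _
          (((d * (N + 1) : ℕ) : ℝ) ^ (∑ l ∈ Finset.range k, q ^ l) * (d : ℝ) ^ q ^ k)
          fun l _ => ?_).trans ?_)
        · rw [map_mul, norm_mul]
          exact mul_le_mul ((ih i l).2 τ) ((h (some (l, j)) k).2 τ) (norm_nonneg _) (by positivity)
        · rw [Finset.card_univ, ← hN, nsmul_eq_mul, pow_add _ _ (q ^ k)]
          have h3 : (N : ℝ) ≤ ((N : ℝ) + 1) ^ q ^ k := by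
            have := le_self_pow₀ (a := (N : ℝ) + 1) (by linarith [(Nat.cast_nonneg N : (0:ℝ) ≤ N)])
              (n := q ^ k) (by positivity)
            linarith
          have h4 : ((d * (N + 1) : ℕ) : ℝ) ^ q ^ k = (d : ℝ) ^ q ^ k * ((N : ℝ) + 1) ^ q ^ k := by
            push_cast
            rw [mul_pow]
          rw [h4]
          calc _ = (((d * (N + 1) : ℕ) : ℝ) ^ (∑ l ∈ Finset.range k, q ^ l) * (d : ℝ) ^ q ^ k) *
                N := by ring
            _ ≤ (((d * (N + 1) : ℕ) : ℝ) ^ (∑ l ∈ Finset.range k, q ^ l) * (d : ℝ) ^ q ^ k) *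
                ((N : ℝ) + 1) ^ q ^ k := by gcongr
            _ = _ := by ring
  have hgeom : ∀ k, ∑ l ∈ Finset.range k, q ^ l ≤ q ^ k := by
    intro k
    induction k with
    | zero => simp
    | succ k ih =>
      rw [Finset.sum_range_succ, pow_succ]
      nlinarith [Nat.pos_of_ne_zero (pow_ne_zero k (by lia : q ≠ 0))]
  have hdN : 1 ≤ d * (N + 1) := by nlinarith
  refine ⟨d * (N + 1), hdN, ⟨1, one_pos, fun k => ⟨?_, fun τ => ?_⟩⟩,
    fun i j => ⟨1, one_pos, fun k => ⟨?_, fun τ => ?_⟩⟩⟩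
  · have h1 := isIntegral_natCast_pow_mul ((N + 1) ^ q ^ k) (h none k).1
    have h2 : ((1 : ℕ) : K) * ((d * (N + 1) : ℕ) : K) ^ (1 * q ^ k) * x ^ q ^ k =
        (((N + 1) ^ q ^ k : ℕ) : K) * ((d : K) ^ q ^ k * x ^ q ^ k) := by
      push_cast
      rw [mul_pow, one_mul, one_mul]
      ring
    rw [h2]
    exact h1
  · refine ((h none k).2 τ).trans ?_
    rw [Nat.cast_one, one_mul, one_mul]
    gcongr
    nlinarith
  · have h1 := isIntegral_natCast_pow_mul
      ((d * (N + 1)) ^ (q ^ k - ∑ l ∈ Finset.range k, q ^ l)) (hmain k i j).1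
    have h2 : ((1 : ℕ) : K) * ((d * (N + 1) : ℕ) : K) ^ (1 * q ^ k) * (iterMat q A k i j).eval x =
        (((d * (N + 1)) ^ (q ^ k - ∑ l ∈ Finset.range k, q ^ l) : ℕ) : K) *
          (((d * (N + 1) : ℕ) : K) ^ (∑ l ∈ Finset.range k, q ^ l) *
            (iterMat q A k i j).eval x) := by
      rw [← mul_assoc, Nat.cast_pow, ← pow_add, Nat.sub_add_cancel (hgeom k), Nat.cast_one,
        one_mul, one_mul]
    rw [h2]
    exact h1
  · refine ((hmain k i j).2 τ).trans ?_
    rw [Nat.cast_one, one_mul, one_mul]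
    exact pow_le_pow_right₀ (by exact_mod_cast hdN) (hgeom k)

end Size

end Mahler

namespace Mahler

open Polynomial Filter Topology

variable {k : Type*} [Field k]

theorem exists_finite_coeff_mem {ι : Type*} {g : ι → PowerSeries k} {u : PowerSeries k}
    (hu : u ∈ Algebra.adjoin k[X] (Set.range g)) :
    ∃ S : Set k, S.Finite ∧ ∀ K : Subfield k, S ⊆ K → (∀ i m, PowerSeries.coeff m (g i) ∈ K) →
      ∀ m, PowerSeries.coeff m u ∈ K := by
  induction hu using Algebra.adjoin_induction with
  | mem u hu =>
    obtain ⟨i, rfl⟩ := hu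
    exact ⟨∅, Set.finite_empty, fun K _ h => h i⟩
  | algebraMap p =>
    refine ⟨p.coeff '' Set.Iic p.natDegree, (Set.finite_Iic _).image _, fun K hK _ m => ?_⟩
    rw [algebraMap_polynomial_apply, Polynomial.coeff_coe]
    rcases le_or_gt m p.natDegree with h | h
    · exact hK ⟨m, h, rfl⟩
    · rw [Polynomial.coeff_eq_zero_of_natDegree_lt h]
      exact zero_mem _
  | add u v _ _ hu hv =>
    obtain ⟨S, hS, hu⟩ := hu
    obtain ⟨S', hS', hv⟩ := hv
    refine ⟨S ∪ S', hS.union hS', fun K hK hg m => ?_⟩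
    rw [map_add]
    exact add_mem (hu K (Set.union_subset_iff.1 hK).1 hg m) (hv K (Set.union_subset_iff.1 hK).2 hg m)
  | mul u v _ _ hu hv =>
    obtain ⟨S, hS, hu⟩ := hu
    obtain ⟨S', hS', hv⟩ := hv
    refine ⟨S ∪ S', hS.union hS', fun K hK hg m => ?_⟩
    rw [PowerSeries.coeff_mul]
    exact sum_mem fun st _ => mul_mem (hu K (Set.union_subset_iff.1 hK).1 hg _)
      (hv K (Set.union_subset_iff.1 hK).2 hg _)

theorem eval₂_evGerm_ne_zero_of_mem_adjoin [CharZero k] [Algebra.IsAlgebraic ℚ k] (φ : k →+* ℂ)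
    {q : ℕ} (hq : 2 ≤ q) (hq0 : q ≠ 0) {ι : Type*} [Fintype ι] [DecidableEq ι]
    {g : ι → PowerSeries k} {a : k[X]} (ha0 : a ≠ 0) {A : Matrix ι ι k[X]}
    (hA : ∀ i, a • g i = ∑ j, A i j • PowerSeries.expand q hq0 (g j))
    {α : k} (hα0 : α ≠ 0) (hα1 : ‖φ α‖ < 1) {l : Ultrafilter ℕ} (hl : (l : Filter ℕ) ≤ atTop)
    (hZ : Tendsto (fun m => φ α ^ q ^ m) l (𝓝 0)) (s : Set (ι × ι))
    (hind : ∀ P : MvPolynomial s k[X], P ≠ 0 →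
      MvPolynomial.eval₂ ((evGerm φ hZ).comp (polyConv φ))
        (fun i => ((fun m => φ ((iterMat q A m i.1.1 i.1.2).eval α) : ℕ → ℂ) :
          (l : Filter ℕ).Germ ℂ)) P ≠ 0)
    {G : MvPolynomial s (convSubring φ)} (hG : G ≠ 0)
    (hGg : ∀ m, ((G.coeff m : convSubring φ) : PowerSeries k) ∈
      Algebra.adjoin k[X] (Set.range g)) :
    MvPolynomial.eval₂ (evGerm φ hZ)
      (fun i => ((fun m => φ ((iterMat q A m i.1.1 i.1.2).eval α) : ℕ → ℂ) :
        (l : Filter ℕ).Germ ℂ)) G ≠ 0 := by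
  classical
  choose S hS hSK using fun m => exists_finite_coeff_mem (hGg m)
  obtain ⟨K, hKfin, hSub, hAK, hgK⟩ := exists_finiteDimensional_coeff_mem hq hq0 ha0 hA
    ({α} ∪ ⋃ m ∈ G.support, S m)
    ((Set.finite_singleton _).union (Set.Finite.biUnion G.support.finite_toSet fun m _ => hS m))
  have hNF : NumberField K := { }
  let ψ : K →+* k := algebraMap K k
  let φK : K →+* ℂ := φ.comp ψ
  have hαK : α ∈ K := hSub (Or.inl rfl)
  let β : K := ⟨α, hαK⟩
  have hcoef : ∀ m n, PowerSeries.coeff n ((G.coeff m : convSubring φ) : PowerSeries k) ∈ K := by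
    intro m n
    by_cases hm : m ∈ G.support
    · exact hSK m K.toSubfield (fun x hx => hSub (Or.inr (Set.mem_biUnion hm hx))) hgK n
    · rw [MvPolynomial.notMem_support_iff.1 hm, Subring.coe_zero, map_zero]
      exact zero_mem _
  let c : (s →₀ ℕ) → convSubring φK := fun m =>
    ⟨PowerSeries.mk fun n => ⟨_, hcoef m n⟩, by
      obtain ⟨ρ, hρ, h⟩ := (G.coeff m).2
      refine ⟨ρ, hρ, h.congr fun n => ?_⟩
      rw [PowerSeries.coeff_mk]
      rfl⟩
  let G' : MvPolynomial s (convSubring φK) := ∑ m ∈ G.support, MvPolynomial.monomial m (c m)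
  have hG' : G' ≠ 0 := by
    obtain ⟨m, hm⟩ := MvPolynomial.support_nonempty.2 hG
    intro h0
    have h1 : MvPolynomial.coeff m G' = c m := by
      simp only [G', MvPolynomial.coeff_sum, MvPolynomial.coeff_monomial]
      rw [Finset.sum_ite_eq' , if_pos hm]
    rw [h0, MvPolynomial.coeff_zero] at h1
    apply MvPolynomial.mem_support_iff.1 hm
    ext n
    have h2 := congrArg (fun f : convSubring φK => ψ (PowerSeries.coeff n (f : PowerSeries K))) h1
    simp only [c, PowerSeries.coeff_mk] at h2
    rw [Subring.coe_zero, map_zero, map_zero] at h2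
    rw [Subring.coe_zero, map_zero]
    exact h2.symm
  have hlift : ∀ i j, ∃ p : K[X], p.map ψ = A i j := fun i j =>
    (Polynomial.mem_lifts _).1 ((Polynomial.lifts_iff_coeff_lifts _).2 fun n =>
      ⟨⟨_, hAK i j n⟩, rfl⟩)
  choose AK hAK' using hlift
  have hAmap : A = (Matrix.of AK).map (Polynomial.mapRingHom ψ) := by
    ext1 i j
    exact (hAK' i j).symm
  have hT : ∀ m i j, φK ((iterMat q (Matrix.of AK) m i j).eval β) =
      φ ((iterMat q A m i j).eval α) := by
    intro m i j
    rw [hAmap, iterMat_map, Matrix.map_apply, Polynomial.coe_mapRingHom]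
    exact congrArg φ (Polynomial.eval_map_apply _ _).symm
  obtain ⟨c₀, hc₀, hSx, hSA⟩ := exists_sizeLE_iterMat hq (Matrix.of AK) β
  have key := eval₂_evGerm_ne_zero φK hq hc₀ (α := β) (fun h => hα0 (congrArg ψ h)) hα1 hl hZ hSx
    (t := fun m (i : s) => (iterMat q (Matrix.of AK) m i.1.1 i.1.2).eval β)
    (fun i => hSA i.1.1 i.1.2) ?_ hG'
  · intro h0
    apply key
    simp only [hT]
    rw [← h0]
    conv_rhs => rw [MvPolynomial.as_sum G]
    rw [MvPolynomial.eval₂_sum, MvPolynomial.eval₂_sum]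
    refine Finset.sum_congr rfl fun m _ => ?_
    rw [MvPolynomial.eval₂_monomial, MvPolynomial.eval₂_monomial]
    congr 1
    have hps : ∀ z, psSum φK (c m : PowerSeries K) z =
        psSum φ ((G.coeff m : convSubring φ) : PowerSeries k) z := by
      intro z
      simp only [psSum, c, PowerSeries.coeff_mk]
      rfl
    exact congrArg (fun u : ℕ → ℂ => (u : (l : Filter ℕ).Germ ℂ)) (funext fun n => hps _)
  · intro P hP h0
    refine hind (MvPolynomial.map (Polynomial.mapRingHom ψ) P) ?_ ?_
    · rw [Ne, ← map_zero (MvPolynomial.map (Polynomial.mapRingHom ψ))]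
      exact fun h => hP (MvPolynomial.map_injective _ (Polynomial.map_injective ψ ψ.injective) h)
    · rw [MvPolynomial.eval₂_map, ← h0]
      simp only [hT]
      have hhom : ((evGerm φ hZ).comp (polyConv φ)).comp (Polynomial.mapRingHom ψ) =
          (evGerm φK hZ).comp (polyConv φK) := by
        refine RingHom.ext fun p => ?_
        rw [RingHom.comp_apply, RingHom.comp_apply, RingHom.comp_apply, evGerm_polyConv,
          Polynomial.coe_mapRingHom, Polynomial.map_map]
        exact (evGerm_polyConv φK hZ p).symm
      rw [hhom]
      rfl

end Mahler

namespace Mahler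

open Polynomial

section Fractions

variable {D O Γ : Type*} [CommRing D] [IsDomain D] [CommRing O] [IsDomain O] [Algebra D O]

theorem mem_range_algebraMap_of_isAlgebraic [FaithfulSMul D O] {F E : Type*} [Field F] [Algebra D F]
    [IsFractionRing D F] [Field E] [Algebra O E] [IsFractionRing O E] [Algebra D E]
    [IsScalarTower D O E] [Algebra F E] [IsScalarTower D F E]
    (hreg : ∀ u w : O, w ≠ 0 → ∀ P : D[X], P ≠ 0 →
      ∑ i ∈ Finset.range (P.natDegree + 1), P.coeff i • (u ^ i * w ^ (P.natDegree - i)) = 0 →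
      ∃ c d : D, d ≠ 0 ∧ d • u = c • w) (e : E) (he : IsAlgebraic F e) :
    e ∈ Set.range (algebraMap F E) := by
  rw [← IsFractionRing.isAlgebraic_iff D F E] at he
  obtain ⟨P, hP, hPe⟩ := he
  obtain ⟨u, w, hw, rfl⟩ := IsFractionRing.div_surjective (A := O) e
  have hw0 : w ≠ 0 := nonZeroDivisors.ne_zero hw
  have hw0' : algebraMap O E w ≠ 0 := by
    rwa [Ne, IsFractionRing.to_map_eq_zero_iff]
  obtain ⟨c, d, hd, hcd⟩ := hreg u w hw0 P hP (by
    apply IsFractionRing.injective O E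
    rw [map_zero, map_sum, ← mul_zero (algebraMap O E w ^ P.natDegree), ← hPe,
      aeval_eq_sum_range, Finset.mul_sum]
    refine Finset.sum_congr rfl fun i hi => ?_
    rw [Finset.mem_range] at hi
    have h3 : algebraMap O E w ^ P.natDegree =
        algebraMap O E w ^ (P.natDegree - i) * algebraMap O E w ^ i := by
      rw [← pow_add, Nat.sub_add_cancel (by lia)]
    rw [Algebra.smul_def, Algebra.smul_def, map_mul, map_mul, map_pow, map_pow,
      ← IsScalarTower.algebraMap_apply, div_pow, h3]
    have h4 := div_mul_cancel₀ (algebraMap O E u ^ i) (pow_ne_zero i hw0')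
    linear_combination (-(algebraMap O E w ^ (P.natDegree - i) * algebraMap D E (P.coeff i))) * h4)
  refine ⟨algebraMap D F c / algebraMap D F d, ?_⟩
  have hd' : algebraMap D E d ≠ 0 := by
    rw [IsScalarTower.algebraMap_apply D F E, _root_.map_ne_zero, Ne, IsFractionRing.to_map_eq_zero_iff]
    exact hd
  rw [map_div₀, ← IsScalarTower.algebraMap_apply, ← IsScalarTower.algebraMap_apply,
    div_eq_div_iff hd' hw0']
  have h5 := congrArg (algebraMap O E) hcd
  rw [Algebra.smul_def, Algebra.smul_def, map_mul, map_mul, ← IsScalarTower.algebraMap_apply,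
    ← IsScalarTower.algebraMap_apply] at h5
  rw [← h5, mul_comm]

theorem algebraicIndependent_fraction {ι : Type*} {E : Type*} [Field E] [Algebra O E]
    [IsFractionRing O E] [Field Γ] [Algebra O Γ] [Algebra E Γ] [IsScalarTower O E Γ] {x : ι → Γ}
    (hx : AlgebraicIndependent O x) : AlgebraicIndependent E x := by
  classical
  rw [algebraicIndependent_iff] at hx ⊢
  intro P hP
  obtain ⟨b, hb⟩ := IsLocalization.exist_integer_multiples (nonZeroDivisors O) P.support
    (fun m => P.coeff m)
  choose! c hc using hb
  have hb0 : algebraMap O E b ≠ 0 := by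
    rw [Ne, IsFractionRing.to_map_eq_zero_iff]
    exact nonZeroDivisors.ne_zero b.2
  let Q : MvPolynomial ι O := ∑ m ∈ P.support, MvPolynomial.monomial m (c m)
  have hQ : MvPolynomial.map (algebraMap O E) Q = MvPolynomial.C (algebraMap O E b) * P := by
    conv_rhs => rw [MvPolynomial.as_sum P]
    rw [map_sum, Finset.mul_sum]
    refine Finset.sum_congr rfl fun m hm => ?_
    rw [MvPolynomial.map_monomial, hc m hm, MvPolynomial.C_mul_monomial, Algebra.smul_def]
  have hQ0 : MvPolynomial.aeval x Q = 0 := by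
    rw [← MvPolynomial.aeval_map_algebraMap E, hQ, map_mul, hP, mul_zero]
  rw [hx Q hQ0, map_zero] at hQ
  refine (mul_eq_zero.1 hQ.symm).resolve_left ?_
  rwa [MvPolynomial.C_eq_zero]

theorem eq_zero_of_sum_eq_zero_of_regular [CharZero D] [FaithfulSMul D O] [Field Γ] [Algebra O Γ]
    [FaithfulSMul O Γ] [Algebra D Γ] [IsScalarTower D O Γ] {ι : Type*} [Finite ι] (x : ι → Γ)
    (hreg : ∀ u w : O, w ≠ 0 → ∀ P : D[X], P ≠ 0 →
      ∑ i ∈ Finset.range (P.natDegree + 1), P.coeff i • (u ^ i * w ^ (P.natDegree - i)) = 0 →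
      ∃ c d : D, d ≠ 0 ∧ d • u = c • w)
    (hind : ∀ s : Set ι, AlgebraicIndependent D (fun i : s => x i) →
      AlgebraicIndependent O (fun i : s => x i))
    {κ : Type*} {y : κ → O} (hy : LinearIndependent D y) (s : Finset κ) (c : κ → Γ)
    (hc : ∀ i, c i ∈ Algebra.adjoin D (Set.range x))
    (h0 : ∑ i ∈ s, c i * algebraMap O Γ (y i) = 0) : ∀ i ∈ s, c i = 0 := by
  have hDΓ : FaithfulSMul D Γ := by
    rw [faithfulSMul_iff_algebraMap_injective, IsScalarTower.algebraMap_eq D O Γ]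
    exact (FaithfulSMul.algebraMap_injective O Γ).comp (FaithfulSMul.algebraMap_injective D O)
  let E := FractionRing O
  let F := FractionRing D
  let _ : Algebra E Γ := FractionRing.liftAlgebra O Γ
  let _ : Algebra F Γ := FractionRing.liftAlgebra D Γ
  let _ : Algebra F E := FractionRing.liftAlgebra D E
  have : IsScalarTower D E Γ := IsScalarTower.of_algebraMap_eq fun d => by
    rw [IsScalarTower.algebraMap_apply D O Γ, IsScalarTower.algebraMap_apply D O E,
      ← IsScalarTower.algebraMap_apply O E Γ]
  have hFEΓ : IsScalarTower F E Γ := inferInstance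
  have hchar : CharZero F := charZero_of_injective_algebraMap (IsFractionRing.injective D F)
  refine eq_zero_of_sum_eq_zero_of_mem_adjoin (F := F) (E := E) x
    (fun e he => mem_range_algebraMap_of_isAlgebraic (D := D) (O := O) hreg e he) (fun t ht => ?_)
    (y := fun i => algebraMap O E (y i)) ?_ s c (fun i => ?_) ?_
  · exact algebraicIndependent_fraction (O := O)
      (hind t (ht.restrictScalars (IsFractionRing.injective D F)))
  · rw [← LinearIndependent.iff_fractionRing (R := D)]
    exact hy.map' (IsScalarTower.toAlgHom D O E).toLinearMap
      (LinearMap.ker_eq_bot.2 (IsFractionRing.injective O E))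
  · have h1 : Algebra.adjoin D (Set.range x) ≤
        (IntermediateField.adjoin F (Set.range x)).toSubalgebra.restrictScalars D :=
      Algebra.adjoin_le (IntermediateField.subset_adjoin F _)
    exact h1 (hc i)
  · rw [← h0]
    refine Finset.sum_congr rfl fun i _ => ?_
    rw [← IsScalarTower.algebraMap_apply O E Γ]

end Fractions

end Mahler

namespace Mahler

open Polynomial Filter Topology

variable {k : Type*} [Field k]

theorem adjoin_le_convSubring (φ : k →+* ℂ) {ι : Type*} {g : ι → PowerSeries k}
    (hg : ∀ i, g i ∈ convSubring φ) {y : PowerSeries k}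
    (hy : y ∈ Algebra.adjoin k[X] (Set.range g)) : y ∈ convSubring φ := by
  induction hy using Algebra.adjoin_induction with
  | mem u hu =>
    obtain ⟨i, rfl⟩ := hu
    exact hg i
  | algebraMap p =>
    rw [algebraMap_polynomial_apply]
    exact coe_mem_convSubring φ p
  | add u v _ _ hu hv => exact add_mem hu hv
  | mul u v _ _ hu hv => exact mul_mem hu hv

theorem frequently_eval₂_eq_zero [CharZero k] [IsAlgClosed k] [Algebra.IsAlgebraic ℚ k]
    (φ : k →+* ℂ) {q : ℕ} (hq : 2 ≤ q) (hq0 : q ≠ 0) {ι : Type*} [Fintype ι] [DecidableEq ι]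
    {g : ι → PowerSeries k} (hg : ∀ i, g i ∈ convSubring φ) {a b : k[X]} (ha0 : a ≠ 0)
    (hb0 : b ≠ 0) {A B : Matrix ι ι k[X]}
    (hA : ∀ i, a • g i = ∑ j, A i j • PowerSeries.expand q hq0 (g j))
    (hB : ∀ i, b • PowerSeries.expand q hq0 (g i) = ∑ j, B i j • g j)
    {α : k} (hα0 : α ≠ 0) (hα1 : ‖φ α‖ < 1) {κ : Type*} [Fintype κ] {y : κ → PowerSeries k}
    (hy : LinearIndependent k[X] y) (hyg : ∀ i, y i ∈ Algebra.adjoin k[X] (Set.range g))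
    (c : κ → MvPolynomial (ι × ι) k[X])
    (h0 : ∀ᶠ m in atTop, ∑ i, φ (MvPolynomial.eval₂ (evalRingHom (α ^ q ^ m))
      (fun p => (iterMat q A m p.1 p.2).eval α) (c i)) * psSum φ (y i) (φ α ^ q ^ m) = 0) :
    ∃ᶠ m in atTop, ∀ i, MvPolynomial.eval₂ (evalRingHom (α ^ q ^ m))
      (fun p => (iterMat q A m p.1 p.2).eval α) (c i) = 0 := by
  classical
  let l : Ultrafilter ℕ := hyperfilter ℕ
  have hl : (l : Filter ℕ) ≤ atTop := by
    rw [← Nat.cofinite_eq_atTop]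
    exact hyperfilter_le_cofinite
  have hZ : Tendsto (fun m => φ α ^ q ^ m) l (𝓝 0) :=
    ((tendsto_pow_atTop_nhds_zero_of_norm_lt_one hα1).comp
      (tendsto_pow_atTop_atTop_of_one_lt (by lia : 1 < q))).mono_left hl
  let O := Algebra.adjoin k[X] (Set.range g)
  let ψ : O →+* convSubring φ :=
    (algebraMap O (PowerSeries k)).codRestrict (convSubring φ) fun u => adjoin_le_convSubring φ hg u.2
  let _ : Algebra O ((l : Filter ℕ).Germ ℂ) := ((evGerm φ hZ).comp ψ).toAlgebra
  let _ : Algebra k[X] ((l : Filter ℕ).Germ ℂ) :=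
    (((evGerm φ hZ).comp ψ).comp (algebraMap k[X] O)).toAlgebra
  have htower : IsScalarTower k[X] O ((l : Filter ℕ).Germ ℂ) :=
    IsScalarTower.of_algebraMap_eq fun _ => rfl
  have hψinj : Function.Injective ψ := fun u v h =>
    Subtype.ext (congrArg (fun w : convSubring φ => (w : PowerSeries k)) h)
  have hinj : Function.Injective (algebraMap O ((l : Filter ℕ).Germ ℂ)) :=
    (evGerm_injective φ hZ (Eventually.of_forall fun m =>
      pow_ne_zero _ ((_root_.map_ne_zero φ).2 hα0))).comp hψinj
  have hf1 : FaithfulSMul O ((l : Filter ℕ).Germ ℂ) :=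
    (faithfulSMul_iff_algebraMap_injective _ _).2 hinj
  have hf2 : FaithfulSMul k[X] O := (faithfulSMul_iff_algebraMap_injective _ _).2 fun p r h =>
    coe_injective_powerSeries (congrArg (algebraMap O (PowerSeries k)) h)
  have hpoly : ∀ p : k[X], ψ (algebraMap k[X] O p) = polyConv φ p := fun p =>
    Subtype.ext (algebraMap_polynomial_apply p)
  have halg : algebraMap k[X] ((l : Filter ℕ).Germ ℂ) = (evGerm φ hZ).comp (polyConv φ) :=
    RingHom.ext fun p => congrArg (evGerm φ hZ) (hpoly p)
  let x : ι × ι → (l : Filter ℕ).Germ ℂ := fun p =>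
    ((fun m => φ ((iterMat q A m p.1 p.2).eval α) : ℕ → ℂ) : (l : Filter ℕ).Germ ℂ)
  have hcx : ∀ i, MvPolynomial.aeval x (c i) =
      ((fun m => φ (MvPolynomial.eval₂ (evalRingHom (α ^ q ^ m))
        (fun p => (iterMat q A m p.1 p.2).eval α) (c i)) : ℕ → ℂ) : (l : Filter ℕ).Germ ℂ) := by
    intro i
    rw [MvPolynomial.aeval_def, halg]
    refine (eval₂_germ ((evGerm φ hZ).comp (polyConv φ))
      (fun p m => (p.map φ).eval (φ α ^ q ^ m)) (fun p => evGerm_polyConv φ hZ p)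
      (fun (p : ι × ι) m => φ ((iterMat q A m p.1 p.2).eval α)) (c i)).trans ?_
    refine congrArg (fun u : ℕ → ℂ => (u : (l : Filter ℕ).Germ ℂ)) ?_
    funext m
    rw [MvPolynomial.eval₂_eq', map_sum]
    refine Finset.sum_congr rfl fun μ _ => ?_
    rw [map_mul, map_prod, coe_evalRingHom, ← map_pow, Polynomial.eval_map_apply]
    simp only [map_pow]
  have key := eq_zero_of_sum_eq_zero_of_regular (D := k[X]) (O := O)
    (Γ := (l : Filter ℕ).Germ ℂ) x ?_ ?_ (y := fun i => (⟨y i, hyg i⟩ : O)) ?_ Finset.univ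
    (fun i => MvPolynomial.aeval x (c i)) (fun i => ?_) ?_
  · have h1 : ∀ᶠ m in (l : Filter ℕ), ∀ i, MvPolynomial.eval₂ (evalRingHom (α ^ q ^ m))
        (fun p => (iterMat q A m p.1 p.2).eval α) (c i) = 0 := by
      rw [eventually_all]
      intro i
      have h2 := key i (Finset.mem_univ i)
      rw [hcx] at h2
      filter_upwards [Germ.coe_eq.1 h2] with m hm
      exact (_root_.map_eq_zero φ).1 hm
    exact h1.frequently.filter_mono hl
  · intro u w hw P hP h
    have hadj : ∀ f : ι → PowerSeries k, ∀ e : ι → k[X], ∑ j, e j • f j ∈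
        Algebra.adjoin k[X] (Set.range f) := fun f e =>
      sum_mem fun j _ => Subalgebra.smul_mem _ (Algebra.subset_adjoin (Set.mem_range_self j)) _
    obtain ⟨c, d, hd, hcd⟩ := exists_smul_eq_smul_of_isAlgebraic φ hq (g := g) ha0
      (fun i => by rw [hA i]; exact hadj _ _) hb0 (fun i => by rw [hB i]; exact hadj _ _)
      u.2 w.2 (fun h => hw (Subtype.ext h)) hP (by
        have := congrArg (algebraMap O (PowerSeries k)) h
        rw [map_sum, map_zero] at this
        exact this)
    exact ⟨c, d, hd, Subtype.ext hcd⟩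
  · intro s hs
    rw [algebraicIndependent_iff] at hs ⊢
    intro G hG
    by_contra hG0
    refine eval₂_evGerm_ne_zero_of_mem_adjoin φ hq hq0 ha0 hA hα0 hα1 hl hZ s ?_
      (G := MvPolynomial.map ψ G) ?_ ?_ ?_
    · intro P hP h
      refine hP (hs P ?_)
      rw [MvPolynomial.aeval_def, halg]
      exact h
    · rw [Ne, ← map_zero (MvPolynomial.map ψ)]
      exact fun h => hG0 (MvPolynomial.map_injective _ hψinj h)
    · intro m
      rw [MvPolynomial.coeff_map]
      exact (G.coeff m).2
    · rw [MvPolynomial.eval₂_map]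
      exact hG
  · exact LinearIndependent.of_comp O.val.toLinearMap hy
  · rw [Algebra.adjoin_range_eq_range_aeval]
    exact ⟨c i, rfl⟩
  · simp only [hcx]
    have h1 : ∀ i, algebraMap O ((l : Filter ℕ).Germ ℂ) ⟨y i, hyg i⟩ =
        ((fun m => psSum φ (y i) (φ α ^ q ^ m) : ℕ → ℂ) : (l : Filter ℕ).Germ ℂ) := fun _ => rfl
    simp only [h1]
    have h2 : ∑ i, ((fun m => φ (MvPolynomial.eval₂ (evalRingHom (α ^ q ^ m))
        (fun p => (iterMat q A m p.1 p.2).eval α) (c i)) : ℕ → ℂ) : (l : Filter ℕ).Germ ℂ) *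
        ((fun m => psSum φ (y i) (φ α ^ q ^ m) : ℕ → ℂ) : (l : Filter ℕ).Germ ℂ) =
        Germ.coeRingHom (R := ℂ) (l : Filter ℕ) (∑ i, (fun m =>
          φ (MvPolynomial.eval₂ (evalRingHom (α ^ q ^ m))
            (fun p => (iterMat q A m p.1 p.2).eval α) (c i))) *
          fun m => psSum φ (y i) (φ α ^ q ^ m)) := by
      rw [map_sum]
      rfl
    rw [h2]
    refine Germ.coe_eq.2 ((h0.filter_mono hl).mono fun m hm => ?_)
    rw [Finset.sum_apply]
    exact hm

end Mahler

namespace Mahler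

open Polynomial

section MatSubst

variable {R S τ ι υ : Type*} [CommRing R] [CommRing S] [Fintype ι] [Fintype υ]

/-- The linear substitution `P(X) ↦ P(M X)` in polynomials. -/
noncomputable def matSubst (M : Matrix τ ι R) : MvPolynomial τ R →ₐ[R] MvPolynomial ι R :=
  MvPolynomial.aeval fun i => ∑ j, MvPolynomial.C (M i j) * MvPolynomial.X j

theorem matSubst_isHomogeneous (M : Matrix τ ι R) {P : MvPolynomial τ R} {d : ℕ}
    (hP : P.IsHomogeneous d) : (matSubst M P).IsHomogeneous d := by
  have := hP.aeval (fun i => ∑ j, MvPolynomial.C (M i j) * MvPolynomial.X j)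
    fun i => MvPolynomial.IsHomogeneous.sum Finset.univ _ 1 fun j _ =>
      MvPolynomial.isHomogeneous_C_mul_X (M i j) j
  rwa [one_mul] at this

theorem eval₂_matSubst (f : R →+* S) (x : ι → S) (M : Matrix τ ι R) (P : MvPolynomial τ R) :
    MvPolynomial.eval₂ f x (matSubst M P) =
      MvPolynomial.eval₂ f (fun i => ∑ j, f (M i j) * x j) P := by
  induction P using MvPolynomial.induction_on with
  | C r => rw [matSubst, MvPolynomial.algHom_C, MvPolynomial.algebraMap_eq, MvPolynomial.eval₂_C,
      MvPolynomial.eval₂_C]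
  | add p r hp hr => rw [map_add, MvPolynomial.eval₂_add, MvPolynomial.eval₂_add, hp, hr]
  | mul_X p i hp =>
    rw [map_mul, MvPolynomial.eval₂_mul, MvPolynomial.eval₂_mul, hp, matSubst,
      MvPolynomial.aeval_X, MvPolynomial.eval₂_X, MvPolynomial.eval₂_sum]
    simp only [MvPolynomial.eval₂_mul, MvPolynomial.eval₂_C, MvPolynomial.eval₂_X]

theorem map_matSubst (f : R →+* S) (M : Matrix τ ι R) (P : MvPolynomial τ R) :
    MvPolynomial.map f (matSubst M P) = matSubst (M.map f) (MvPolynomial.map f P) := by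
  induction P using MvPolynomial.induction_on with
  | C r => simp [matSubst]
  | add p r hp hr => simp only [map_add, hp, hr]
  | mul_X p i hp =>
    rw [map_mul, map_mul, map_mul, map_mul, hp]
    simp [matSubst]

theorem matSubst_matSubst (N : Matrix ι υ R) (M : Matrix τ ι R) (P : MvPolynomial τ R) :
    matSubst N (matSubst M P) = matSubst (M * N) P := by
  conv_lhs => rw [matSubst, MvPolynomial.aeval_def, eval₂_matSubst]
  rw [matSubst, MvPolynomial.aeval_def]
  congr 1
  funext i
  simp only [Matrix.mul_apply, map_sum, Finset.mul_sum, Finset.sum_mul, map_mul,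
    MvPolynomial.algebraMap_eq]
  rw [Finset.sum_comm]
  refine Finset.sum_congr rfl fun _ _ => Finset.sum_congr rfl fun _ _ => ?_
  ring

theorem eval₂_mul_of_isHomogeneous (f : R →+* S) (c : S) (x : τ → S) {P : MvPolynomial τ R} {d : ℕ}
    (hP : P.IsHomogeneous d) :
    MvPolynomial.eval₂ f (fun i => c * x i) P = c ^ d * MvPolynomial.eval₂ f x P := by
  rw [MvPolynomial.eval₂_eq, MvPolynomial.eval₂_eq, Finset.mul_sum]
  refine Finset.sum_congr rfl fun m hm => ?_
  have hd := hP.degree_eq_sum_deg_support hm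
  simp only [mul_pow, Finset.prod_mul_distrib]
  rw [Finset.prod_pow_eq_pow_sum, ← hd]
  ring

theorem matSubst_smul_one [DecidableEq ι] (c : R) {P : MvPolynomial ι R} {d : ℕ}
    (hP : P.IsHomogeneous d) : matSubst (c • (1 : Matrix ι ι R)) P = MvPolynomial.C (c ^ d) * P := by
  have h1 : (fun i => ∑ j, MvPolynomial.C ((c • (1 : Matrix ι ι R)) i j) * MvPolynomial.X j) =
      fun i : ι => MvPolynomial.C (σ := ι) c * MvPolynomial.X i := by
    funext i
    rw [Finset.sum_eq_single i]
    · simp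
    · intro j _ hj
      simp [Matrix.one_apply_ne hj.symm]
    · simp
  rw [matSubst, MvPolynomial.aeval_def, h1, eval₂_mul_of_isHomogeneous _ _ _ hP, map_pow,
    MvPolynomial.algebraMap_eq, MvPolynomial.eval₂_eta]

end MatSubst

section Iterate

variable {k : Type*} [Field k] {q : ℕ} {ι : Type*} [Fintype ι] [DecidableEq ι]
  {g : ι → PowerSeries k} {a b : k[X]} {A B : Matrix ι ι k[X]}

theorem expand_pow_succ (hq0 : q ≠ 0) (m : ℕ) (f : PowerSeries k) :
    PowerSeries.expand (q ^ (m + 1)) (pow_ne_zero _ hq0) f =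
      PowerSeries.expand (q ^ m) (pow_ne_zero _ hq0) (PowerSeries.expand q hq0 f) := by
  rw [← PowerSeries.expand_mul]
  rfl

theorem exists_iterate_inverse (hq0 : q ≠ 0)
    (hB : ∀ i, b • PowerSeries.expand q hq0 (g i) = ∑ j, B i j • g j)
    (hAB : A * B = (a * b) • 1) {α : k} (hα : ∀ j, (a * b).eval (α ^ q ^ j) ≠ 0) (m : ℕ) :
    ∃ (Bm : Matrix ι ι k[X]) (bm cm : k[X]),
      (∀ i, bm • PowerSeries.expand (q ^ m) (pow_ne_zero _ hq0) (g i) = ∑ j, Bm i j • g j) ∧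
      iterMat q A m * Bm = cm • 1 ∧ cm.eval α ≠ 0 := by
  induction m with
  | zero =>
    refine ⟨1, 1, 1, fun i => ?_, by simp [iterMat], by simp⟩
    rw [Finset.sum_eq_single i]
    · simp only [pow_zero, Matrix.one_apply_eq, PowerSeries.expand_one_apply]
    · intro j _ hj
      rw [Matrix.one_apply_ne hj.symm, zero_smul]
    · simp
  | succ m ih =>
    obtain ⟨Bm, bm, cm, h1, h2, h3⟩ := ih
    refine ⟨B.map (Polynomial.expand k (q ^ m)) * Bm, bm * Polynomial.expand k (q ^ m) b,
      cm * Polynomial.expand k (q ^ m) (a * b), fun i => ?_, ?_, ?_⟩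
    · rw [expand_pow_succ hq0, mul_smul, ← expand_smul, hB, map_sum, Finset.smul_sum]
      simp only [expand_smul, Matrix.mul_apply, Finset.sum_smul]
      rw [Finset.sum_comm]
      refine Finset.sum_congr rfl fun j _ => ?_
      rw [smul_comm, h1, Finset.smul_sum]
      simp only [Matrix.map_apply, mul_smul]
    · have h4 : A.map (Polynomial.expand k (q ^ m)) * B.map (Polynomial.expand k (q ^ m)) =
          Polynomial.expand k (q ^ m) (a * b) • 1 := by
        rw [← Matrix.map_mul, hAB]
        ext1 i j
        rcases eq_or_ne i j with rfl | h
        · simp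
        · simp [h]
      rw [iterMat, Matrix.mul_assoc, ← Matrix.mul_assoc (A.map _), h4, Matrix.smul_mul,
        Matrix.one_mul, Matrix.mul_smul, h2, smul_smul, mul_comm]
    · rw [Polynomial.eval_mul, Polynomial.expand_eval]
      exact mul_ne_zero h3 (hα m)

theorem exists_iterate (hq0 : q ≠ 0)
    (hA : ∀ i, a • g i = ∑ j, A i j • PowerSeries.expand q hq0 (g j))
    {α : k} (hα : ∀ j, a.eval (α ^ q ^ j) ≠ 0) (m : ℕ) :
    ∃ am : k[X], am.eval α ≠ 0 ∧ ∀ i, am • g i =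
      ∑ j, iterMat q A m i j • PowerSeries.expand (q ^ m) (pow_ne_zero _ hq0) (g j) := by
  induction m with
  | zero =>
    refine ⟨1, by simp, fun i => ?_⟩
    rw [Finset.sum_eq_single i]
    · simp only [iterMat, pow_zero, Matrix.one_apply_eq, PowerSeries.expand_one_apply]
    · intro j _ hj
      rw [iterMat, Matrix.one_apply_ne hj.symm, zero_smul]
    · simp
  | succ m ih =>
    obtain ⟨am, h1, h2⟩ := ih
    refine ⟨am * Polynomial.expand k (q ^ m) a, ?_, fun i => ?_⟩
    · rw [Polynomial.eval_mul, Polynomial.expand_eval]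
      exact mul_ne_zero h1 (hα m)
    · simp only [expand_pow_succ hq0, iterMat, Matrix.mul_apply, Finset.sum_smul]
      rw [mul_comm, mul_smul, h2, Finset.smul_sum, Finset.sum_comm]
      refine Finset.sum_congr rfl fun j _ => ?_
      rw [smul_comm, ← expand_smul, hA, map_sum, Finset.smul_sum]
      simp only [expand_smul, Matrix.map_apply, mul_smul]

end Iterate

end Mahler

namespace Mahler

open Polynomial Filter Topology

variable {k : Type*} [Field k]

theorem eventually_psSum_aeval (φ : k →+* ℂ) {ι : Type*} {g : ι → PowerSeries k}
    (hg : ∀ i, g i ∈ convSubring φ) (Q : MvPolynomial ι k[X]) :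
    ∀ᶠ z in 𝓝 (0 : ℂ), psSum φ (MvPolynomial.aeval g Q) z =
      MvPolynomial.eval₂ ((evalRingHom z).comp (mapRingHom φ)) (fun i => psSum φ (g i) z) Q := by
  have hmem : ∀ Q : MvPolynomial ι k[X], MvPolynomial.aeval g Q ∈ convSubring φ := fun Q =>
    adjoin_le_convSubring φ hg (by
      rw [Algebra.adjoin_range_eq_range_aeval]
      exact ⟨Q, rfl⟩)
  induction Q using MvPolynomial.induction_on with
  | C p =>
    refine Eventually.of_forall fun z => ?_
    rw [MvPolynomial.algHom_C, algebraMap_polynomial_apply, psSum_coe, MvPolynomial.eval₂_C]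
    rfl
  | add p r hp hr =>
    filter_upwards [hp, hr, eventually_psSum_add φ (hmem p) (hmem r)] with z h1 h2 h3
    rw [map_add, h3, h1, h2, MvPolynomial.eval₂_add]
  | mul_X p i hp =>
    filter_upwards [hp, eventually_psSum_mul φ (hmem p) (hg i)] with z h1 h3
    rw [map_mul, MvPolynomial.aeval_X, h3, h1, MvPolynomial.eval₂_mul, MvPolynomial.eval₂_X]

theorem exists_homogeneous_basis {ι : Type*} [Finite ι] (g : ι → PowerSeries k) (d : ℕ) :
    ∃ (n : ℕ) (E : Fin n → MvPolynomial ι k[X]) (c : (ι →₀ ℕ) → Fin n → k[X]),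
      LinearIndependent k[X] (fun i => MvPolynomial.aeval g (E i)) ∧
      (∀ i, (E i).IsHomogeneous d) ∧
      ∀ μ : ι →₀ ℕ, μ.degree = d → MvPolynomial.aeval g (MvPolynomial.monomial μ (1 : k[X])) =
        MvPolynomial.aeval g (∑ i, MvPolynomial.C (c μ i) * E i) := by
  let N : Submodule k[X] (PowerSeries k) :=
    (MvPolynomial.homogeneousSubmodule ι k[X] d).map (MvPolynomial.aeval g).toLinearMap
  have hfin : Module.Finite k[X] N :=
    Module.Finite.iff_fg.2 ((MvPolynomial.homogeneousSubmodule_fg _ _ d).map _)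
  obtain ⟨n, y, hy, hyN, hspan⟩ := exists_basis_of_fg N
  choose E hE hEy using hyN
  have hmon : ∀ μ : ι →₀ ℕ, ∃ e : Fin n → k[X], μ.degree = d →
      MvPolynomial.aeval g (MvPolynomial.monomial μ (1 : k[X])) = ∑ j, e j • y j := by
    intro μ
    by_cases h : μ.degree = d
    · obtain ⟨e, he⟩ := hspan _ (Submodule.mem_map_of_mem
        ((MvPolynomial.mem_homogeneousSubmodule d _).2
          (MvPolynomial.isHomogeneous_monomial (1 : k[X]) h)))
      exact ⟨e, fun _ => he⟩
    · exact ⟨0, fun h' => absurd h' h⟩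
  choose c hc using hmon
  refine ⟨n, E, c, ?_, hE, fun μ hμ => ?_⟩
  · have : (fun i => MvPolynomial.aeval g (E i)) = y := funext hEy
    rwa [this]
  · rw [hc μ hμ, map_sum]
    refine Finset.sum_congr rfl fun i _ => ?_
    rw [map_mul, MvPolynomial.algHom_C, ← Algebra.smul_def]
    exact congrArg _ (hEy i).symm

theorem exists_homogeneous_lift [CharZero k] [IsAlgClosed k] [Algebra.IsAlgebraic ℚ k]
    (φ : k →+* ℂ) {q : ℕ} (hq : 2 ≤ q) (hq0 : q ≠ 0) {ι : Type*} [Fintype ι] [DecidableEq ι]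
    {g : ι → PowerSeries k} (hg : ∀ i, g i ∈ convSubring φ) {a b : k[X]} (ha0 : a ≠ 0)
    (hb0 : b ≠ 0) {A B : Matrix ι ι k[X]}
    (hA : ∀ i, a • g i = ∑ j, A i j • PowerSeries.expand q hq0 (g j))
    (hB : ∀ i, b • PowerSeries.expand q hq0 (g i) = ∑ j, B i j • g j)
    (hAB : A * B = (a * b) • 1)
    {α : k} (hα0 : α ≠ 0) (hα1 : ‖φ α‖ < 1) (hα : ∀ j, (a * b).eval (α ^ q ^ j) ≠ 0)
    {P : MvPolynomial ι k} {d : ℕ} (hP : P.IsHomogeneous d)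
    (h0 : ∀ᶠ m in atTop, MvPolynomial.eval₂ φ (fun i => ∑ j, φ ((iterMat q A m i j).eval α) *
      psSum φ (g j) (φ α ^ q ^ m)) P = 0) :
    ∃ Q : MvPolynomial ι k[X], Q.IsHomogeneous d ∧ MvPolynomial.aeval g Q = 0 ∧
      MvPolynomial.map (evalRingHom α) Q = P := by
  classical
  have hZ : Tendsto (fun m => φ α ^ q ^ m) atTop (𝓝 0) :=
    (tendsto_pow_atTop_nhds_zero_of_norm_lt_one hα1).comp
      (tendsto_pow_atTop_atTop_of_one_lt (by lia : 1 < q))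
  obtain ⟨n, E, c, hE, hEd, hc⟩ := exists_homogeneous_basis g d
  let U : MvPolynomial ι (MvPolynomial (ι × ι) k[X]) :=
    matSubst (Matrix.of fun i j => MvPolynomial.X (i, j))
      (MvPolynomial.map ((MvPolynomial.C (σ := ι × ι)).comp (Polynomial.C (R := k))) P)
  have hU : U.IsHomogeneous d := matSubst_isHomogeneous _ (hP.map _)
  have hUd : ∀ μ ∈ U.support, μ.degree = d := fun μ hμ => by
    by_contra h
    exact MvPolynomial.mem_support_iff.1 hμ (hU.coeff_eq_zero h)
  let ev : ℕ → MvPolynomial (ι × ι) k[X] →+* k := fun m =>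
    MvPolynomial.eval₂Hom (evalRingHom (α ^ q ^ m)) (fun p => (iterMat q A m p.1 p.2).eval α)
  have hevC : ∀ m p, ev m (MvPolynomial.C p) = p.eval (α ^ q ^ m) := fun m p =>
    MvPolynomial.eval₂Hom_C _ _ _
  have hevU : ∀ m, MvPolynomial.map (ev m) U =
      matSubst ((iterMat q A m).map (evalRingHom α)) P := by
    intro m
    rw [map_matSubst, MvPolynomial.map_map]
    have h1 : (ev m).comp ((MvPolynomial.C (σ := ι × ι)).comp (Polynomial.C (R := k))) =
        RingHom.id k := by
      refine RingHom.ext fun x => ?_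
      rw [RingHom.comp_apply, RingHom.comp_apply, hevC, eval_C]
      rfl
    rw [h1, MvPolynomial.map_id]
    congr 2
    ext i j
    simp [ev]
  let Rel : (ι →₀ ℕ) → MvPolynomial ι k[X] := fun μ =>
    MvPolynomial.monomial μ 1 - ∑ i, MvPolynomial.C (c μ i) * E i
  have hRel : ∀ μ ∈ U.support, MvPolynomial.aeval g (Rel μ) = 0 := fun μ hμ => by
    rw [map_sub, hc μ (hUd μ hμ), sub_self]
  have hfreq := frequently_eval₂_eq_zero φ hq hq0 hg ha0 hb0 hA hB hα0 hα1 hE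
    (fun i => by
      rw [Algebra.adjoin_range_eq_range_aeval]
      exact ⟨E i, rfl⟩)
    (fun i => ∑ μ ∈ U.support, U.coeff μ * MvPolynomial.C (c μ i)) ?_
  · obtain ⟨m, hm⟩ := hfreq.exists
    have hm' : ∀ i, ∑ μ ∈ U.support, ev m (U.coeff μ) * (c μ i).eval (α ^ q ^ m) = 0 := by
      intro i
      have := hm i
      rw [MvPolynomial.eval₂_sum] at this
      rw [← this]
      refine Finset.sum_congr rfl fun μ _ => ?_
      rw [MvPolynomial.eval₂_mul, MvPolynomial.eval₂_C]
      rfl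
    let Qm : MvPolynomial ι k[X] :=
      ∑ μ ∈ U.support, MvPolynomial.C (Polynomial.C (ev m (U.coeff μ))) * Rel μ
    have hQmd : Qm.IsHomogeneous d := MvPolynomial.IsHomogeneous.sum _ _ _ fun μ hμ =>
      MvPolynomial.IsHomogeneous.C_mul ((MvPolynomial.isHomogeneous_monomial _ (hUd μ hμ)).sub
        (MvPolynomial.IsHomogeneous.sum _ _ _ fun i _ =>
          MvPolynomial.IsHomogeneous.C_mul (hEd i) _)) _
    have hQm0 : MvPolynomial.aeval g Qm = 0 := by
      rw [map_sum]
      refine Finset.sum_eq_zero fun μ hμ => ?_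
      rw [map_mul, hRel μ hμ, mul_zero]
    have hQmα : MvPolynomial.map (evalRingHom (α ^ q ^ m)) Qm =
        matSubst ((iterMat q A m).map (evalRingHom α)) P := by
      rw [← hevU, map_sum]
      conv_rhs => rw [MvPolynomial.as_sum U, map_sum]
      have h1 : ∀ μ ∈ U.support, MvPolynomial.map (evalRingHom (α ^ q ^ m))
          (MvPolynomial.C (Polynomial.C (ev m (U.coeff μ))) * Rel μ) =
          MvPolynomial.map (ev m) (MvPolynomial.monomial μ (U.coeff μ)) -
          ∑ i, MvPolynomial.C (ev m (U.coeff μ) * (c μ i).eval (α ^ q ^ m)) *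
            MvPolynomial.map (evalRingHom (α ^ q ^ m)) (E i) := by
        intro μ _
        rw [map_mul, map_sub, map_sum, mul_sub, MvPolynomial.map_C, MvPolynomial.map_monomial,
          MvPolynomial.map_monomial, MvPolynomial.C_mul_monomial, Finset.mul_sum]
        simp [mul_assoc]
      rw [Finset.sum_congr rfl h1, Finset.sum_sub_distrib, Finset.sum_comm]
      simp only [← Finset.sum_mul, ← map_sum, hm', map_zero, zero_mul, Finset.sum_const_zero,
        sub_zero]
    obtain ⟨Bm, bm, cm, h1, h2, h3⟩ := exists_iterate_inverse hq0 hB hAB hα m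
    have hqm : q ^ m ≠ 0 := pow_ne_zero _ hq0
    let Q' : MvPolynomial ι k[X] :=
      matSubst Bm (MvPolynomial.map (Polynomial.expand k (q ^ m)).toRingHom Qm)
    have hQ'α : MvPolynomial.map (evalRingHom α) Q' = MvPolynomial.C (cm.eval α ^ d) * P := by
      have h4 : (evalRingHom α).comp (Polynomial.expand k (q ^ m)).toRingHom =
          evalRingHom (α ^ q ^ m) := RingHom.ext fun p => Polynomial.expand_eval _ p α
      rw [map_matSubst, MvPolynomial.map_map, h4, hQmα, matSubst_matSubst, ← Matrix.map_mul, h2,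
        ← matSubst_smul_one _ hP]
      congr 2
      ext i j
      rcases eq_or_ne i j with rfl | h
      · simp
      · simp [h]
    have hQ'g : MvPolynomial.aeval g Q' = 0 := by
      rw [MvPolynomial.aeval_def, eval₂_matSubst]
      have h4 : (fun i => ∑ j, algebraMap k[X] (PowerSeries k) (Bm i j) * g j) = fun i =>
          algebraMap k[X] (PowerSeries k) bm * PowerSeries.expand (q ^ m) hqm (g i) := by
        funext i
        rw [← Algebra.smul_def, h1]
        exact Finset.sum_congr rfl fun j _ => (Algebra.smul_def _ _).symm
      rw [h4, eval₂_mul_of_isHomogeneous _ _ _ (hQmd.map _), MvPolynomial.eval₂_map]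
      have h5 : (algebraMap k[X] (PowerSeries k)).comp (Polynomial.expand k (q ^ m)).toRingHom =
          (PowerSeries.expand (q ^ m) hqm : PowerSeries k →ₐ[k] PowerSeries k).toRingHom.comp
            (algebraMap k[X] (PowerSeries k)) := by
        refine RingHom.ext fun p => ?_
        have := expand_coe hqm p
        simp only [RingHom.comp_apply, algebraMap_polynomial_apply]
        exact this.symm
      have h6 := MvPolynomial.hom_eval₂ Qm (algebraMap k[X] (PowerSeries k))
        (PowerSeries.expand (q ^ m) hqm : PowerSeries k →ₐ[k] PowerSeries k).toRingHom g
      rw [← MvPolynomial.aeval_def, hQm0, map_zero] at h6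
      rw [h5]
      exact mul_eq_zero_of_right _ h6.symm
    refine ⟨MvPolynomial.C (Polynomial.C (cm.eval α ^ d)⁻¹) * Q',
      MvPolynomial.IsHomogeneous.C_mul (matSubst_isHomogeneous _ (hQmd.map _)) _, ?_, ?_⟩
    · rw [map_mul, hQ'g, mul_zero]
    · rw [map_mul, hQ'α, MvPolynomial.map_C, coe_evalRingHom, eval_C, ← mul_assoc, ← map_mul,
        inv_mul_cancel₀ (pow_ne_zero _ h3), map_one, one_mul]
  · have hE' : ∀ᶠ m in atTop, ∀ i, psSum φ (MvPolynomial.aeval g (E i)) (φ α ^ q ^ m) =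
        MvPolynomial.eval₂ ((evalRingHom (φ α ^ q ^ m)).comp (mapRingHom φ))
          (fun i => psSum φ (g i) (φ α ^ q ^ m)) (E i) :=
      eventually_all.2 fun i => hZ.eventually (eventually_psSum_aeval φ hg (E i))
    have hR' : ∀ᶠ m in atTop, ∀ μ ∈ U.support,
        0 = MvPolynomial.eval₂ ((evalRingHom (φ α ^ q ^ m)).comp (mapRingHom φ))
          (fun i => psSum φ (g i) (φ α ^ q ^ m)) (Rel μ) := by
      rw [eventually_all_finset]
      intro μ hμ
      filter_upwards [hZ.eventually (eventually_psSum_aeval φ hg (Rel μ))] with m hm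
      rw [← hm, hRel μ hμ]
      simp [psSum]
    filter_upwards [hE', hR', h0] with m hE' hR' h0
    let w : ι → ℂ := fun i => psSum φ (g i) (φ α ^ q ^ m)
    let ζ : k[X] →+* ℂ := (evalRingHom (φ α ^ q ^ m)).comp (mapRingHom φ)
    have hζ : ∀ p, ζ p = φ (p.eval (α ^ q ^ m)) := fun p => by
      simp only [ζ, RingHom.comp_apply, coe_evalRingHom, coe_mapRingHom]
      rw [← map_pow, Polynomial.eval_map_apply]
    have h1 : MvPolynomial.eval₂ (φ.comp (ev m)) w U = 0 := by
      rw [← MvPolynomial.eval₂_map, hevU, eval₂_matSubst]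
      exact h0
    rw [← h1, MvPolynomial.eval₂_eq]
    have h2 : ∀ μ ∈ U.support, ∏ i ∈ μ.support, w i ^ μ i =
        ∑ i, ζ (c μ i) * MvPolynomial.eval₂ ζ w (E i) := by
      intro μ hμ
      have := hR' μ hμ
      rw [MvPolynomial.eval₂_sub, MvPolynomial.eval₂_monomial, MvPolynomial.eval₂_sum, map_one,
        one_mul] at this
      simp only [MvPolynomial.eval₂_mul, MvPolynomial.eval₂_C] at this
      exact sub_eq_zero.1 this.symm
    have h3 : ∑ μ ∈ U.support, (φ.comp (ev m)) (U.coeff μ) * ∏ i ∈ μ.support, w i ^ μ i =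
        ∑ μ ∈ U.support, ∑ i, (φ.comp (ev m)) (U.coeff μ) *
          (ζ (c μ i) * MvPolynomial.eval₂ ζ w (E i)) :=
      Finset.sum_congr rfl fun μ hμ => by rw [h2 μ hμ, Finset.mul_sum]
    rw [h3, Finset.sum_comm]
    refine Finset.sum_congr rfl fun i _ => ?_
    rw [hE' i, MvPolynomial.eval₂_sum, map_sum, Finset.sum_mul]
    refine Finset.sum_congr rfl fun μ _ => ?_
    rw [MvPolynomial.eval₂_mul, MvPolynomial.eval₂_C, map_mul, hζ, mul_assoc]
    rfl

end Mahler

namespace Mahler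

open Polynomial

section Homogeneous

variable {R Y τ : Type*} [CommRing R] [CommRing Y] [Algebra R Y]

theorem aeval_X_mul_C_of_isHomogeneous (x : τ → Y) {P : MvPolynomial τ R} {d : ℕ}
    (hP : P.IsHomogeneous d) :
    MvPolynomial.aeval (fun i => (X * C (x i) : Y[X])) P = X ^ d * C (MvPolynomial.aeval x P) := by
  rw [MvPolynomial.aeval_def, eval₂_mul_of_isHomogeneous _ _ _ hP]
  congr 1
  have h1 : algebraMap R Y[X] = (C : Y →+* Y[X]).comp (algebraMap R Y) := rfl
  rw [h1, ← MvPolynomial.hom_eval₂]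
  rfl

theorem coeff_aeval_X_mul_C (x : τ → Y) (P : MvPolynomial τ R) (d : ℕ) :
    (MvPolynomial.aeval (fun i => (X * C (x i) : Y[X])) P).coeff d =
      MvPolynomial.aeval x (MvPolynomial.homogeneousComponent d P) := by
  conv_lhs => rw [← MvPolynomial.sum_homogeneousComponent P]
  rw [map_sum, finsetSum_coeff]
  have h1 : ∀ e, (MvPolynomial.aeval (fun i => (X * C (x i) : Y[X]))
      (MvPolynomial.homogeneousComponent e P)).coeff d =
      if e = d then MvPolynomial.aeval x (MvPolynomial.homogeneousComponent d P) else 0 := by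
    intro e
    rw [aeval_X_mul_C_of_isHomogeneous x (MvPolynomial.homogeneousComponent_isHomogeneous e P),
      mul_comm, coeff_C_mul_X_pow]
    split_ifs with h h' h'
    · rw [h]
    · exact absurd h.symm h'
    · exact absurd h'.symm h
    · rfl
  simp only [h1]
  rw [Finset.sum_ite_eq']
  split_ifs with h
  · rfl
  · rw [MvPolynomial.homogeneousComponent_eq_zero, map_zero]
    rw [Finset.mem_range] at h
    lia

theorem isHomogeneous_of_C_mul [IsDomain R] {c : R} (hc : c ≠ 0) {P : MvPolynomial τ R} {d : ℕ}
    (h : (MvPolynomial.C c * P).IsHomogeneous d) : P.IsHomogeneous d := by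
  intro μ hμ
  refine h ?_
  rw [MvPolynomial.coeff_C_mul]
  exact mul_ne_zero hc hμ

end Homogeneous

variable {k : Type*} [Field k]

theorem exists_sub_mul_of_map_eq_zero {ι : Type*} {α : k} {Q : MvPolynomial ι k[X]} {d : ℕ}
    (hQ : Q.IsHomogeneous d) (h0 : MvPolynomial.map (evalRingHom α) Q = 0) :
    ∃ Q' : MvPolynomial ι k[X], Q'.IsHomogeneous d ∧ Q = MvPolynomial.C (X - C α) * Q' := by
  have h1 : MvPolynomial.C (X - C α) ∣ Q := by
    rw [MvPolynomial.C_dvd_iff_dvd_coeff]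
    intro μ
    rw [dvd_iff_isRoot]
    have := congrArg (MvPolynomial.coeff μ) h0
    rwa [MvPolynomial.coeff_map, MvPolynomial.coeff_zero] at this
  obtain ⟨Q', rfl⟩ := h1
  exact ⟨Q', isHomogeneous_of_C_mul (X_sub_C_ne_zero α) hQ, rfl⟩

theorem exists_homogeneous_relation {τ ι : Type*} [Finite τ] [Fintype ι] {f : τ → PowerSeries k}
    {g : ι → PowerSeries k} {T : Matrix τ ι k[X]} (hf : ∀ i, f i = ∑ j, T i j • g j) :
    ∃ h : k[X], h ≠ 0 ∧ ∀ (α : k), h.eval α ≠ 0 → ∀ (P : MvPolynomial τ k) (d : ℕ),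
      P.IsHomogeneous d → ∀ Q : MvPolynomial ι k[X], Q.IsHomogeneous d →
      MvPolynomial.aeval g Q = 0 →
      MvPolynomial.map (evalRingHom α) Q = matSubst (T.map (evalRingHom α)) P →
      ∃ Q' : MvPolynomial τ k[X], Q'.IsHomogeneous d ∧ MvPolynomial.aeval f Q' = 0 ∧
        MvPolynomial.map (evalRingHom α) Q' = P := by
  let u : τ → (PowerSeries k)[X] := fun i => X * C (f i)
  let v : ι → (PowerSeries k)[X] := fun i => X * C (g i)
  obtain ⟨h, hh0, hh⟩ := exists_pow_smul_mem_adjoin (D := k[X]) (Set.range u) (Set.range v)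
    (Set.finite_range u) (Set.finite_range v)
  refine ⟨h, hh0, fun α hα P d hP Q hQ hQg hQα => ?_⟩
  let PC : MvPolynomial τ k[X] := MvPolynomial.map (C : k →+* k[X]) P
  have hPC : PC.IsHomogeneous d := hP.map _
  have hPCα : MvPolynomial.map (evalRingHom α) PC = P := by
    have h1 : (evalRingHom α).comp (C : k →+* k[X]) = RingHom.id k :=
      RingHom.ext fun x => eval_C
    rw [MvPolynomial.map_map, h1, MvPolynomial.map_id]
  obtain ⟨W, hW, hWe⟩ := exists_sub_mul_of_map_eq_zero (α := α)
    ((matSubst_isHomogeneous T hPC).sub hQ) (by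
      rw [map_sub, map_matSubst, hPCα, hQα, sub_self])
  have hPf : MvPolynomial.aeval f PC = (X - C α) • MvPolynomial.aeval g W := by
    have h1 := congrArg (MvPolynomial.aeval g) hWe
    rw [map_sub, hQg, sub_zero, map_mul, MvPolynomial.algHom_C, ← Algebra.smul_def] at h1
    rw [← h1, MvPolynomial.aeval_def, MvPolynomial.aeval_def, eval₂_matSubst]
    congr 1
    funext i
    rw [hf i]
    exact Finset.sum_congr rfl fun j _ => Algebra.smul_def _ _
  obtain ⟨n, hn⟩ := hh (MvPolynomial.aeval v W) (by
      have : Algebra.adjoin k[X] (Set.range v) ≤ Algebra.adjoin k[X] (Set.range u ∪ Set.range v) :=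
        Algebra.adjoin_mono Set.subset_union_right
      refine this ?_
      rw [Algebra.adjoin_range_eq_range_aeval]
      exact ⟨W, rfl⟩) (X - C α) (X_sub_C_ne_zero α) (by
      have h1 : (X - C α) • MvPolynomial.aeval v W = MvPolynomial.aeval u PC := by
        rw [aeval_X_mul_C_of_isHomogeneous g hW, aeval_X_mul_C_of_isHomogeneous f hPC, hPf,
          ← mul_smul_comm, smul_C]
      rw [h1, Algebra.adjoin_range_eq_range_aeval]
      exact ⟨PC, rfl⟩)
  rw [Algebra.adjoin_range_eq_range_aeval] at hn
  obtain ⟨G, hG⟩ := hn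
  have hGd : MvPolynomial.aeval f (MvPolynomial.homogeneousComponent d G) =
      h ^ n • MvPolynomial.aeval g W := by
    rw [← coeff_aeval_X_mul_C]
    have h1 := congrArg (fun p : (PowerSeries k)[X] => p.coeff d) hG
    have h2 : MvPolynomial.aeval v W = X ^ d * C (MvPolynomial.aeval g W) :=
      aeval_X_mul_C_of_isHomogeneous g hW
    simp only [h2] at h1
    refine Eq.trans h1 ?_
    rw [coeff_smul, mul_comm, coeff_C_mul_X_pow, if_pos rfl]
  have hhn : h.eval α ^ n ≠ 0 := pow_ne_zero _ hα
  refine ⟨MvPolynomial.C (C (h.eval α ^ n)⁻¹) * (MvPolynomial.C (h ^ n) * PC -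
    MvPolynomial.C (X - C α) * MvPolynomial.homogeneousComponent d G),
    MvPolynomial.IsHomogeneous.C_mul ((MvPolynomial.IsHomogeneous.C_mul hPC _).sub
      (MvPolynomial.IsHomogeneous.C_mul
        (MvPolynomial.homogeneousComponent_isHomogeneous d G) _)) _, ?_, ?_⟩
  · have h1 : MvPolynomial.aeval f (MvPolynomial.C (h ^ n) * PC -
        MvPolynomial.C (X - C α) * MvPolynomial.homogeneousComponent d G) = 0 := by
      rw [map_sub, map_mul, map_mul, MvPolynomial.algHom_C, MvPolynomial.algHom_C,
        ← Algebra.smul_def, ← Algebra.smul_def, hGd, hPf, smul_comm, sub_self]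
    rw [map_mul, h1, mul_zero]
  · rw [map_mul, map_sub, map_mul, map_mul, hPCα]
    simp only [MvPolynomial.map_C, coe_evalRingHom, eval_C, eval_sub, eval_X, sub_self, map_zero,
      zero_mul, sub_zero, eval_pow]
    rw [← mul_assoc, ← map_mul, inv_mul_cancel₀ hhn, map_one, one_mul]

end Mahler

namespace Mahler

open Polynomial Filter Topology

theorem eq_zero_of_meromorphicOn_ball {G : ℂ → ℂ} {r : ℝ} (hr : 0 < r)
    (hG : MeromorphicOn G (Metric.ball 0 r)) (h0 : ∀ᶠ z in 𝓝 0, G z = 0) {x : ℂ}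
    (hx : x ∈ Metric.ball 0 r) (hc : ContinuousAt G x) : G x = 0 := by
  have hconn : IsConnected (Metric.ball (0 : ℂ) r) :=
    (convex_ball 0 r).isConnected ⟨0, Metric.mem_ball_self hr⟩
  have htop : meromorphicOrderAt G x = ⊤ := by
    by_contra h
    have h1 := (hG.exists_meromorphicOrderAt_ne_top_iff_forall hconn).1 ⟨⟨x, hx⟩, h⟩
      ⟨0, Metric.mem_ball_self hr⟩
    exact h1 (meromorphicOrderAt_eq_top_iff.2 (h0.filter_mono nhdsWithin_le_nhds))
  rw [meromorphicOrderAt_eq_top_iff] at htop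
  have h2 : Tendsto G (𝓝[≠] x) (𝓝 (G x)) := hc.tendsto.mono_left nhdsWithin_le_nhds
  exact tendsto_nhds_unique h2 (tendsto_const_nhds.congr' (htop.mono fun _ h => h.symm))

variable {k : Type*} [Field k]

theorem AbsConv.differentiableOn {φ : k →+* ℂ} {f : PowerSeries k} {ρ : ℝ}
    (hf : AbsConv φ f ρ) : DifferentiableOn ℂ (psSum φ f) (Metric.ball 0 ρ) := by
  refine Complex.differentiableOn_tsum_of_summable_norm hf (fun n => by fun_prop)
    Metric.isOpen_ball fun n z hz => ?_
  rw [norm_mul, norm_pow]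
  have : ‖z‖ ≤ ρ := (mem_ball_zero_iff.1 hz).le
  gcongr

theorem psSum_expand (φ : k →+* ℂ) {n : ℕ} (hn : n ≠ 0) (f : PowerSeries k) (z : ℂ) :
    psSum φ (PowerSeries.expand n hn f) z = psSum φ f (z ^ n) := by
  have hinj : Function.Injective fun m : ℕ => n * m := fun _ _ h =>
    Nat.eq_of_mul_eq_mul_left (Nat.pos_of_ne_zero hn) h
  rw [psSum, psSum, ← hinj.tsum_eq]
  · refine tsum_congr fun m => ?_
    rw [PowerSeries.coeff_expand_mul, pow_mul]
  · intro m hm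
    by_contra h
    refine hm ?_
    dsimp only
    rw [PowerSeries.coeff_expand_of_not_dvd _ _ _ fun ⟨c, hc⟩ => h ⟨c, hc.symm⟩, map_zero, zero_mul]

theorem expand_mem_convSubring (φ : k →+* ℂ) {n : ℕ} (hn : n ≠ 0) {f : PowerSeries k}
    (hf : f ∈ convSubring φ) : PowerSeries.expand n hn f ∈ convSubring φ := by
  obtain ⟨ρ, hρ, h⟩ := hf
  have hmin : 0 < min ρ 1 := lt_min hρ one_pos
  refine ⟨min ρ 1, hmin, ?_⟩
  have h1 : AbsConv φ f (min ρ 1 ^ n) := h.mono (by positivity)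
    ((pow_le_of_le_one hmin.le (min_le_right _ _) hn).trans (min_le_left _ _))
  have hinj : Function.Injective fun m : ℕ => n * m := fun _ _ h =>
    Nat.eq_of_mul_eq_mul_left (Nat.pos_of_ne_zero hn) h
  refine (hinj.summable_iff fun m hm => ?_).1 (h1.congr fun m => ?_)
  · rw [PowerSeries.coeff_expand_of_not_dvd _ _ _ fun ⟨c, hc⟩ => hm ⟨c, hc.symm⟩, map_zero,
      norm_zero, zero_mul]
  · dsimp only [Function.comp]
    rw [PowerSeries.coeff_expand_mul, pow_mul]

theorem sum_smul_mem_convSubring (φ : k →+* ℂ) {ι : Type*} [Fintype ι] {g : ι → PowerSeries k}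
    (hg : ∀ i, g i ∈ convSubring φ) (T : ι → k[X]) : ∑ j, T j • g j ∈ convSubring φ :=
  sum_mem fun j _ => by
    rw [polynomial_smul_eq]
    exact mul_mem (coe_mem_convSubring φ _) (hg j)

theorem eventually_eval_mul_eq (φ : k →+* ℂ) {q : ℕ} (hq : 2 ≤ q) (hq0 : q ≠ 0) {ι : Type*}
    [Fintype ι] [DecidableEq ι] {g : ι → PowerSeries k} (hg : ∀ i, g i ∈ convSubring φ)
    {A : Matrix ι ι k[X]} {α : k} (hα1 : ‖φ α‖ < 1) {f : PowerSeries k} {T : ι → k[X]}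
    (hf : f = ∑ j, T j • g j) {F : ℂ → ℂ} (hF : MeromorphicOn F (Metric.ball 0 1))
    (hF0 : ∀ᶠ z in 𝓝 0, F z = psSum φ f z) (hFα : AnalyticAt ℂ F (φ α)) :
    ∀ᶠ m in atTop, ∀ am : k[X], (∀ i, am • g i =
      ∑ j, iterMat q A m i j • PowerSeries.expand (q ^ m) (pow_ne_zero _ hq0) (g j)) →
      φ (am.eval α) * F (φ α) = ∑ j, φ ((T j).eval α) *
        ∑ l, φ ((iterMat q A m j l).eval α) * psSum φ (g l) (φ α ^ q ^ m) := by
  obtain ⟨r, hr1, hr2⟩ := exists_between hα1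
  have hr0 : 0 < r := (norm_nonneg _).trans_lt hr1
  choose ρ hρ hgρ using hg
  have hrt : Tendsto (fun m => r ^ q ^ m) atTop (𝓝 0) :=
    (tendsto_pow_atTop_nhds_zero_of_lt_one hr0.le hr2).comp
      (tendsto_pow_atTop_atTop_of_one_lt (by lia : 1 < q))
  have hev : ∀ᶠ m in atTop, ∀ j, r ^ q ^ m < ρ j :=
    eventually_all.2 fun j => hrt.eventually (gt_mem_nhds (hρ j))
  have hg' : ∀ i, g i ∈ convSubring φ := fun i => ⟨ρ i, hρ i, hgρ i⟩
  have hf' : f ∈ convSubring φ := hf ▸ sum_smul_mem_convSubring φ hg' T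
  filter_upwards [hev] with m hm am ham
  have hqm : q ^ m ≠ 0 := pow_ne_zero _ hq0
  let H : ℂ → ℂ := fun z => ∑ j, ((T j).map φ).eval z *
    ∑ l, ((iterMat q A m j l).map φ).eval z * psSum φ (g l) (z ^ q ^ m)
  have hHan : ∀ z ∈ Metric.ball (0 : ℂ) r, AnalyticAt ℂ H z := by
    have hd : DifferentiableOn ℂ H (Metric.ball 0 r) := by
      refine DifferentiableOn.fun_sum fun j _ => DifferentiableOn.mul
        (Polynomial.differentiable _).differentiableOn (DifferentiableOn.fun_sum fun l _ =>
          DifferentiableOn.mul (Polynomial.differentiable _).differentiableOn ?_)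
      refine (hgρ l).differentiableOn.comp (differentiable_pow _).differentiableOn fun z hz => ?_
      rw [mem_ball_zero_iff] at hz ⊢
      rw [norm_pow]
      exact (pow_le_pow_left₀ (norm_nonneg _) hz.le _).trans_lt (hm l)
    exact fun z hz => hd.analyticAt (Metric.isOpen_ball.mem_nhds hz)
  have hαr : φ α ∈ Metric.ball (0 : ℂ) r := mem_ball_zero_iff.2 hr1
  have hpoly : ∀ z, AnalyticAt ℂ (fun z => (am.map φ).eval z) z := fun z =>
    (Polynomial.differentiable _).analyticAt z
  have hzero : ∀ᶠ z in 𝓝 0, (am.map φ).eval z * F z - H z = 0 := by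
    let W : MvPolynomial ι k[X] := ∑ j, MvPolynomial.C (T j) *
      ∑ l, MvPolynomial.C (iterMat q A m j l) * MvPolynomial.X l
    have hW : MvPolynomial.aeval (fun l => PowerSeries.expand (q ^ m) hqm (g l)) W =
        (am : PowerSeries k) * f := by
      rw [← polynomial_smul_eq, hf, Finset.smul_sum, map_sum]
      refine Finset.sum_congr rfl fun j _ => ?_
      rw [map_mul, MvPolynomial.algHom_C, ← Algebra.smul_def, smul_comm, ham, map_sum]
      congr 1
      refine Finset.sum_congr rfl fun l _ => ?_
      rw [map_mul, MvPolynomial.algHom_C, ← Algebra.smul_def, MvPolynomial.aeval_X]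
    filter_upwards [hF0, eventually_psSum_mul φ (coe_mem_convSubring φ am) hf',
      eventually_psSum_aeval φ (fun l => expand_mem_convSubring φ hqm (hg' l)) W] with z h1 h2 h3
    rw [hW, h2, psSum_coe, ← h1] at h3
    rw [h3, sub_eq_zero, MvPolynomial.eval₂_sum]
    refine Finset.sum_congr rfl fun j _ => ?_
    rw [MvPolynomial.eval₂_mul, MvPolynomial.eval₂_C, MvPolynomial.eval₂_sum]
    congr 1
    refine Finset.sum_congr rfl fun l _ => ?_
    rw [MvPolynomial.eval₂_mul, MvPolynomial.eval₂_C, MvPolynomial.eval₂_X, psSum_expand]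
    rfl
  have key := eq_zero_of_meromorphicOn_ball hr0 (G := fun z => (am.map φ).eval z * F z - H z)
    (fun z hz => ((hpoly z).meromorphicAt.mul (hF z (Metric.ball_subset_ball hr2.le hz))).sub
      (hHan z hz).meromorphicAt) hzero hαr
    (((hpoly _).mul hFα).sub (hHan _ hαr)).continuousAt
  simp only [H] at key
  rw [sub_eq_zero, Polynomial.eval_map_apply] at key
  rw [key]
  simp only [Polynomial.eval_map_apply]

end Mahler

namespace Mahler

open Polynomial Filter Topology

variable {k : Type*} [Field k]

theorem exists_finset_forall_eval_pow_ne_zero (φ : k →+* ℂ) {q : ℕ} (hq : 2 ≤ q) {c : k[X]}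
    (hc : c ≠ 0) {R : ℝ} (hR0 : 0 < R) (hR1 : R < 1) :
    ∃ S : Finset k, ∀ α, α ≠ 0 → ‖φ α‖ < R → α ∉ S → ∀ j, c.eval (α ^ q ^ j) ≠ 0 := by
  classical
  have hRt : Tendsto (fun m => R ^ q ^ m) atTop (𝓝 0) :=
    (tendsto_pow_atTop_nhds_zero_of_lt_one hR0.le hR1).comp
      (tendsto_pow_atTop_atTop_of_one_lt (by lia : 1 < q))
  have hev : ∀ᶠ m in atTop, ∀ x ∈ c.roots.toFinset, x ≠ 0 → R ^ q ^ m < ‖φ x‖ := by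
    rw [eventually_all_finset]
    intro x _
    by_cases hx : x = 0
    · exact Eventually.of_forall fun _ h => absurd hx h
    · filter_upwards [hRt.eventually (gt_mem_nhds (norm_pos_iff.2 ((_root_.map_ne_zero φ).2 hx)))]
        with m hm _ using hm
  obtain ⟨J, hJ⟩ := eventually_atTop.1 hev
  have hqpos : ∀ j, 0 < q ^ j := fun j => pow_pos (by lia) j
  refine ⟨(Finset.range J).biUnion fun j => (expand k (q ^ j) c).roots.toFinset,
    fun α hα0 hαR hαS j h0 => ?_⟩
  rcases lt_or_ge j J with h | h
  · refine hαS (Finset.mem_biUnion.2 ⟨j, Finset.mem_range.2 h, Multiset.mem_toFinset.2 ?_⟩)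
    rw [mem_roots ((expand_ne_zero (hqpos j)).2 hc), IsRoot, expand_eval]
    exact h0
  · have h1 := hJ j h (α ^ q ^ j) (Multiset.mem_toFinset.2 ((mem_roots hc).2 h0))
      (pow_ne_zero _ hα0)
    rw [map_pow, norm_pow] at h1
    exact absurd (pow_le_pow_left₀ (norm_nonneg _) hαR.le _) (not_le.2 h1)

theorem exists_finset_forall_lift [CharZero k] [IsAlgClosed k] [Algebra.IsAlgebraic ℚ k]
    (φ : k →+* ℂ) {q : ℕ} (hq : 2 ≤ q) (hq0 : q ≠ 0) {τ : Type*} [Finite τ]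
    {f : τ → PowerSeries k} (hconv : ∀ i, f i ∈ convSubring φ)
    (hf : ∀ i, ∃ (m : ℕ) (p : ℕ → k[X]), (∃ j, j ≤ m ∧ p j ≠ 0) ∧
      ∑ j ∈ Finset.range (m + 1), p j • (PowerSeries.expand q hq0)^[j] (f i) = 0)
    {R : ℝ} (hR0 : 0 < R) (hR1 : R < 1) :
    ∃ S : Finset k, ∀ α, α ≠ 0 → ‖φ α‖ < R → α ∉ S → ∀ F : τ → ℂ → ℂ,
      (∀ i, MeromorphicOn (F i) (Metric.ball 0 1)) →
      (∀ i, ∀ᶠ z in 𝓝 0, F i z = psSum φ (f i) z) → (∀ i, AnalyticAt ℂ (F i) (φ α)) →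
      ∀ (P : MvPolynomial τ k) (d : ℕ), P.IsHomogeneous d →
      MvPolynomial.eval₂ φ (fun i => F i (φ α)) P = 0 →
      ∃ Q : MvPolynomial τ k[X], Q.IsHomogeneous d ∧ MvPolynomial.aeval f Q = 0 ∧
        MvPolynomial.map (evalRingHom α) Q = P := by
  obtain ⟨n, g, a, b, A, B, T, -, ha0, hb0, hA, hB, hAB, hT, hspan⟩ :=
    exists_mahler_system hq hq0 f hf
  have hiter : ∀ (j : ℕ) (i : τ), (PowerSeries.expand q hq0)^[j] (f i) ∈ convSubring φ := by
    intro j i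
    induction j with
    | zero => exact hconv i
    | succ j ih =>
      rw [Function.iterate_succ_apply']
      exact expand_mem_convSubring φ hq0 ih
  have hg : ∀ j, g j ∈ convSubring φ := by
    intro j
    refine Submodule.span_induction (p := fun y _ => y ∈ convSubring φ) ?_ (zero_mem _)
      (fun x y _ _ hx hy => add_mem hx hy) (fun c x _ hx => ?_) (hspan j)
    · rintro _ ⟨x, rfl⟩
      exact hiter x.2 x.1
    · rw [polynomial_smul_eq]
      exact mul_mem (coe_mem_convSubring φ c) hx
  obtain ⟨h, hh0, hh⟩ := exists_homogeneous_relation hT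
  obtain ⟨S, hS⟩ := exists_finset_forall_eval_pow_ne_zero φ hq
    (mul_ne_zero (mul_ne_zero ha0 hb0) hh0) hR0 hR1
  refine ⟨S, fun α hα0 hαR hαS F hF hF0 hFα P d hP hPF => ?_⟩
  have hev := hS α hα0 hαR hαS
  have hα1 : ‖φ α‖ < 1 := hαR.trans hR1
  simp only [eval_mul] at hev
  obtain ⟨Q, hQ, hQg, hQα⟩ := exists_homogeneous_lift φ hq hq0 hg ha0 hb0 hA hB hAB hα0 hα1
    (fun j => by
      rw [eval_mul]
      exact left_ne_zero_of_mul (hev j))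
    (matSubst_isHomogeneous (T.map (evalRingHom α)) hP) (by
      have hval := eventually_all.2 fun i => eventually_eval_mul_eq φ hq hq0 hg (A := A) hα1
        (hT i) (hF i) (hF0 i) (hFα i)
      filter_upwards [hval] with m hm
      obtain ⟨am, ham0, ham⟩ := exists_iterate hq0 hA
        (fun j => left_ne_zero_of_mul (left_ne_zero_of_mul (hev j))) m
      rw [eval₂_matSubst]
      have h1 := eval₂_mul_of_isHomogeneous φ (φ (am.eval α)) (fun i => F i (φ α)) hP
      rw [hPF, mul_zero] at h1
      rw [← h1]
      congr 1
      funext i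
      exact (hm i am ham).symm)
  refine hh α ?_ P d hP Q hQ hQg hQα
  have := right_ne_zero_of_mul (hev 0)
  rwa [pow_zero, pow_one] at this

end Mahler

namespace Mahler

open Polynomial Filter Topology

theorem psSigma_eq_expand {q : ℕ} (hq : q ≠ 0) (f : PowerSeries ℂ) :
    psSigma q f = PowerSeries.expand q hq f := by
  ext n
  simp [psSigma, PowerSeries.coeff_expand]

theorem map_expand_iterate {k : Type*} [Field k] (φ : k →+* ℂ) {q : ℕ} (hq : q ≠ 0) (j : ℕ)
    (f : PowerSeries k) :
    PowerSeries.map φ ((PowerSeries.expand q hq)^[j] f) =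
      (psSigma q)^[j] (PowerSeries.map φ f) := by
  induction j generalizing f with
  | zero => rfl
  | succ j ih =>
    rw [Function.iterate_succ_apply, Function.iterate_succ_apply, ih, psSigma_eq_expand hq]
    congr 1
    ext n
    simp only [PowerSeries.coeff_map, PowerSeries.coeff_expand]
    split_ifs <;> simp

theorem map_injective_powerSeries {k : Type*} [Field k] (φ : k →+* ℂ) :
    Function.Injective (PowerSeries.map φ) := by
  intro f g h
  ext n
  apply φ.injective
  simpa using congrArg (PowerSeries.coeff n) h

theorem map_coe_polynomial {k : Type*} [Field k] (φ : k →+* ℂ) (p : k[X]) :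
    PowerSeries.map φ (p : PowerSeries k) = polyPS (p.map φ) := by
  ext n
  simp [polyPS]

theorem mem_convSubring_of_eventually_hasSum {k : Type*} [Field k] (φ : k →+* ℂ)
    {f : PowerSeries k} {F : ℂ → ℂ}
    (h : ∀ᶠ z in 𝓝 (0 : ℂ), HasSum (fun n => φ (PowerSeries.coeff n f) * z ^ n) (F z)) :
    f ∈ convSubring φ := by
  obtain ⟨ε, hε, h⟩ := Metric.eventually_nhds_iff.1 h
  have hz : dist (((ε / 2 : ℝ) : ℂ)) 0 < ε := by
    rw [dist_zero_right, Complex.norm_real, Real.norm_of_nonneg (by positivity)]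
    linarith
  have hs := (h hz).summable.norm
  refine ⟨ε / 2, by positivity, ?_⟩
  refine hs.congr fun n => ?_
  rw [norm_mul, norm_pow, Complex.norm_real, Real.norm_of_nonneg (by positivity)]

theorem exists_map_eq_of_isM {k : Type*} [Field k] {φ : k →+* ℂ}
    (hφ : ∀ x, IsAlgebraic ℚ x → x ∈ φ.range) {q : ℕ} (hq : q ≠ 0) {f : PowerSeries ℂ}
    (hf : IsM q f) :
    ∃ g : PowerSeries k, PowerSeries.map φ g = f ∧
      ∃ (m : ℕ) (p : ℕ → k[X]), (∃ j, j ≤ m ∧ p j ≠ 0) ∧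
        ∑ j ∈ Finset.range (m + 1), p j • (PowerSeries.expand q hq)^[j] g = 0 := by
  obtain ⟨hc, m, p, hp, ⟨i, him, hi⟩, hsum⟩ := hf
  choose c hc using fun n => hφ _ (hc n)
  have hp' : ∀ i, ∃ P : k[X], P.map φ = p i := fun i => by
    refine (Polynomial.lifts_iff_coeff_lifts (f := φ) _).2 fun n => ?_
    exact hφ _ (hp i n)
  choose P hP using hp'
  have hg : PowerSeries.map φ (PowerSeries.mk c) = f := by
    ext n
    simp [hc]
  refine ⟨PowerSeries.mk c, hg, m, P, ⟨i, him, fun h => hi (by rw [← hP, h, Polynomial.map_zero])⟩,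
    map_injective_powerSeries φ ?_⟩
  rw [map_zero, map_sum, ← hsum]
  refine Finset.sum_congr rfl fun j _ => ?_
  rw [polynomial_smul_eq, map_mul, map_coe_polynomial, map_expand_iterate, hg, hP]

theorem banal_map {k : Type*} [Field k] [CharZero k] [Algebra.IsAlgebraic ℚ k] (φ : k →+* ℂ)
    {r : ℕ} {f : Fin r → PowerSeries k}
    {Q : MvPolynomial (Fin r) k[X]} {d : ℕ} (hQ : Q.IsHomogeneous d)
    (hf : MvPolynomial.aeval f Q = 0) (α : k) :
    Banal (fun i => PowerSeries.map φ (f i)) (φ α)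
      (MvPolynomial.map φ (MvPolynomial.map (evalRingHom α) Q)) := by
  refine ⟨MvPolynomial.map (mapRingHom φ) Q, fun v n => ?_, ⟨d, hQ.map _⟩, ?_, ?_⟩
  · rw [MvPolynomial.coeff_map, coe_mapRingHom, coeff_map]
    exact IsAlgebraic.algHom φ.toRatAlgHom (Algebra.IsAlgebraic.isAlgebraic _)
  · rw [MvPolynomial.eval₂_map]
    have h := congrArg (PowerSeries.map φ) hf
    rw [map_zero, MvPolynomial.aeval_def, MvPolynomial.hom_eval₂] at h
    rw [← h]
    congr 1
    ext : 1
    · ext; simp [polyPS, algebraMap_polynomial_apply]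
    · simp [polyPS, algebraMap_polynomial_apply]
  · rw [MvPolynomial.map_map, MvPolynomial.map_map]
    congr 1
    ext <;> simp

end Mahler

/-- For fixed M_q-functions `f₁, …, f_r` and `0 < R < 1` there is a finite
set `S_R ⊂ ℚ̄` such that a non-banal homogeneous algebraic relation over `ℚ̄` among
`f₁(α), …, f_r(α)`, for `α` algebraic with `0 < |α| < R` not a pole of any `f_i`, can only
exist when `α ∈ S_R`. -/
theorem M_nonbanal_relations_sporadic
    (q : ℕ) (hq : 2 ≤ q)
    (r : ℕ) (f : Fin r → PowerSeries ℂ) (hM : ∀ i, IsM q (f i))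
    (R : ℝ) (hR0 : 0 < R) (hR1 : R < 1) :
    ∃ S : Finset ℂ, (∀ x ∈ S, IsAlgebraic ℚ x) ∧
      ∀ α : ℂ, IsAlgebraic ℚ α → 0 < ‖α‖ → ‖α‖ < R →
        ∀ v : Fin r → ℂ, (∀ i, MahlerValue (f i) α (v i)) →
        (∃ (P : MvPolynomial (Fin r) ℂ) (d : ℕ),
            P.IsHomogeneous d ∧
            (∀ w, IsAlgebraic ℚ (MvPolynomial.coeff w P)) ∧
            MvPolynomial.eval v P = 0 ∧
            ¬ Banal f α P) →
        α ∈ S := by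
  classical
  have : IsAlgClosed (algebraicClosure ℚ ℂ) :=
    (algebraicClosure.isAlgClosure ℚ ℂ).isAlgClosed
  have hq0 : q ≠ 0 := by lia
  let φ : algebraicClosure ℚ ℂ →+* ℂ := algebraMap _ _
  have hφ : ∀ x, IsAlgebraic ℚ x → x ∈ φ.range := fun x hx =>
    ⟨⟨x, mem_algebraicClosure_iff.2 hx⟩, rfl⟩
  have hφa : ∀ x, IsAlgebraic ℚ (φ x) := fun x => mem_algebraicClosure_iff.1 x.2
  have : Algebra.IsAlgebraic ℚ (algebraicClosure ℚ ℂ) :=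
    ⟨fun x => (isAlgebraic_algHom_iff φ.toRatAlgHom φ.injective).1 (hφa x)⟩
  choose g hg hgM using fun i => Mahler.exists_map_eq_of_isM hφ hq0 (hM i)
  have hcoeff : ∀ i n, PowerSeries.coeff n (f i) = φ (PowerSeries.coeff n (g i)) := fun i n => by
    rw [← hg, PowerSeries.coeff_map]
  by_cases hconv : ∀ i, g i ∈ Mahler.convSubring φ
  · obtain ⟨S, hS⟩ := Mahler.exists_finset_forall_lift φ hq hq0 hconv hgM hR0 hR1
    refine ⟨S.image φ, fun x hx => ?_, ?_⟩
    · obtain ⟨y, -, rfl⟩ := Finset.mem_image.1 hx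
      exact hφa y
    rintro α hα hα0 hαR v hv ⟨P, d, hPd, hPa, hPv, hPb⟩
    by_contra hαS
    obtain ⟨α, rfl⟩ := hφ α hα
    choose F hFm hFs hFa hFv using hv
    obtain ⟨P, rfl⟩ : ∃ P', MvPolynomial.map φ P' = P := by
      rw [← Set.mem_range,
        MvPolynomial.mem_range_map_iff_coeffs_subset]
      intro x hx
      obtain ⟨w, -, rfl⟩ := MvPolynomial.mem_coeffs_iff.1 hx
      exact hφ _ (hPa w)
    obtain ⟨Q, hQd, hQ, rfl⟩ := hS α (by rintro rfl; simp at hα0) hαR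
      (fun h => hαS (Finset.mem_image_of_mem _ h)) F hFm
      (fun i => (hFs i).mono fun z hz => by simpa [Mahler.psSum, hcoeff] using hz.tsum_eq.symm)
      hFa P d (hPd.of_map φ.injective) (by
        rw [MvPolynomial.eval_map] at hPv
        simpa only [hFv] using hPv)
    refine hPb ?_
    simpa only [hg] using Mahler.banal_map φ hQd hQ α
  · refine ⟨∅, by simp, ?_⟩
    rintro α - - - v hv -
    refine (hconv fun i => ?_).elim
    obtain ⟨F, -, hF, -⟩ := hv i
    exact Mahler.mem_convSubring_of_eventually_hasSum φ (F := F)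
      (by simpa only [hcoeff] using hF)
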